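/- Let f₀ := x¹⁰ + a₁x⁹ + a₂x⁸ + a₃x⁷ + a₄x⁶ + a₅x⁵ + a₆x⁴ + a₇x³ + a₈x² + a₉x + a₁₀, g₀ := x² − 6x + a₁₁, g₁ := x³ + a₁₂x² + a₁₃x + a₁₄, with a₁,…,a₁₄ the explicit rational functions in α given in the context, and set f(x, α, t) := f₀³·(x − 3) − t·g₀⁸·g₁⁴·x, a polynomial of degree 31 in x. Then the Galois group of f over the rational function field ℚ(α, t) in two algebraically independent transcendentals α, t is isomorphic to PSL₅(𝔽₂), the projective special linear group of degree 5 over the field with two elements. -/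

import Mathlib

/-!
Statement 0: the polynomial `f(x, α, t) = f₀³·(x−3) − t·g₀⁸·g₁⁴·x` of degree 31 in `x`
has Galois group `PSL₅(𝔽₂)` over the rational function field `ℚ(α, t)`.
We model `ℚ(α, t)` as `RatFunc (RatFunc ℚ)`, with `α = RatFunc.C RatFunc.X` and
`t = RatFunc.X` algebraically independent transcendentals over `ℚ`.
-/

open Polynomial

namespace PSL52Family

/-- The coefficient `a₁` as a rational function of `α`. -/
noncomputable def a1 {F : Type*} [Field F] (α : F) : F :=
  2 * (α^4 - 37/2*α^3 - 3*α^2 - 109/2*α + 91) / ((α - 2) * (α + 1)^2)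

/-- The coefficient `a₂` as a rational function of `α`. -/
noncomputable def a2 {F : Type*} [Field F] (α : F) : F :=
  -12 * ((α^2 - 5/2*α - 8) * (α^3 + 10*α^2 + 17*α + 44)) / ((α - 2) * (α + 1) * (α + 4))

/-- The coefficient `a₃` as a rational function of `α`. -/
noncomputable def a3 {F : Type*} [Field F] (α : F) : F :=
  -8 * (α^6 - 93/2*α^5 - 261/2*α^4 - 1343/2*α^3 - 507/2*α^2 - 963*α + 3076) /
    ((α - 2) * (α + 1) * (α + 4))

/-- The coefficient `a₄` as a rational function of `α`. -/
noncomputable def a4 {F : Type*} [Field F] (α : F) : F :=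
  62 * (α^9 + 159/31*α^8 - 1410/31*α^7 - 3834/31*α^6 - 987*α^5 - 52905/31*α^4 - 72480/31*α^3
      - 50196/31*α^2 + 256224/31*α - 56384/31) / ((α - 2)^2 * (α + 1) * (α + 4)^2)

/-- The coefficient `a₅` as a rational function of `α`. -/
noncomputable def a5 {F : Type*} [Field F] (α : F) : F :=
  -36 * (α^9 + 241/6*α^8 + 226/3*α^7 + 521/3*α^6 + 1483/3*α^5 - 19319/6*α^4 - 12872/3*α^3
      - 58186/3*α^2 - 51344/3*α + 30944/3) / ((α - 2)^2 * (α + 4)^2)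

/-- The coefficient `a₆` as a rational function of `α`. -/
noncomputable def a6 {F : Type*} [Field F] (α : F) : F :=
  -92 * ((α + 1)^2 * (α^7 - 337/23*α^6 - 237/23*α^5 - 2075/23*α^4 - 7724/23*α^3 + 2166/23*α^2
      - 35740/23*α + 44048/23)) / ((α - 2)^2 * (α + 4))

/-- The coefficient `a₇` as a rational function of `α`. -/
noncomputable def a7 {F : Type*} [Field F] (α : F) : F :=
  152 * ((α + 1)^3 * (α^7 + 5/38*α^6 - 489/38*α^5 - 407/38*α^4 - 4367/38*α^3 - 3768/19*α^2
      - 2882/19*α - 23192/19)) / ((α - 2)^2 * (α + 4))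

/-- The coefficient `a₈` as a rational function of `α`. -/
noncomputable def a8 {F : Type*} [Field F] (α : F) : F :=
  -87 * ((α + 1)^4 * (α^6 + 96/29*α^5 + 66/29*α^4 + 532/29*α^3 - 3/29*α^2 + 300/29*α + 4724/29)) /
    ((α - 2)^2)

/-- The coefficient `a₉` as a rational function of `α`. -/
noncomputable def a9 {F : Type*} [Field F] (α : F) : F :=
  18 * ((α + 1)^6 * (α^5 + 53/6*α^4 + 70/3*α^3 + 111/2*α^2 + 376/3*α + 94/3)) / ((α - 2)^2)

/-- The coefficient `a₁₀` as a rational function of `α`. -/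
noncomputable def a10 {F : Type*} [Field F] (α : F) : F :=
  -6 * ((α + 1)^9 * (α + 4)) / (α - 2)

/-- The coefficient `a₁₁` as a rational function of `α`. -/
noncomputable def a11 {F : Type*} [Field F] (α : F) : F := -(α + 1)^2

/-- The coefficient `a₁₂` as a rational function of `α`. -/
noncomputable def a12 {F : Type*} [Field F] (α : F) : F :=
  (α + 1) * (α^2 - 16*α - 8) / ((α - 2) * (α + 4))

/-- The coefficient `a₁₃` as a rational function of `α`. -/
noncomputable def a13 {F : Type*} [Field F] (α : F) : F := -3*(α + 1)^2

/-- The coefficient `a₁₄` as a rational function of `α`. -/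
noncomputable def a14 {F : Type*} [Field F] (α : F) : F := (α + 1)^3 * (α + 4) / (α - 2)

/-- `f₀ = x¹⁰ + a₁x⁹ + ⋯ + a₁₀`. -/
noncomputable def f0 {F : Type*} [Field F] (α : F) : Polynomial F :=
  X^10 + C (a1 α) * X^9 + C (a2 α) * X^8 + C (a3 α) * X^7 + C (a4 α) * X^6 + C (a5 α) * X^5
    + C (a6 α) * X^4 + C (a7 α) * X^3 + C (a8 α) * X^2 + C (a9 α) * X + C (a10 α)

/-- `g₀ = x² − 6x + a₁₁`. -/
noncomputable def g0 {F : Type*} [Field F] (α : F) : Polynomial F :=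
  X^2 - 6*X + C (a11 α)

/-- `g₁ = x³ + a₁₂x² + a₁₃x + a₁₄`. -/
noncomputable def g1 {F : Type*} [Field F] (α : F) : Polynomial F :=
  X^3 + C (a12 α) * X^2 + C (a13 α) * X + C (a14 α)

/-- The family `f(x, α, t) = f₀³·(x − 3) − t·g₀⁸·g₁⁴·x`, as a polynomial in `x` over `F`,
where `α, t : F`. -/
noncomputable def fFamily {F : Type*} [Field F] (α t : F) : Polynomial F :=
  (f0 α)^3 * (X - 3) - C t * (g0 α)^8 * (g1 α)^4 * X

/-- The vector space `𝔽₂⁵`. -/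
abbrev V5 := Fin 5 → ZMod 2

theorem V5_add_self (x : V5) : x + x = 0 := by
  ext i; exact CharTwo.add_self_eq_zero _

/-- An action of an element of order 5 on a finite set: cardinality mod 5. -/
theorem card_modEq_card_fixed {X : Type*} [Finite X] (e : Equiv.Perm X) (he : e ^ 5 = 1) :
    Nat.card X ≡ Nat.card {x : X // e x = x} [MOD 5] := by
  have : Fact (Nat.Prime 5) := ⟨by norm_num⟩
  have hp : IsPGroup 5 (Subgroup.zpowers e) := by
    rintro ⟨g, k, rfl⟩
    refine ⟨1, ?_⟩
    ext1
    change (e ^ k) ^ (5 ^ 1) = 1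
    rw [pow_one, ← zpow_natCast, ← zpow_mul, mul_comm, zpow_mul, zpow_natCast, he, one_zpow]
  refine (hp.card_modEq_card_fixedPoints X).trans ?_
  have : MulAction.fixedPoints (Subgroup.zpowers e) X = {x : X | e x = x} := by
    ext x
    constructor
    · intro h
      exact h ⟨e, Subgroup.mem_zpowers e⟩
    · rintro h ⟨g, hg⟩
      have h2 : e ∈ MulAction.stabilizer (Equiv.Perm X) x := h
      exact (Subgroup.zpowers_le.mpr h2) hg
  rw [this]
  rfl

theorem eq_top_of_transvection (Γ : Subgroup (V5 ≃ₗ[ZMod 2] V5))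
    (htrans : ∀ a b : V5, a ≠ 0 → b ≠ 0 → ∃ g ∈ Γ, g a = b)
    (u₁ : V5) (φ₁ : Module.Dual (ZMod 2) V5) (hu₁ : u₁ ≠ 0) (hφ₁ : φ₁ ≠ 0) (hφu : φ₁ u₁ = 0)
    (hτ : ∃ g ∈ Γ, ∀ x, g x = x + φ₁ x • u₁)
    (σ : V5 ≃ₗ[ZMod 2] V5) (hσ : σ ∈ Γ) (hσ5 : σ ^ 5 = 1) (hσ1 : σ ≠ 1) : Γ = ⊤ := by
  have hcV : Nat.card V5 = 32 := by simp
  have hcD : Nat.card (Module.Dual (ZMod 2) V5) = 32 := by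
    rw [Module.natCard_eq_pow_finrank (K := ZMod 2), Subspace.dual_finrank_eq]; simp
  have : Finite (Module.Dual (ZMod 2) V5) := Nat.finite_of_card_ne_zero (by rw [hcD]; norm_num)
  let F : AddSubgroup V5 :=
    { carrier := {x | σ x = x}
      zero_mem' := by simp
      add_mem' := by intro a b ha hb; simp only [Set.mem_ofPred_eq] at *; rw [map_add, ha, hb]
      neg_mem' := by intro a ha; simp only [Set.mem_ofPred_eq] at *; rw [map_neg, ha] }
  have hdvd : ∀ {A : Type} [AddGroup A] (H : AddSubgroup A), Nat.card A = 32 → H ≠ ⊤ →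
      Nat.card H ∈ ({1, 2, 4, 8, 16} : Finset ℕ) := by
    intro A _ H hA hH
    have : Finite A := Nat.finite_of_card_ne_zero (by rw [hA]; norm_num)
    have h1 : Nat.card H ∣ 2 ^ 5 := by
      have := H.card_addSubgroup_dvd_card; rw [hA] at this; exact this
    obtain ⟨k, hk, hk2⟩ := (Nat.dvd_prime_pow Nat.prime_two).1 h1
    have h2 : Nat.card H ≠ 32 := fun h => hH (AddSubgroup.eq_top_of_card_eq H (h.trans hA.symm))
    interval_cases k <;> simp_all
  have hF : Nat.card F = 2 := by
    have h1 : Nat.card V5 ≡ Nat.card F [MOD 5] := by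
      refine card_modEq_card_fixed σ.toEquiv ?_
      ext1 x
      exact congrArg (fun g : V5 ≃ₗ[ZMod 2] V5 => g x) hσ5
    have h2 := hdvd F hcV (fun h => hσ1 (by
      ext1 x
      have : x ∈ F := h ▸ AddSubgroup.mem_top x
      exact this))
    rw [hcV] at h1
    simp only [Finset.mem_insert, Finset.mem_singleton] at h2
    rcases h2 with h | h | h | h | h <;> rw [h] at h1 <;>
      first | exact h | (exact absurd h1 (by decide))
  obtain ⟨u, hu, hFu⟩ : ∃ u : V5, u ≠ 0 ∧ ∀ x, σ x = x ↔ x = 0 ∨ x = u := by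
    rw [Nat.card_eq_two_iff' (0 : F)] at hF
    obtain ⟨⟨u, hu⟩, hu0, huu⟩ := hF
    refine ⟨u, fun h => hu0 (Subtype.ext h), fun x => ⟨fun hx => ?_, ?_⟩⟩
    · by_cases h : x = 0
      · exact Or.inl h
      · right
        have := huu ⟨x, hx⟩ (fun h' => h (congrArg Subtype.val h'))
        exact congrArg Subtype.val this
    · rintro (rfl | rfl)
      · simp
      · exact hu
  have hσu : σ u = u := (hFu u).2 (Or.inr rfl)
  let U : AddSubgroup (Module.Dual (ZMod 2) V5) :=
    { carrier := {φ | φ u = 0}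
      zero_mem' := by simp
      add_mem' := by intro a b ha hb; simp only [Set.mem_ofPred_eq] at *; simp [ha, hb]
      neg_mem' := by intro a ha; simp only [Set.mem_ofPred_eq] at *; simp [ha] }
  let W : AddSubgroup (Module.Dual (ZMod 2) V5) :=
    { carrier := {φ | φ u = 0 ∧ ∃ g ∈ Γ, ∀ x, g x = x + φ x • u}
      zero_mem' := ⟨by simp, 1, Γ.one_mem, by simp⟩
      add_mem' := by
        rintro a b ⟨ha, g, hg, hga⟩ ⟨hb, g', hg', hgb⟩
        refine ⟨by simp [ha, hb], g * g', Γ.mul_mem hg hg', fun x => ?_⟩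
        rw [LinearEquiv.mul_apply, hgb, hga]
        simp only [map_add, map_smul, ha, smul_zero, add_zero, LinearMap.add_apply, add_smul]
        abel
      neg_mem' := by
        rintro a ⟨ha, g, hg, hga⟩
        refine ⟨by simp [ha], g, hg, fun x => ?_⟩
        rw [hga, LinearMap.neg_apply, ZMod.neg_eq_self_mod_two] }
  have hUtop : U ≠ ⊤ := by
    intro h
    have : ∀ φ : Module.Dual (ZMod 2) V5, φ u = 0 := fun φ => by
      have : φ ∈ U := h ▸ AddSubgroup.mem_top φ
      exact this
    exact hu ((Module.forall_dual_apply_eq_zero_iff (ZMod 2) u).1 this)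
  have hWU : W ≤ U := fun φ h => h.1
  have hconj : ∀ (g : V5 ≃ₗ[ZMod 2] V5), g ∈ Γ → ∀ (a : V5) (φ : Module.Dual (ZMod 2) V5),
      (∃ h ∈ Γ, ∀ x, h x = x + φ x • a) →
      ∃ h ∈ Γ, ∀ x, h x = x + (φ ∘ₗ (g⁻¹ : V5 ≃ₗ[ZMod 2] V5).toLinearMap) x • g a := by
    rintro g hg a φ ⟨h, hh, hx⟩
    refine ⟨g * h * g⁻¹, Γ.mul_mem (Γ.mul_mem hg hh) (Γ.inv_mem hg), fun x => ?_⟩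
    rw [LinearEquiv.mul_apply, LinearEquiv.mul_apply, hx, map_add, map_smul]
    congr 1
    exact g.apply_symm_apply x
  have hinv : ∀ (g : V5 ≃ₗ[ZMod 2] V5) x, g⁻¹ (g x) = x := fun g x => g.symm_apply_apply x
  have hWne : W ≠ ⊥ := by
    obtain ⟨g, hg, hgu⟩ := htrans u₁ u hu₁ hu
    have h := hconj g hg u₁ φ₁ hτ
    rw [hgu] at h
    intro hbot
    have hmem : φ₁ ∘ₗ (g⁻¹ : V5 ≃ₗ[ZMod 2] V5).toLinearMap ∈ W := by
      refine ⟨?_, h⟩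
      rw [← hgu]
      change φ₁ (g⁻¹ (g u₁)) = 0
      rw [hinv, hφu]
    rw [hbot, AddSubgroup.mem_bot] at hmem
    refine hφ₁ (LinearMap.ext fun x => ?_)
    have := LinearMap.congr_fun hmem (g x)
    change φ₁ (g⁻¹ (g x)) = 0 at this
    rwa [hinv] at this
  have hstab : ∀ g ∈ Γ, g u = u → ∀ φ ∈ W,
      φ ∘ₗ (g⁻¹ : V5 ≃ₗ[ZMod 2] V5).toLinearMap ∈ W := by
    rintro g hg hgu φ ⟨h0, hφ⟩
    have h := hconj g hg u φ hφ
    rw [hgu] at h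
    refine ⟨?_, h⟩
    change φ (g⁻¹ u) = 0
    nth_rewrite 1 [← hgu]
    rw [hinv, h0]
  have hσu' : σ⁻¹ u = u := by nth_rewrite 1 [← hσu]; exact hinv σ u
  let e : Equiv.Perm W :=
    { toFun := fun φ => ⟨φ.1 ∘ₗ (σ⁻¹ : V5 ≃ₗ[ZMod 2] V5).toLinearMap, hstab σ hσ hσu φ.1 φ.2⟩
      invFun := fun φ => ⟨φ.1 ∘ₗ ((σ⁻¹)⁻¹ : V5 ≃ₗ[ZMod 2] V5).toLinearMap,
        hstab σ⁻¹ (Γ.inv_mem hσ) hσu' φ.1 φ.2⟩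
      left_inv := fun φ => Subtype.ext (LinearMap.ext fun x => by
        change φ.1 (σ⁻¹ (σ⁻¹⁻¹ x)) = φ.1 x
        rw [inv_inv, hinv])
      right_inv := fun φ => Subtype.ext (LinearMap.ext fun x => by
        change φ.1 (σ⁻¹⁻¹ (σ⁻¹ x)) = φ.1 x
        rw [hinv]) }
  have hepow : ∀ (n : ℕ) (φ : W) (x : V5), ((e ^ n) φ).1 x = φ.1 ((σ⁻¹ ^ n) x) := by
    intro n
    induction n with
    | zero => intro φ x; rfl
    | succ n ih =>
      intro φ x
      rw [pow_succ, Equiv.Perm.mul_apply, ih, pow_succ', LinearEquiv.mul_apply]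
      rfl
  have he5 : e ^ 5 = 1 := by
    refine Equiv.ext fun φ => Subtype.ext (LinearMap.ext fun x => ?_)
    rw [hepow, inv_pow, hσ5, inv_one]
    rfl
  have hfix : ∀ φ : W, e φ = φ → φ = 0 := by
    intro φ hφ
    have h1 : ∀ x, φ.1 (σ x) = φ.1 x := by
      intro x
      have : (e φ).1 (σ x) = φ.1 (σ x) := by rw [hφ]
      rw [← this]
      change φ.1 (σ⁻¹ (σ x)) = _
      rw [hinv]
    refine Subtype.ext (LinearMap.ext fun x => ?_)
    change φ.1 x = 0
    have h5 : σ (σ (σ (σ (σ x)))) = x :=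
      congrArg (fun g : V5 ≃ₗ[ZMod 2] V5 => g x) hσ5
    have h2 : σ (x + σ x + σ (σ x) + σ (σ (σ x)) + σ (σ (σ (σ x)))) =
        x + σ x + σ (σ x) + σ (σ (σ x)) + σ (σ (σ (σ x))) := by
      simp only [map_add, h5]
      abel
    have h3 : φ.1 (x + σ x + σ (σ x) + σ (σ (σ x)) + σ (σ (σ (σ x)))) = 0 := by
      rcases (hFu _).1 h2 with h | h
      · rw [h, map_zero]
      · rw [h]; exact φ.2.1
    simp only [map_add, h1] at h3
    have h4 : φ.1 x + φ.1 x = 0 := CharTwo.add_self_eq_zero _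
    calc φ.1 x = φ.1 x + φ.1 x + φ.1 x + φ.1 x + φ.1 x := by
          rw [h4, zero_add, h4, zero_add]
      _ = 0 := h3
  have hW : Nat.card W = 16 := by
    have h1 := card_modEq_card_fixed e he5
    have h2 : Nat.card {x : W // e x = x} = 1 := by
      rw [Nat.card_eq_one_iff_unique]
      exact ⟨⟨fun a b => Subtype.ext ((hfix _ a.2).trans (hfix _ b.2).symm)⟩,
        ⟨0, by apply Subtype.ext; exact LinearMap.zero_comp _⟩⟩
    rw [h2] at h1
    have h3 := hdvd W hcD (fun h => hUtop (top_le_iff.1 (h ▸ hWU)))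
    have h4 : Nat.card W ≠ 1 := fun h => hWne ((AddSubgroup.card_eq_one).1 h)
    simp only [Finset.mem_insert, Finset.mem_singleton] at h3
    rcases h3 with h | h | h | h | h
    · exact absurd h h4
    all_goals rw [h] at h1
    · exact absurd h1 (by decide)
    · exact absurd h1 (by decide)
    · exact absurd h1 (by decide)
    · exact h
  have hWU' : W = U := by
    have h3 := hdvd U hcD hUtop
    refine AddSubgroup.eq_of_le_of_card_ge hWU ?_
    rw [hW]
    simp only [Finset.mem_insert, Finset.mem_singleton] at h3
    omega
  have hall : ∀ (a : V5) (φ : Module.Dual (ZMod 2) V5), φ a = 0 →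
      ∃ g ∈ Γ, ∀ x, g x = x + φ x • a := by
    intro a φ ha
    by_cases ha0 : a = 0
    · exact ⟨1, Γ.one_mem, fun x => by simp [ha0]⟩
    obtain ⟨g, hg, hgu⟩ := htrans u a hu ha0
    have hmem : φ ∘ₗ g.toLinearMap ∈ W := by
      rw [hWU']
      change φ (g u) = 0
      rw [hgu, ha]
    obtain ⟨h, hh, hx⟩ := hconj g hg u _ hmem.2
    refine ⟨h, hh, fun x => ?_⟩
    rw [hx, hgu]
    congr 2
    change φ (g (g⁻¹ x)) = φ x
    exact congrArg φ (g.apply_symm_apply x)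
  have key : ∀ M : Matrix (Fin 5) (Fin 5) (ZMod 2), M.det ≠ 0 →
      ∃ g ∈ Γ, ∀ x, g x = M.mulVec x := by
    intro M hM
    refine Matrix.diagonal_transvection_induction_of_det_ne_zero
      (fun M => ∃ g ∈ Γ, ∀ x, g x = M.mulVec x) M hM ?_ ?_ ?_
    · intro D hD
      refine ⟨1, Γ.one_mem, fun x => ?_⟩
      have hz : ∀ z : ZMod 2, z ≠ 0 → z = 1 := by decide
      have : D = 1 := by
        funext i
        refine hz _ fun h => hD ?_
        rw [Matrix.det_diagonal]
        exact Finset.prod_eq_zero (Finset.mem_univ i) h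
      subst this
      simp
    · intro t
      obtain ⟨g, hg, hx⟩ := hall (Pi.single t.i t.c) (LinearMap.proj t.j) (by
        simp [t.hij.symm])
      refine ⟨g, hg, fun x => ?_⟩
      rw [hx, Matrix.TransvectionStruct.toMatrix, Matrix.transvection, Matrix.add_mulVec,
        Matrix.one_mulVec, Matrix.single_mulVec]
      congr 1
      ext k
      simp [Pi.single_apply, Function.update_apply, mul_comm]
    · rintro A B - - ⟨g, hg, hgx⟩ ⟨h, hh, hhx⟩
      refine ⟨g * h, Γ.mul_mem hg hh, fun x => ?_⟩
      rw [LinearEquiv.mul_apply, hhx, hgx, Matrix.mulVec_mulVec]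
  rw [eq_top_iff]
  intro g _
  have hdet : (LinearMap.toMatrix' g.toLinearMap).det ≠ 0 := by
    rw [LinearMap.det_toMatrix']
    exact (LinearEquiv.isUnit_det' g).ne_zero
  obtain ⟨h, hh, hx⟩ := key _ hdet
  have : g = h := by
    ext1 x
    rw [hx, LinearMap.toMatrix'_mulVec]
    rfl
  exact this ▸ hh

theorem exists_frobenius_place {R K L : Type} [CommRing R] [IsDomain R] [IsIntegrallyClosed R]
    [IsNoetherianRing R] [Field K] [Algebra R K] [IsFractionRing R K] [Field L] [Algebra K L]
    [Algebra R L] [IsScalarTower R K L] [FiniteDimensional K L] [IsGalois K L]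
    {p : ℕ} [Fact p.Prime] (φ : R →+* ZMod p) :
    ∃ (κ : Type) (_ : Field κ) (ι : ZMod p →+* κ) (O : Subring L) (Φ : O →+* κ) (σ : Gal(L/K)),
      (∀ r, ∃ h : algebraMap R L r ∈ O, Φ ⟨_, h⟩ = ι (φ r)) ∧
      (∀ z : O, Φ z ≠ 0 → z.1⁻¹ ∈ O) ∧
      (∀ z : O, ∃ h : σ z ∈ O, Φ ⟨σ z, h⟩ = Φ z ^ p) ∧
      (∀ z : L, IsIntegral O z → z ∈ O) := by
  let S := integralClosure R L
  have : FaithfulSMul R L := by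
    rw [faithfulSMul_iff_algebraMap_injective, IsScalarTower.algebraMap_eq R K L]
    exact (algebraMap K L).injective.comp (IsFractionRing.injective R K)
  have hSL : IsFractionRing S L := integralClosure.isFractionRing_of_finite_extension K L
  let := IsIntegralClosure.MulSemiringAction R K L S
  have hinv : Algebra.IsInvariant R S Gal(L/K) := Algebra.isInvariant_of_isGalois R K L S
  have hSfin : Module.Finite R S := IsIntegralClosure.finite R K L S
  have hSic : IsIntegrallyClosed S := integralClosure.isIntegrallyClosedOfFiniteExtension K
  have hφs : Function.Surjective φ := ZMod.ringHom_surjective φ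
  have hPp : (RingHom.ker φ).IsPrime := RingHom.ker_isPrime φ
  obtain ⟨Q, -, hQ, hQP⟩ := Ideal.exists_ideal_over_prime_of_isIntegral (S := S) (RingHom.ker φ) ⊥
    (by
      have : RingHom.ker (algebraMap R S) = ⊥ := by
        rw [RingHom.ker_eq_bot_iff_eq_zero]
        intro x hx
        apply FaithfulSMul.algebraMap_injective R L
        rw [map_zero, IsScalarTower.algebraMap_apply R S L, hx, map_zero]
      change RingHom.ker (algebraMap R S) ≤ _
      rw [this]; exact bot_le)
  have hQu : Q.under R = RingHom.ker φ := hQP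
  obtain ⟨e, he⟩ : ∃ e : R ⧸ Q.under R ≃+* ZMod p, ∀ r, e (Ideal.Quotient.mk _ r) = φ r :=
    ⟨(Ideal.quotEquivOfEq hQu).trans (RingHom.quotientKerEquivOfSurjective hφs), fun r => rfl⟩
  have hcard : Nat.card (R ⧸ Q.under R) = p := by
    rw [Nat.card_congr e.toEquiv, Nat.card_zmod]
  have hfinR : Finite (R ⧸ Q.under R) := Finite.of_equiv _ e.symm.toEquiv
  have hmfin : Module.Finite (R ⧸ Q.under R) (S ⧸ Q) :=
    Module.Finite.of_restrictScalars_finite R _ _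
  have hfinS : Finite (S ⧸ Q) := Module.finite_of_finite (R ⧸ Q.under R)
  have hcomm : SMulCommClass Gal(L/K) R S :=
    ⟨fun g r s => map_smul (galRestrict R K L S g) r s⟩
  obtain ⟨σ, hσ⟩ := IsArithFrobAt.exists_of_isInvariant R Gal(L/K) Q
  have hσ' : ∀ x : S, Ideal.Quotient.mk Q (σ • x) = Ideal.Quotient.mk Q x ^ p := by
    intro x
    have := hσ.mk_apply x
    rw [hcard] at this
    exact this
  have hQmax : Q.IsMaximal := Ideal.Quotient.maximal_of_isField _ (Finite.isField_of_domain (S ⧸ Q))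
  let : Field (S ⧸ Q) := Ideal.Quotient.field Q
  have hle : Q.primeCompl ≤ nonZeroDivisors S := Q.primeCompl_le_nonZeroDivisors
  let O := Localization.subalgebra.ofField L Q.primeCompl hle
  have hunit : ∀ y : Q.primeCompl, IsUnit (Ideal.Quotient.mk Q y) := fun y =>
    isUnit_iff_ne_zero.2 fun h => y.2 (Ideal.Quotient.eq_zero_iff_mem.1 h)
  let Φ : O →+* S ⧸ Q := IsLocalization.lift (M := Q.primeCompl) hunit
  have hΦ : ∀ (x : L) (hx : x ∈ O) (a s : S), s ∉ Q → x * algebraMap S L s = algebraMap S L a →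
      Φ ⟨x, hx⟩ * Ideal.Quotient.mk Q s = Ideal.Quotient.mk Q a := by
    intro x hx a s hs h
    have h1 : (⟨x, hx⟩ : O) * algebraMap S O s = algebraMap S O a := Subtype.ext h
    have h2 := congrArg Φ h1
    rw [map_mul] at h2
    simpa only [Φ, IsLocalization.lift_eq] using h2
  have hmem : ∀ x : L, x ∈ O ↔ ∃ a s : S, s ∉ Q ∧ x * algebraMap S L s = algebraMap S L a := by
    intro x
    constructor
    · rintro ⟨a, s, hs, rfl⟩
      have : algebraMap S L s ≠ 0 := fun h => hs (by
        rw [(FaithfulSMul.algebraMap_eq_zero_iff S L).1 h]; exact Q.zero_mem)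
      exact ⟨a, s, hs, by field_simp⟩
    · rintro ⟨a, s, hs, h⟩
      have : algebraMap S L s ≠ 0 := fun h => hs (by
        rw [(FaithfulSMul.algebraMap_eq_zero_iff S L).1 h]; exact Q.zero_mem)
      exact ⟨a, s, hs, by rw [← h]; field_simp⟩
  have hsmul : ∀ x : S, algebraMap S L (σ • x) = σ (algebraMap S L x) := fun x => by
    exact algebraMap_galRestrict_apply R σ x
  have hσQ : ∀ s : S, s ∉ Q → σ • s ∉ Q := by
    intro s hs h
    rw [← Ideal.Quotient.eq_zero_iff_mem, hσ'] at h
    exact hs (Ideal.Quotient.eq_zero_iff_mem.1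
      (pow_eq_zero_iff (Fact.out : p.Prime).ne_zero |>.1 h))
  refine ⟨S ⧸ Q, inferInstance, (algebraMap (R ⧸ Q.under R) (S ⧸ Q)).comp e.symm.toRingHom,
    O.toSubring, Φ, σ, ?_, ?_, ?_, ?_⟩
  · intro r
    have h : algebraMap R L r ∈ O := (hmem _).2 ⟨algebraMap R S r, 1, Q.one_notMem, by
      rw [map_one, mul_one]; rfl⟩
    refine ⟨h, ?_⟩
    have h1 := hΦ _ h (algebraMap R S r) 1 Q.one_notMem (by rw [map_one, mul_one]; rfl)
    rw [map_one, mul_one] at h1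
    refine h1.trans ?_
    change _ = algebraMap (R ⧸ Q.under R) (S ⧸ Q) (e.symm (φ r))
    rw [← he, e.symm_apply_apply]
    rfl
  · rintro ⟨z, hz⟩ hz0
    obtain ⟨a, s, hs, h⟩ := (hmem z).1 hz
    have h1 := hΦ z hz a s hs h
    have ha : a ∉ Q := fun ha => by
      rw [Ideal.Quotient.eq_zero_iff_mem.2 ha] at h1
      rcases mul_eq_zero.1 h1 with h2 | h2
      · exact hz0 h2
      · exact hs (Ideal.Quotient.eq_zero_iff_mem.1 h2)
    refine (hmem _).2 ⟨s, a, ha, ?_⟩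
    have : algebraMap S L a ≠ 0 := fun h => ha (by
        rw [(FaithfulSMul.algebraMap_eq_zero_iff S L).1 h]; exact Q.zero_mem)
    have hz' : z ≠ 0 := by rintro rfl; rw [zero_mul] at h; exact this h.symm
    rw [← h]
    field_simp
  · rintro ⟨z, hz⟩
    obtain ⟨a, s, hs, h⟩ := (hmem z).1 hz
    have h' : σ z * algebraMap S L (σ • s) = algebraMap S L (σ • a) := by
      rw [hsmul, hsmul, ← map_mul, h]
    have hm : σ z ∈ O := (hmem _).2 ⟨_, _, hσQ s hs, h'⟩
    refine ⟨hm, ?_⟩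
    have h1 := hΦ z hz a s hs h
    have h2 := hΦ _ hm _ _ (hσQ s hs) h'
    rw [hσ', hσ', ← h1, mul_pow] at h2
    refine mul_right_cancel₀ (pow_ne_zero p ?_) h2
    exact fun h => hs (Ideal.Quotient.eq_zero_iff_mem.1 h)
  · intro z hz
    have hO : IsIntegrallyClosed O := isIntegrallyClosed_of_isLocalization O Q.primeCompl hle
    have : IsFractionRing O L := Localization.subalgebra.isFractionRing_ofField L Q.primeCompl hle
    obtain ⟨y, hy⟩ := (isIntegrallyClosed_iff (R := O) L).1 hO (x := z) hz
    exact hy ▸ y.2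

/-- The rational function field `ℚ(α, t)`. -/
abbrev Kαt := RatFunc (RatFunc ℚ)

/-- Evaluation `ℤ[α][t] → A` at a pair of elements. -/
noncomputable def evalPair {A : Type*} [CommRing A] (a t : A) : ℤ[X][X] →+* A :=
  eval₂RingHom (eval₂RingHom (Int.castRingHom A) a) t

@[simp] theorem evalPair_X {A : Type*} [CommRing A] (a t : A) : evalPair a t X = t := by
  simp [evalPair]

@[simp] theorem evalPair_C_X {A : Type*} [CommRing A] (a t : A) : evalPair a t (C X) = a := by
  simp [evalPair]

theorem subfield_eq_top (F : Subfield Kαt)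
    (h1 : RatFunc.C (RatFunc.X : RatFunc ℚ) ∈ F) (h2 : RatFunc.X ∈ F)
    (z : Kαt) : z ∈ F := by
  have hC : ∀ c : RatFunc ℚ, RatFunc.C c ∈ F := by
    have hp : ∀ q : ℚ[X], RatFunc.C (algebraMap ℚ[X] (RatFunc ℚ) q) ∈ F := by
      intro q
      induction q using Polynomial.induction_on' with
      | add p q hp hq => rw [map_add, map_add]; exact F.add_mem hp hq
      | monomial n a =>
        rw [← C_mul_X_pow_eq_monomial, map_mul, map_mul, map_pow, map_pow, RatFunc.algebraMap_X]
        refine F.mul_mem ?_ (F.pow_mem h1 n)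
        have : RatFunc.C (algebraMap ℚ[X] (RatFunc ℚ) (C a)) = ((a : ℚ) : Kαt) := by
          exact map_ratCast ((RatFunc.C : RatFunc ℚ →+* Kαt).comp
            ((algebraMap ℚ[X] (RatFunc ℚ)).comp C)) a
        rw [this]
        exact SubfieldClass.ratCast_mem F a
    intro c
    induction c using RatFunc.induction_on with
    | f p q hq => rw [map_div₀]; exact F.div_mem (hp p) (hp q)
  have hp : ∀ q : (RatFunc ℚ)[X], algebraMap (RatFunc ℚ)[X] Kαt q ∈ F := by
    intro q
    induction q using Polynomial.induction_on' with
    | add p q hp hq => rw [map_add]; exact F.add_mem hp hq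
    | monomial n a =>
      rw [← C_mul_X_pow_eq_monomial, map_mul, map_pow, RatFunc.algebraMap_X, RatFunc.algebraMap_C]
      exact F.mul_mem (hC a) (F.pow_mem h2 n)
  induction z using RatFunc.induction_on with
  | f p q hq => exact F.div_mem (hp p) (hp q)

theorem evalPair_injective :
    Function.Injective (evalPair (RatFunc.C (RatFunc.X : RatFunc ℚ) : Kαt) RatFunc.X) := by
  have h : evalPair (RatFunc.C (RatFunc.X : RatFunc ℚ) : Kαt) RatFunc.X =
      (algebraMap (RatFunc ℚ)[X] Kαt).comp (mapRingHom ((algebraMap ℚ[X] (RatFunc ℚ)).comp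
        (mapRingHom (Int.castRingHom ℚ)))) := by
    refine Polynomial.ringHom_ext' ?_ ?_
    · refine Polynomial.ringHom_ext' (RingHom.ext_int _ _) ?_
      simp [evalPair, RatFunc.algebraMap_X, RatFunc.algebraMap_C]
    · simp [evalPair, RatFunc.algebraMap_X]
  rw [h]
  refine (RatFunc.algebraMap_injective _).comp (map_injective _ ?_)
  exact (RatFunc.algebraMap_injective _).comp (map_injective _ Int.cast_injective)

/-! ### A separation principle for integer polynomials -/

section Separation

/-- A submultiplicative seminorm with integer values. -/
structure IsNm {R : Type*} [CommRing R] (ν : R → ℤ) : Prop where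
  nonneg : ∀ a, 0 ≤ ν a
  zero : ν 0 = 0
  one : ν 1 ≤ 1
  neg : ∀ a, ν (-a) = ν a
  add : ∀ a b, ν (a + b) ≤ ν a + ν b
  mul : ∀ a b, ν (a * b) ≤ ν a * ν b

theorem isNm_abs : IsNm (fun a : ℤ => |a|) where
  nonneg := abs_nonneg
  zero := abs_zero
  one := le_of_eq abs_one
  neg := abs_neg
  add := abs_add_le
  mul a b := le_of_eq (abs_mul a b)

/-- The weighted `ℓ¹`-norm of a polynomial. -/
noncomputable def pn {R : Type*} [CommRing R] (ν : R → ℤ) (r : ℤ) (f : R[X]) : ℤ :=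
  f.sum fun i c => ν c * r ^ i

variable {R : Type*} [CommRing R] {ν : R → ℤ}

theorem IsNm.pn_monomial (h : IsNm ν) (r : ℤ) (n : ℕ) (a : R) :
    pn ν r (monomial n a) = ν a * r ^ n := by
  rw [pn, sum_monomial_index]
  rw [h.zero, zero_mul]

theorem IsNm.pn_nonneg (h : IsNm ν) {r : ℤ} (hr : 0 ≤ r) (f : R[X]) : 0 ≤ pn ν r f :=
  Finset.sum_nonneg fun _ _ => mul_nonneg (h.nonneg _) (pow_nonneg hr _)

theorem IsNm.pn_add (h : IsNm ν) {r : ℤ} (hr : 0 ≤ r) (f g : R[X]) :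
    pn ν r (f + g) ≤ pn ν r f + pn ν r g := by
  classical
  have h0 : ∀ i : ℕ, ν 0 * r ^ i = 0 := fun i => by rw [h.zero, zero_mul]
  unfold pn
  rw [sum_eq_of_subset (p := f + g) (fun i c => ν c * r ^ i) h0 support_add,
    sum_eq_of_subset (p := f) (fun i c => ν c * r ^ i) h0
      (Finset.subset_union_left (s₂ := g.support)),
    sum_eq_of_subset (p := g) (fun i c => ν c * r ^ i) h0
      (Finset.subset_union_right (s₁ := f.support)), ← Finset.sum_add_distrib]
  refine Finset.sum_le_sum fun i _ => ?_
  rw [coeff_add, ← add_mul]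
  exact mul_le_mul_of_nonneg_right (h.add _ _) (pow_nonneg hr _)

theorem IsNm.pn_sum (h : IsNm ν) {r : ℤ} (hr : 0 ≤ r) {ι : Type*} (s : Finset ι) (f : ι → R[X]) :
    pn ν r (∑ i ∈ s, f i) ≤ ∑ i ∈ s, pn ν r (f i) := by
  classical
  induction s using Finset.induction_on with
  | empty => simp [pn]
  | insert a s ha ih =>
    rw [Finset.sum_insert ha, Finset.sum_insert ha]
    exact (h.pn_add hr _ _).trans (by gcongr)

theorem IsNm.pn (h : IsNm ν) {r : ℤ} (hr : 0 ≤ r) : IsNm (pn ν r) where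
  nonneg := h.pn_nonneg hr
  zero := by simp [PSL52Family.pn]
  one := by
    rw [← monomial_zero_one, h.pn_monomial, pow_zero, mul_one]
    exact h.one
  neg f := by
    unfold PSL52Family.pn
    rw [sum_def, sum_def, support_neg]
    exact Finset.sum_congr rfl fun i _ => by rw [coeff_neg, h.neg]
  add := h.pn_add hr
  mul f g := by
    rw [mul_eq_sum_sum]
    refine (h.pn_sum hr _ _).trans ?_
    have : PSL52Family.pn ν r f * PSL52Family.pn ν r g =
        ∑ i ∈ f.support, ∑ j ∈ g.support, (ν (f.coeff i) * r ^ i) * (ν (g.coeff j) * r ^ j) := by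
      rw [← Finset.sum_mul_sum]
      rfl
    rw [this]
    refine Finset.sum_le_sum fun i _ => (h.pn_sum hr _ _).trans (Finset.sum_le_sum fun j _ => ?_)
    rw [h.pn_monomial, pow_add]
    calc _ ≤ ν (f.coeff i) * ν (g.coeff j) * (r ^ i * r ^ j) :=
          mul_le_mul_of_nonneg_right (h.mul _ _) (by positivity)
      _ = _ := by ring

theorem IsNm.pn_C (h : IsNm ν) (r : ℤ) (a : R) : PSL52Family.pn ν r (C a) = ν a := by
  rw [← monomial_zero_left, h.pn_monomial, pow_zero, mul_one]

theorem IsNm.pn_X (h : IsNm ν) {r : ℤ} (hr : 0 ≤ r) : PSL52Family.pn ν r X ≤ r := by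
  rw [← monomial_one_one_eq_X, h.pn_monomial, pow_one]
  calc ν 1 * r ≤ 1 * r := mul_le_mul_of_nonneg_right h.one hr
    _ = r := one_mul r

theorem IsNm.le_pn_one (h : IsNm ν) (f : R[X]) (i : ℕ) :
    ν (f.coeff i) ≤ PSL52Family.pn ν 1 f := by
  by_cases hi : i ∈ f.support
  · have := Finset.single_le_sum (f := fun i => ν (f.coeff i) * 1 ^ i)
      (fun j _ => mul_nonneg (h.nonneg _) (pow_nonneg zero_le_one _)) hi
    simpa [PSL52Family.pn, sum_def] using this
  · rw [notMem_support_iff.1 hi, h.zero]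
    exact h.pn_nonneg zero_le_one f

theorem abs_eval₂_le {e : R →+* ℤ} (he : ∀ c, |e c| ≤ ν c) {r : ℤ} (hr : 0 ≤ r)
    (f : R[X]) : |f.eval₂ e r| ≤ PSL52Family.pn ν r f := by
  rw [eval₂_eq_sum]
  refine (Finset.abs_sum_le_sum_abs _ _).trans (Finset.sum_le_sum fun i _ => ?_)
  rw [abs_mul, abs_pow, abs_of_nonneg hr]
  exact mul_le_mul_of_nonneg_right (he _) (pow_nonneg hr _)

theorem eq_zero_of_eval_eq_zero {y : ℤ} : ∀ (n : ℕ) (g : ℤ[X]), g.natDegree < n →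
    (∀ i, |g.coeff i| < y) → g.eval y = 0 → g = 0 := by
  intro n
  induction n with
  | zero => intro g hg; exact absurd hg (Nat.not_lt_zero _)
  | succ n ih =>
    intro g hg hc h0
    have hy : 0 < y := (abs_nonneg _).trans_lt (hc 0)
    have h1 := divX_mul_X_add g
    have h2 : g.divX.eval y * y + g.coeff 0 = 0 := by
      rw [← h0]
      conv_rhs => rw [← h1]
      simp
    have h3 : g.coeff 0 = 0 :=
      Int.eq_zero_of_abs_lt_dvd ⟨-g.divX.eval y, by linarith⟩ (hc 0)
    have h4 : g.divX.eval y = 0 := by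
      rw [h3, add_zero] at h2
      exact (mul_eq_zero.1 h2).resolve_right hy.ne'
    rw [h3, C_0, add_zero] at h1
    by_cases hd : g.natDegree = 0
    · rw [eq_C_of_natDegree_eq_zero hd, h3, C_0]
    · rw [← h1, ih g.divX (by rw [natDegree_divX_eq_natDegree_tsub_one]; omega)
        (fun i => by rw [coeff_divX]; exact hc _) h4, zero_mul]

theorem IsNm.map_coeff_eq_zero (h : IsNm ν) {e : R →+* ℤ} (he : ∀ c, |e c| ≤ ν c) {y : ℤ}
    (f : R[X]) (hf : PSL52Family.pn ν 1 f < y) (h0 : f.eval₂ e y = 0) (i : ℕ) :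
    e (f.coeff i) = 0 := by
  have : f.map e = 0 := by
    refine eq_zero_of_eval_eq_zero _ _ (Nat.lt_succ_self _) (fun i => ?_) (by rwa [eval_map])
    rw [coeff_map]
    exact ((he _).trans (h.le_pn_one f i)).trans_lt hf
  rw [← coeff_map, this, coeff_zero]

/-- The weighted `ℓ¹`-norm of an integer polynomial in three variables. -/
noncomputable def nm3 (a x y : ℤ) : ℤ[X][X][X] → ℤ := pn (pn (pn (fun c => |c|) a) x) y

theorem isNm_nm3 {a x y : ℤ} (ha : 0 ≤ a) (hx : 0 ≤ x) (hy : 0 ≤ y) : IsNm (nm3 a x y) :=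
  ((isNm_abs.pn ha).pn hx).pn hy

theorem eq_zero_of_eval_of_nm3 {a x y : ℤ} (ha : 0 ≤ a) (hx : 0 ≤ x) (D : ℤ[X][X][X])
    (h1 : nm3 1 1 1 D < a) (h2 : nm3 a 1 1 D < x) (h3 : nm3 a x 1 D < y)
    (h0 : D.eval₂ (eval₂RingHom (eval₂RingHom (RingHom.id ℤ) a) x) y = 0) : D = 0 := by
  have e1 : ∀ c, |eval₂RingHom (RingHom.id ℤ) a c| ≤ pn (fun c => |c|) a c := fun c =>
    abs_eval₂_le (fun c => le_rfl) ha c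
  have n1 := isNm_abs.pn ha
  have e2 : ∀ c, |eval₂RingHom (eval₂RingHom (RingHom.id ℤ) a) x c| ≤
      pn (pn (fun c => |c|) a) x c := fun c => abs_eval₂_le e1 hx c
  have k3 := (n1.pn hx).map_coeff_eq_zero e2 D h3 h0
  have k2 : ∀ i j, eval₂RingHom (RingHom.id ℤ) a ((D.coeff i).coeff j) = 0 := fun i =>
    n1.map_coeff_eq_zero e1 (D.coeff i)
      (((n1.pn zero_le_one).le_pn_one D i).trans_lt h2) (k3 i)
  have k1 : ∀ i j k, ((D.coeff i).coeff j).coeff k = 0 := fun i j =>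
    isNm_abs.map_coeff_eq_zero (e := RingHom.id ℤ) (fun c => le_rfl) _
      ((((isNm_abs.pn zero_le_one).le_pn_one (D.coeff i) j).trans
        (((isNm_abs.pn zero_le_one).pn zero_le_one).le_pn_one D i)).trans_lt h1) (k2 i j)
  ext i j k
  rw [k1]
  simp

end Separation

/-! ### Evaluation of coefficient lists -/

section Evaluation

variable {A : Type*} [CommRing A]

/-- Horner evaluation of a univariate coefficient list. -/
def ev1 (l : List ℤ) (a : A) : A := l.foldr (fun (c : ℤ) (r : A) => (c : A) + a * r) 0

/-- Horner evaluation of a bivariate coefficient list. -/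
def ev2 (l : List (List ℤ)) (a x : A) : A := l.foldr (fun (c : List ℤ) (r : A) => ev1 c a + x * r) 0

/-- Horner evaluation of a trivariate coefficient list. -/
def ev3 (l : List (List (List ℤ))) (a x y : A) : A :=
  l.foldr (fun (c : List (List ℤ)) (r : A) => ev2 c a x + y * r) 0

theorem map_ev1 {B : Type*} [CommRing B] (f : A →+* B) (l : List ℤ) (a : A) :
    f (ev1 l a) = ev1 l (f a) := by
  induction l with
  | nil => exact map_zero f
  | cons c l ih =>
    change f ((c : A) + a * ev1 l a) = (c : B) + f a * ev1 l (f a)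
    rw [map_add, map_mul, ih, map_intCast]

theorem map_ev2 {B : Type*} [CommRing B] (f : A →+* B) (l : List (List ℤ)) (a x : A) :
    f (ev2 l a x) = ev2 l (f a) (f x) := by
  induction l with
  | nil => exact map_zero f
  | cons c l ih =>
    change f (ev1 c a + x * ev2 l a x) = ev1 c (f a) + f x * ev2 l (f a) (f x)
    rw [map_add, map_mul, ih, map_ev1]

theorem map_ev3 {B : Type*} [CommRing B] (f : A →+* B) (l : List (List (List ℤ))) (a x y : A) :
    f (ev3 l a x y) = ev3 l (f a) (f x) (f y) := by
  induction l with
  | nil => exact map_zero f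
  | cons c l ih =>
    change f (ev2 c a x + y * ev3 l a x y) = ev2 c (f a) (f x) + f y * ev3 l (f a) (f x) (f y)
    rw [map_add, map_mul, ih, map_ev2]

end Evaluation

/-! ### The integer data -/

/-- The cleared form of `f₀` in the variable `x / (α + 1)`. -/
def cF : List (List ℤ) :=
  [[768, 3264, 5232, 3588, 426, -768, -420, -84, -6], [9024, 58656, 124836, 126768, 75435, 32754,
  11166, 2604, 339, 18], [-226752, -354528, -149004, -47592, -42291, -23715, -11682, -4878, -1071,
  -87], [-742144, -1019904, -421392, -243648, -123996, -33432, -11328, -1248, 780, 152], [-704768,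
  -309120, 503952, 223224, 179016, 76188, 18432, 7320, 888, -92], [-371328, 616128, 698232,
  154464, 115914, -17796, -6252, -2712, -1446, -36], [-112768, 512448, -100392, -144960, -105810,
  -61194, -7668, -2820, 318, 62], [196864, 86016, -136272, -56640, -26796, 8904, 6336, 2208, 348,
  -8], [-33792, -82752, -61536, -6684, 11238, 7500, 2148, -132, -138, -12], [-5824, -8160, 2436,
  6768, 2499, 66, -690, -276, -21, 2], [64, 288, 468, 264, -99, -171, -42, 18, 9, 1]]

/-- The cleared form of `g₀` in the variable `x / (α + 1)`. -/
def cG : List (List ℤ) :=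
  [[-1, -1], [-6], [1, 1]]

/-- The cleared form of `g₁` in the variable `x / (α + 1)`. -/
def cH : List (List ℤ) :=
  [[16, 8, 1], [24, -6, -3], [-8, -16, 1], [-8, 2, 1]]

/-- The cleared form of `f₀` for the dual parameter. -/
def dF : List (List ℤ) :=
  [[3456, -2592, -2592, 3024, -648, -162, 54], [76032, -136944, 62208, -18360, 16416, -5103, -108,
  27], [-375264, -310032, -121392, 114120, 14922, 22707, -6336, 63], [-1162752, -1025472, -515328,
  83328, 141024, 54636, 16176, -3468, 48], [-575616, -1744512, -903360, -273408, 164616, 111144,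
  45924, 7572, -912], [114176, -1130016, -1386240, -675024, -198528, 41406, 35640, 16026, 2208,
  -64], [76224, -43488, -850464, -678960, -375444, -132174, -22104, -990, 1440, 192], [164352,
  465216, 304896, 14208, -12192, -31620, -11472, -2748, -528], [-75264, -37344, 48864, 5424,
  -2544, 1122, -1770, 132, 48], [-6912, -15984, 0, 7560, -864, 729, -108, -189], [288, -144, -432,
  360, 90, -189, 72, -9]]

/-- The cleared form of `g₀` for the dual parameter. -/
def dG : List (List ℤ) :=
  [[-2, 1], [-8, -2], [2, -1]]

/-- The cleared form of `g₁` for the dual parameter. -/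
def dH : List (List ℤ) :=
  [[9], [9, 9], [-7, 4, 2], [-3, -3]]

def cA0 : List (List ℤ) :=
  [[], [2038431744, 6115295232, 4586471424, -2802843648, -4920901632, -859963392, 1423319040,
  707678208, -64665216, -126873216, -28040256, 3639168, 2832408, 565704, 52488, 1944],
  [12230590464, 27518828544, 2293235712, -31149785088, -13329432576, 12935282688, 7885983744,
  -1995383808, -2012179968, -64198656, 228427776, 48848832, -6135264, -3569184, -489888, -23328],
  [23441965056, 22932357120, -59815231488, -61853663232, 43750637568, 48056426496, -13183368192,
  -16298993664, 1004970240, 2754134784, 223528896, -211258368, -41100048, 3884112, 1597968,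
  112752], [5096079360, -57330892800, -110839726080, 53668085760, 144939663360, -20946677760,
  -75085056000, 4736517120, 18044674560, 99221760, -2201696640, -169128000, 121577760, 17146080,
  -1516320, -272160], [-32487505920, -91729428480, 32535281664, 209281646592, 10216544256,
  -177336096768, -11740889088, 70933542912, 1004410368, -12859513344, -200434176, 1123943040,
  48364776, -41343048, -2711880, 309096], [-25990004736, 19492503552, 173425950720, 42257645568,
  -231724302336, -62741495808, 144067756032, 22305300480, -45336195072, -1064503296, 6085808640,
  -72503424, -357151680, 1819584, 6858432, -46656], [13504610304, 82938691584, 36548444160,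
  -184255119360, -94769160192, 170362331136, 62100006912, -83031257088, -12933043200, 20111099904,
  -208738944, -1840859136, 105341472, 59789664, -3009312, -225504], [18345885696, 11466178560,
  -93162700800, -71161970688, 126808768512, 79636193280, -89265991680, -32060510208, 34317914112,
  3205827072, -5909448960, 387711360, 311148864, -31212864, -3219264, 139968], [-637009920,
  -28665446400, -30576476160, 61551083520, 57214439424, -60487077888, -37403430912, 33646067712,
  8923519872, -9647309952, -8258112, 1019060352, -120094488, -21467592, 2280312, 60264],
  [-5096079360, -7644119040, 19014746112, 24755798016, -26025836544, -24915050496, 20245966848,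
  9932129280, -8674656768, -1015732224, 1608325632, -133856064, -82993248, 11080800, 723168,
  -54432], [-764411904, 3439853568, 6736379904, -6975258624, -10050822144, 7381352448, 5898064896,
  -4474497024, -1237876992, 1306554624, -35691840, -123171840, 13518576, 3884112, -454896,
  -11664], [509607936, 1146617856, -1051066368, -2444525568, 1433272320, 1985679360, -1271531520,
  -624817152, 543075840, 20839680, -78662016, 6111936, 4844448, -489888, -116640, 7776],
  [127401984, 0, -334430208, 87588864, 326965248, -159750144, -126406656, 94058496, 10637568,
  -18724608, 839808, 1772928, -153576, -87480, 5832, 1944]]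

def cA1 : List (List ℤ) :=
  [[1719926784, 6449725440, 7739670528, 913711104, -4776827904, -2857026816, 425782656, 789839424,
  164392416, -43670016, -23934528, -3779136, -209952], [45785088000, 149299200000, 146283356160,
  -9448648704, -96260472576, -44442639360, 9250174080, 13176214272, 3484468368, -468737280,
  -565237440, -146826432, -4071708, 5948640, 1312200, 108864, 2916], [107350769664, 215957975040,
  -80751707136, -419270452992, -188320733568, 156552932736, 140228941824, 7455386448,
  -28168390872, -11025999936, 297835056, 1269179280, 316373688, 6723648, -8576928, -1288224,
  -55728], [-534280458240, -1577385695232, -1549337207040, -70460119296, 1056969601344,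
  716283751680, -75075889392, -249334813008, -69697115172, 23371835904, 15853899960, 1227935376,
  -948228444, -221696352, 462672, 4170528, 303912], [-2805925183488, -4706922037248, 271884294144,
  4042536864768, 1841737512960, -767751540480, -1050617661696, -205033462272, 199512696672,
  95999027904, -7944894720, -11748925584, -1231943904, 409099248, 72141840, -2807136, -742608],
  [-4941017210880, -2107685670912, 8761756801536, 4533966379008, -3598896749184, -2762635569408,
  -149815549728, 762412103424, 333905053896, -83344489920, -67438952136, 288030816, 5006327796,
  389888640, -119416032, -9548928, 817452], [-3674545274880, 6238389104640, 10053743680512,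
  -6487970648832, -6503158452096, 1252490428800, 1788573229056, 596440030608, -292838990904,
  -232902659232, 21846363552, 28451338128, 25973136, -1298058048, -28149120, 18734976, -108216],
  [-395235127296, 8033968281600, -1619965059840, -11196160360704, 2427809754816, 4020130414080,
  78409870128, -567366183504, -450520807356, 67976768160, 96207411744, -6015303648, -7285725792,
  231729984, 184695552, -6711984, -579636], [824158126080, 2323974094848, -7255506161664,
  -1262414979072, 6576288694272, -622753152768, -1235702998656, -293829228864, 76711678560,
  188723188224, -16241036544, -24220941408, 1961291232, 1045154016, -79843968, -8807616, 368064],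
  [121035866112, -775266951168, -2666663617536, 4026834819072, 811405195776, -2182910694912,
  145178246592, 140937542784, 160144247232, -7857585792, -46361301264, 4728678912, 3531545244,
  -414523008, -63423000, 6026400, 133164], [-190369087488, -363270500352, 363658761216,
  1334287676160, -1422477168768, -58281586560, 342529896960, 5535712368, 2295096120, -41299435008,
  3261216816, 6505716528, -942827688, -254575872, 35334144, 1677024, -150336], [-7005450240,
  26693867520, 295327938816, -206837349120, -234206925120, 236086016256, -17571677328,
  -20984602608, -7651207836, -428587200, 5340156984, -842611248, -473320908, 84203712, 9980496,
  -1459296, -16848], [7078772736, 36707696640, -13665355776, -48377170944, 28963795968,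
  12384928512, -17091648000, 4253969664, 381902688, 827661888, -243155520, -316292688, 80660448,
  20408112, -4024080, -225504, 27216], [1940889600, 1263071232, -2784056832, -680804352,
  494833536, -1026618624, 1095086304, 641520000, -565068312, -38397888, -7960680, 27970272,
  9666540, -4082400, -618192, 116640, 2916], [75644928, 150294528, -133622784, -392345856,
  26904960, 353185920, 35707392, -147895632, -19298088, 26166240, 5007744, -58320, -1345248,
  -248832, 116640, 15552, -1944], [-331776, -1824768, -3421440, -1223424, 3924288, 4230144,
  -1051056, -3181680, -399492, 1184544, 309744, -248832, -74520, 28512, 7776, -1296, -324]]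

def cA2 : List (List ℤ) :=
  [[6879707136, 32678608896, 56757583872, 34613526528, -15452467200, -30535418880, -9724976640,
  4862488320, 3816927360, 482889600, -270418176, -110854656, -15956352, -839808], [42488561664,
  281558384640, 569654083584, 355041460224, -183712914432, -301193966592, -68121616896,
  48911040000, 28581348960, 3960340128, -1291994064, -913851072, -264320334, -27488646, 3898692,
  1219860, 92826, 1458], [-2590958223360, -7250543788032, -7337403076608, -3352093756416,
  -203248507392, 1416109464576, 1390701892608, 424700884800, -106154170272, -117278728416,
  -35419529664, -1823978736, 2164591512, 675239976, 57605904, -5971968, -1270728, -53784],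
  [-18988780437504, -41949183025152, -25978730849280, 3630261583872, 12700985870592,
  8206590553344, 1368106867008, -1643810032512, -1049132433168, -144024322320, 84340093104,
  43061350464, 5138384148, -1368589068, -423101448, -19682136, 3761748, 318708], [-53108775124992,
  -69005504323584, 13372957440000, 52221361333248, 23757588873216, -3201631059456, -9873718051968,
  -4406309627328, 290904011712, 875009539872, 263566472832, -16686535248, -25348630536,
  -3445052472, 503225136, 117821952, -516456, -784728], [-71562339164160, 53423013888,
  111565323399168, 51365524681728, -25255758970368, -30786510661632, -8933658372864,
  4116716371008, 3685818863520, 632456966592, -339664198176, -166290806304, -3560711778,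
  9005275494, 939786732, -136199988, -13661514, 849582], [-42478233255936, 102089732382720,
  78962270349312, -54595420968960, -58917105381888, -7230348762624, 15658151029632, 8429509074816,
  26713603872, -1540007206272, -529075308384, 75213503424, 59629263696, 1408388688, -1997318304,
  -87357312, 20764944, -101520], [2404250173440, 84021605572608, -53849622168576, -68297240005632,
  313918108416, 29259893281536, 11625535091520, -3950477047872, -3410106729264, -752109108624,
  393628407840, 207233171712, -14866352712, -12963514536, 95222736, 248051376, -4969080, -597240],
  [16851527663616, 4977078386688, -57314785849344, 12740274321408, 25267684478976, 10672200714240,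
  -9251556721920, -4749317373312, 278874973440, 796394445120, 370483265664, -81009138528,
  -46177697808, 3417683760, 1615382784, -77137056, -10774512, 378000], [4915845808128,
  -16300817547264, -248566800384, 17031746893824, 364713836544, -5634400545792, -4770049277952,
  2261867414400, 899534895264, 179197670304, -150862816656, -88974244800, 14853460590, 5911436646,
  -569249316, -92456532, 6121062, 129870], [-2937732268032, -3798944907264, 4472599486464,
  -2145747151872, -1570209615360, -911120984064, 1489357221120, 841213995840, -371245539168,
  -118518032736, -62018155008, 26185918032, 11723233464, -1977554520, -407493072, 43525728,
  2235384, -156600], [-310349021184, 959026176000, 186032747520, 63742408704, 898503687936,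
  54962682624, 56948363712, -353906074368, -72930404592, 42280755408, 18828791280, 8733913344,
  -3206393964, -880300332, 149341752, 15911208, -1652940, -13068], [136965980160, 121959309312,
  172496369664, 281229124608, -118922895360, -242517984768, -58488912000, 16307901504,
  53812105920, 6651254304, -3762125568, -2393486928, -683812584, 230142600, 43538256, -6370272,
  -328104, 30024], [1791811584, 34294136832, 44209041408, -40015309824, -72426604032, -3719264256,
  27776777472, 13603553856, -923850144, -4506064128, -736712064, 159113376, 170262594, 36843066,
  -9444492, -1568268, 160650, 2322], [1098842112, 1663524864, -2999089152, -6454702080,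
  -809657856, 4325239296, 2147824512, -756490752, -875269152, -135162432, 123340320, 52563168,
  4517856, -6078240, -1474848, 178848, 36288, -2592], [-5750784, -36052992, -85625856, -78769152,
  25208064, 105055488, 51433920, -37157184, -39650256, 963792, 11644992, 2165184, -1576800,
  -476064, 79488, 34560, 432, -432]]

def cA3 : List (List ℤ) :=
  [[4968677376, 42329309184, 123070316544, 153706512384, 52106913792, -67773252096, -71040478464,
  -11533643136, 14290312896, 7579920384, 461661120, -641520000, -217556928, -28926720, -1446336],
  [-503184752640, -1659591327744, -1685311930368, -136335384576, 581158291968, 56647019520,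
  -146385107712, 38541318912, 65381884560, 8056897632, -6244411176, -2358311760, -618744177,
  -197934354, -33461667, 19764, 570969, 42606, 243], [-13842100813824, -49712222969856,
  -68445110937600, -44074015114752, -10490123987712, 5197696439040, 7338847110912, 4091464465056,
  854883591696, -236481887232, -203258806704, -62351022024, -8565688116, 1014751152, 612880020,
  79594488, 373572, -559872, -26244], [-65362560491520, -197673575952384, -195282267683328,
  -39006298344960, 59268267174528, 53081508867840, 20007843588000, -1049404129632, -5208201908136,
  -2278476618192, -286638960816, 114478544376, 62477768502, 10513606788, -512371710, -369816624,
  -29953854, 1167588, 163134], [-109835694784512, -236790599602176, -13904010436608,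
  258272598021120, 191456479374336, 28300110628608, -36497240589312, -31084444761408,
  -8744534654976, 1481438909376, 1707880059216, 458576100648, 2045184012, -28236017664,
  -4888203660, 219115368, 96256404, 2182896, -401508], [-55760339128320, -11666933342208,
  357321906330624, 330686900158464, -43092506158848, -152989204073472, -76109856088896,
  -4641470093952, 16185464730576, 8027153323200, 878587415712, -561843811080, -241793895015,
  -15002747478, 8268099435, 1098749988, -72476721, -10333062, 428157], [-5392375234560,
  33930777194496, 180362394150912, -158398164085248, -298052557763328, -81726669923328,
  46192300268544, 50455700866656, 15261973518096, -2937007749600, -3246265543536, -787564907280,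
  95781463416, 72063387072, 3772844136, -1607941584, -103638312, 11673504, -45144],
  [-48665214296064, -90521664638976, -51894446556672, -207498364098048, 1983108956544,
  125282575501056, 66690445786848, 2138631779232, -17179680095352, -7628874970608, -576364672440,
  773894641392, 278653407012, -12944930760, -13148510004, -232387488, 178341588, -590328,
  -300852], [-24157257891840, 44084634034176, 106370742288384, 67407635109888, 125636338925568,
  20019635288064, -31649521575168, -29082292095744, -6109864471872, 3092474756736, 2010234439584,
  444856995216, -135672356808, -54604197792, 2410302312, 1405260144, -28178712, -7175520, 186264],
  [26189470015488, 82893480689664, 39818360014848, -18440944275456, -37400583333888,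
  -48540155848704, -11560438053504, 4852285786368, 8349037691184, 2051684979552, -152120876904,
  -371456975520, -108388013247, 18981640386, 6111439443, -355906116, -75577401, 2860866, 64989],
  [1473399226368, -18982255067136, -57900708845568, -45785939433984, -13713437493504,
  11205932338944, 13665970536192, 5170541963616, -217992881232, -1484235543744, -406549034064,
  -45866753064, 51883005276, 13872796560, -1862070876, -390065544, 25186356, 1769472, -77076],
  [-2049163960320, -8857924079616, -2839889659392, 12258732049920, 15303653723520, 7228155343104,
  -1289369801376, -2627232968736, -1347064923096, -107226960048, 160691396832, 58369025304,
  10416465270, -4737832668, -1040864958, 113346864, 14689458, -864540, -6354], [-223221989376,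
  1202704920576, 3963055693824, 3514425283584, 60950817792, -2173727612160, -1515500554752,
  -151846208064, 254606737536, 180962202816, 26870389200, -9934487352, -5489089092, -1112836320,
  252614052, 49572648, -4089852, -291600, 14796], [113412648960, 327264067584, 235544730624,
  -228021129216, -485504527104, -242627069952, 82079269056, 128763036288, 42301072368,
  -6368395392, -11434958352, -2721106440, 109746711, 292224294, 68050341, -7288596, -1611279,
  83862, 1107], [-2243248128, -9493991424, -20424075264, -27412674048, -16233765120, 7655219712,
  15770156544, 5772590496, -1939461840, -2305795680, -658694160, 163475712, 137810592, 25757568,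
  -6418656, -2238624, 73008, 31968, -1296], [-37822464, -268627968, -773356032, -1073226240,
  -499132800, 535120128, 819917856, 224471520, -252883080, -186400656, 4237704, 40262400, 8916912,
  -2876256, -1202256, -14688, 34776, 2160, -216]]

def cA4 : List (List ℤ) :=
  [[-11466178560, -31531991040, 25798901760, 185967083520, 235728506880, 57073351680,
  -111330547200, -91413100800, -6361545600, 20022422400, 8421874560, 88179840, -793618560,
  -236545920, -29393280, -1399680], [-1389467271168, -6626516926464, -12196895293440,
  -10214280216576, -2646545716224, 1679623382016, 1532236684032, 653215674240, 232846306560,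
  10702925280, -48498823872, -22573015200, -3623510376, -140087232, -35203248, -15727608,
  -1043280, 131544, 11016], [-23570639290368, -115127497801728, -223455980703744,
  -220975877827584, -116655163974144, -26053290648576, 9033455854080, 12335743996992,
  6183592431840, 1388121139296, -66381424128, -140322269808, -52256953872, -11172734136,
  -754782840, 209604240, 44431200, 2051784, -84024, -6480], [-57713729421312, -301346204000256,
  -497235523986432, -282255272773632, 67016666891520, 170123288249088, 102771493464384,
  29327368944384, -4092196651920, -7591661306928, -2990338696080, -496073333664, 41602129632,
  46441975320, 10547129232, 508478040, -142168608, -17746776, -164016, 40824], [72748516147200,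
  6422026567680, 111797770917888, 630365278123008, 724114450096128, 299876161443840,
  -14182100625024, -84117671819712, -50270693097024, -11586231798624, 1667738598912,
  1801221739344, 505073835504, 36836390088, -16390166616, -3824964288, -64965888, 39831912,
  1899432, -99360], [346577857904640, 439344544235520, 512111622758400, 640352938871808,
  51911548328448, -429556396755456, -322137025887744, -99408394648512, 12712200000480,
  27413287814112, 10594950124704, 1229496775632, -449273179512, -212681363832, -21676187952,
  3917418624, 704737872, -13220928, -4329096, 103656], [219364540219392, -365293321273344,
  -740024608315392, -738681379080192, -868379629441536, -421773028936704, 55943850699648,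
  149726262695040, 83837982312864, 16295570168448, -5496089088192, -3886619123232, -855063590400,
  44284260528, 52358956848, 4321977408, -681719616, -60828624, 3422256, -8832], [-177465176014848,
  -909275037278208, -603583915521024, -49241750952960, 225947176148736, 473060055409920,
  302288721060672, 63690704068032, -30316870600560, -32122741037808, -10169536588464,
  -424780822512, 793702337184, 250497887760, -1058348160, -7952595696, -337459536, 69292800,
  889104, -72960], [-115058110267392, 36995859922944, 771127204294656, 822144798959616,
  463182412843008, 116145732280320, -126755160162048, -117619721981568, -46884736445184,
  -2740816211520, 6160130632320, 2736154867104, 437936853600, -110915468784, -41642968752,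
  261691200, 706469760, 2989008, -2652720, 43392], [56069943951360, 304057405194240,
  310489352478720, -88521752954880, -305946696867840, -257348570674176, -107158324587264,
  6100451453952, 26643159261504, 15202255377696, 2867109110016, -434948479488, -443688991128,
  -96730786800, 11741871024, 3982668552, -71783856, -34044840, 554232, 15888], [1084306391040,
  -46659529605120, -198077625483264, -245229801421824, -111287744441856, 25159245262848,
  63276269379840, 36888571517760, 7360909118496, -2671189917600, -2596110174336, -662684223024,
  -39615910416, 48483364392, 11171030760, -826432560, -220463136, 6141096, 767784, -17808],
  [-1963958157312, -13672187437056, -8587928226816, 33858215313408, 62075550456576,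
  43283490953472, 9244251421632, -7347873815424, -6717245817456, -2351925344784, -118244106480,
  228664615680, 79609257504, 11081560824, -3362214960, -764523720, 36180288, 7259112, -213072,
  -1608], [20711866368, 1714909052928, 6516159657984, 8673875813376, 2866703247360,
  -4446612882432, -5590849850496, -2329023017664, 144557030592, 585941764128, 295979278848,
  50528017296, -7942494672, -5516421336, -1122587640, 125847936, 31105152, -1058616, -134520,
  3360], [-14759559168, 55736795136, 218948714496, 46798765056, -457276737024, -554036295168,
  -123174849024, 196514597952, 165275317728, 41888168736, -13041836256, -14653464624, -4140674568,
  -271035864, 209026224, 61015536, -1664208, -790128, 18696, 264], [3336929280, 22155264000,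
  49971161088, 36688785408, -24099061248, -50960683008, -16679564928, 14096664576, 12260741472,
  1745991360, -2144500416, -1205540928, -30811104, 130796640, 35981280, -1924128, -1555200,
  -19872, 13536, -288], [-113295360, -916561920, -3144932352, -5764045824, -5524676352,
  -1346588928, 2758942656, 2926800576, 639604080, -672355536, -459194064, -27055728, 62325216,
  18503136, -1099872, -1133856, -100944, 12528, 1392, -48]]

def cA5 : List (List ℤ) :=
  [[-14969733120, -93083074560, -197122719744, -113982971904, 170562640896, 280398267648,
  78408425088, -102724117056, -80441079264, -3687192576, 16194422016, 6059867904, -80092800,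
  -567274752, -155831040, -18304704, -832032], [-1091436871680, -8042913792000, -22443844165632,
  -31032231874560, -21745102447872, -5211742445568, 3080626380288, 3205548504576, 1497735573840,
  404984406528, -25603921800, -75249386208, -27977183406, -4084207920, -53119314, 32142096,
  -1315602, -408240, 11178, 1296], [-12273617387520, -105335966674944, -312392736046080,
  -462402432739584, -390158923969152, -199182506170752, -60255987575040, -4305687777360,
  7283836374552, 4553351594496, 1312148622240, 200652081120, 4512010824, -12844926648,
  -5551976736, -914804064, -20953944, 9270504, 765504, 11232, -648], [18616048865280,
  -83894860523520, -412029276602112, -494726241915648, -94830199606080, 250997383466496,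
  257801194784880, 131298274164240, 37034336431620, -592245727344, -5327577211104, -2272803555744,
  -509957694540, -46457157744, 13034450988, 5105278800, 546245748, -8548416, -4350276, -162720,
  3996], [233560824791040, 733319955025920, 967570828498944, 1239919671361536, 1484150800831488,
  1013196903644160, 302905460044800, -43054846100928, -93637220628960, -49074575969376,
  -11362151487456, 324145482480, 1021927827384, 337102614216, 44397150192, -3599286192,
  -1615383000, -97381224, 6674256, 598464, -9504], [393049552896000, 1227904982077440,
  1015349259560448, 472699248021504, -51805341724032, -767172930188544, -821598308601696,
  -408332843144064, -99783038085192, 16434310958496, 24518541874416, 8828173990320, 1322779343310,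
  -138897975456, -108913711734, -15340794336, 736127154, 249735168, 3390390, -936240, 9624],
  [92582569246720, -167638328320000, -2006350193835008, -2621114550204672, -2066331939487872,
  -1236564765706368, -220884483654912, 229711861764912, 205130626670328, 87048214490816,
  13883661924400, -4236963199936, -2786351367864, -639169911312, -13892618784, 21811518672,
  2493901416, -128946000, -18038192, 476960, -584], [-124976609464320, -848121498753024,
  -1714367411698944, -303794356550400, 909697168763712, 1214903770460928, 946015899182928,
  368520606212112, 35810120054556, -46898846677872, -32392187908728, -8852763941952,
  -540766192500, 450979086816, 146188610280, 5518988784, -2758107420, -184793040, 12723120,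
  384288, -6780], [41504879738880, 74673469317120, 826940089430016, 1943503495501824,
  1430782051295232, 498216154975488, -135206924948352, -293305492298304, -164602864307808,
  -47913610906944, -211228431360, 5745804348000, 2218853129904, 342486975312, -43702389504,
  -19593234720, -534383856, 196588656, 5084064, -504192, 3840], [23919590768640, 106436494172160,
  326850031690752, 28148040603648, -623154407929344, -691414032674304, -403953133635648,
  -100180482113664, 30727703479968, 36709524564672, 15534998728920, 2637456471168, -321922241154,
  -299446218576, -60462459486, 2996321904, 1548539586, 23313168, -7784778, 11952, 1488],
  [-27904305807360, -82158031810560, -163848813302784, -316666970069760, -249429881897856,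
  -11578970388096, 117849952823040, 105195187596816, 43423193632392, 5753812002048,
  -3583728614976, -2426685898272, -596708669160, -42863846616, 23848171776, 5693018688,
  -119830824, -70482168, -82080, 165408, -1560], [4408248545280, 29242560768000, 43342779197184,
  56527022479104, 88289748009792, 81028852107264, 34864575484176, -3107140971984, -12896394433092,
  -7666620550992, -2191826575824, -82694685984, 174977435628, 59402772720, 8478646956,
  -1120083120, -325220580, 1084896, 1809324, -21216, -156], [1691184414720, 869775642624,
  -5412264855552, -8248788301824, -7259763326976, -7942868246016, -7744331803392, -4452846390720,
  -742509660384, 751266110112, 661071117408, 263330112816, 46644696792, -2026578456, -2850891120,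
  -650347632, 22997160, 10726776, 8976, -29760, 288], [-457018490880, -1653311631360,
  -2031871977984, -421446260736, 1363784317056, 1526489973504, 744783336864, 204170494464,
  39623453784, -4343036256, -19149695808, -19936551120, -11343714174, -3274631136, -430581978,
  55511136, 27875646, 464544, -188118, 1392, 24], [13383106560, 87402086400, 244264258560,
  351988727040, 224940410496, -48063199104, -178071471360, -107280261360, -9350101656,
  20276769600, 10885642224, 1203393408, -705882600, -149585760, 53601984, 22947408, 782424,
  -557856, -24048, 2784, -24], [-136376320, -1315727360, -5513734912, -12969740544, -18170557248,
  -13950470400, -2333152464, 5968090032, 5505643812, 1286462512, -836397016, -619602560,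
  -87820044, 45265056, 18172992, 1127280, -441876, -66768, 680, 352, -4]]

def cA6 : List (List ℤ) :=
  [[5605687296, -12103188480, -146894487552, -324699881472, -232168218624, 112148084736,
  256882959360, 89351216640, -62258077440, -53294526720, -4426223616, 8243804160, 3100695552,
  15178752, -238381056, -63576576, -7153920, -311040], [249690193920, -1848997969920,
  -14080785334272, -34170933141504, -41380862529024, -26285918515200, -6293396127744,
  2945295779328, 3395970138816, 1680466095648, 476264036448, 15710726736, -46589921766,
  -18031195134, -2829287340, -115573932, 16241634, 1172826, -30672, 1152], [5506585460736,
  -11331905617920, -150644516511744, -399373130483712, -527046544272384, -417467629099008,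
  -221015790830592, -84814060892544, -23166128613312, -3199114137984, 449169223584, 385793423424,
  160072958088, 50893248816, 7907393880, -336328272, -271888776, -27534384, -282936, 61584, 3456],
  [5188244766720, 48152187912192, -37444974630912, -277825235300352, -224181419825664,
  128675778605568, 311595238173312, 242541911688192, 118223616871008, 37972391689056,
  5800848402576, -907478096112, -781813107180, -256686906708, -50593463784, -2986970544,
  902505924, 175373100, 8119392, -207192, -24192], [-94133552873472, 289003955355648,
  1131448980492288, 1598623782082560, 1808036898951168, 1618987743627264, 892788214185216,
  249047858832768, -15565555482624, -55851272271936, -29631820025664, -7722211205952,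
  -720397815768, 234066243024, 123885756504, 23872325184, 863813592, -310270608, -32575032,
  -225792, 65952], [-304536110571520, 403390868242432, 1430979510185984, 830763164153856,
  -113099042975232, -812251603373568, -1136808484353024, -813662055553152, -350650925550816,
  -88137062539520, 1901483507312, 11255736390016, 4358642793366, 838549220694, 28744214124,
  -29339547180, -5691920466, -88963314, 44524064, 1742728, -80800], [-248329429811200,
  324305903779840, -410224896692224, -2748185363521536, -3110333421020160, -2132453522660352,
  -916973697972480, -8109012972288, 231824707378752, 157790484287872, 59695389402752,
  10186733746624, -1198961894256, -1128824589792, -294623831760, -22790671008, 4499800944,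
  724808640, -1983952, -2422016, 22880], [132588986269696, 468191449579520, -685946450462720,
  -1170279161702400, 566252028157440, 1561404618124800, 1494977459127936, 884217301901184,
  283840483509024, 23168694439904, -30354729156896, -18613137148192, -4901363995656,
  -473974613016, 133392863184, 52053208512, 3776918232, -474821112, -45701120, 538832, 45472],
  [146747944960000, 176326599360512, 5906868846592, 967905010212864, 1751123203958784,
  994977800659968, 132061266060288, -294649308704256, -281728869033216, -127857712513792,
  -32890932492800, -718812846784, 2787177763536, 1056408497472, 173839253712, -5407127904,
  -5294904432, -282247392, 26669968, 1300160, -38336], [-62736092905472, -245426590892032,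
  -286779289812992, -113031888420864, -422104078311936, -800625013450752, -631142553709056,
  -290734969615872, -43540865360256, 32309603874848, 25928270403520, 9394019177744, 1546815034374,
  -94744140018, -116534950356, -23844901764, -190502754, 323212470, 12557296, -727216, -5696],
  [750415740928, -14706275074048, 13634897600512, 26921007237120, -43123993156608, 21000379573248,
  138194340172800, 145339101243264, 86053316344512, 27937864189184, 2537525388832, -2325777586432,
  -1293282234840, -303593522352, -26967439848, 6150920208, 1710542712, 29158224, -11573336,
  -285616, 13888], [786748702720, 21092758323200, 69362153568256, 82092035493888, 59678679747072,
  44491844755968, 19124643622272, -6733259183616, -15976270380000, -11837249044192,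
  -4950961780016, -1161478830448, -22208532204, 79603280940, 25326849048, 3824727792, -103685244,
  -73365780, -1754528, 199304, -320], [355743268864, 1925080432640, -4642245545984,
  -22513003640832, -31295109691392, -23550731572224, -11495291632896, -3091583250816,
  613400137728, 1425523560512, 989373147712, 443433099008, 133612902024, 21506815344, 155816664,
  -795002592, -212981352, -3190800, 1882024, 50624, -2528], [-15443271680, -920532385792,
  -3056444911616, -3320717629440, 123627412992, 3537968911872, 3642961454592, 1729997268096,
  227780394144, -226638821440, -173863887248, -66648754144, -19668237366, -5643668454,
  -1390666476, -238297764, -5652078, 6295074, 263488, -19288, -32], [-1460666368, 18488246272,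
  148776538112, 411005411328, 548820077568, 306132344832, -99073330944, -260238008064,
  -155189749056, -23330296064, 21552481472, 14844571648, 3718115904, 171983328, -68129952,
  7997664, 7732896, 727968, -97696, -6752, 224], [-12550144, -365576192, -2662242304, -9488283648,
  -19690065408, -24733487616, -17097627264, -2288947584, 6696847200, 5769099424, 1462930112,
  -586980224, -502353312, -106623552, 11919360, 8818176, 1133088, -43872, -16960, -512, 32]]

def cA7 : List (List ℤ) :=
  [[12560891904, 66411823104, 101780029440, -40378466304, -269452431360, -238138555392,
  33316710912, 161703095040, 67261276800, -24712574976, -26008829568, -3781347840, 2698189056,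
  1163939328, 71024256, -54998784, -15590016, -1714176, -71424], [643564240896, 3073796014080,
  2979567378432, -8877970132992, -27487384171776, -32920374191616, -20467479315456,
  -5531780427264, 1346919110784, 2105102619456, 1145162661504, 367500560832, 50706013545,
  -10173597282, -5951666241, -1070870364, -73529865, 1002078, 257601, 3072, 576], [7232411074560,
  39706945830912, 58854756544512, -39218096765952, -223892340346368, -313514510575104,
  -250579750574592, -139937171229504, -61558090854048, -22126368545664, -6427626350016,
  -1539942021960, -273514803804, -1317018024, 18330478020, 5171625288, 539966700, 435816,
  -3606996, -215808, -7968], [-39362080096256, -111412231856128, -119972650984448,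
  -155997437426688, -225783053590272, -104100084844032, 112696038352320, 185697886095552,
  134423035589904, 66811424724512, 24154047668392, 6086406388616, 1015211112450, 59238878916,
  -39169553610, -16229102304, -2510645874, -91672428, 14718514, 1431584, 46480],
  [-232566874636288, -737212080029696, -524138103205888, 336064957169664, 927544988709888,
  1161073842829824, 969449449511424, 500986910977152, 152337277860096, 12063198891808,
  -16802000288656, -10556249219000, -3248280100428, -611213999592, -43109496060, 18009287256,
  6020136060, 587883720, -6353860, -3469472, -134752], [-278108895703040, -788334509375488,
  274173911019520, 1333956821084160, 789560477518080, -39137024165376, -592935579092352,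
  -706647500484864, -451291098341712, -190750234101568, -53807959468856, -6083703946120,
  1969901756223, 1113230459802, 280896235449, 31391381796, -2979008799, -1068686742, -56646161,
  2858912, 195136], [50650627178496, 228880456704000, 1446273171861504, 570069700641792,
  -1442230482498048, -1783228214946816, -1186822623062016, -430861554037440, 27870850914912,
  114624929141952, 71470088314272, 26229693992304, 5230461390120, 217835668656, -212073587064,
  -73897172784, -8661457224, 264842928, 96313944, 1797984, -99264], [128074418421760,
  414705492303872, 713429327395840, -658758625268736, -826975246071552, 399088970405376,
  958666732754496, 852012980257728, 451411771921584, 136605256757408, 14724044852896,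
  -9857637845488, -6144358844820, -1642309713960, -215161871340, 14851376736, 10362605268,
  1030757208, -22486580, -4272448, -76784], [-94986974232576, -145765895405568, -304534765215744,
  -540727425736704, 322167674161152, 757184755027968, 333680396631552, -60236252794368,
  -202246513530624, -144642811133376, -58500708344544, -14418215008176, -907306900344,
  692826401232, 281561362056, 49507088976, 1113449400, -756502128, -55351080, 1133760, 107328],
  [-31206991044608, -25753438191616, -135628148547584, -189529884844032, -81377082127104,
  -291749058624000, -417147793178880, -274432038074880, -101935075803744, -2356807398208,
  18194548202320, 10858853637488, 3453453929607, 552381271122, -4694207727, -25362128532,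
  -5331500151, -236023086, 29702575, 1593920, -6848], [42134802890752, 104000195723264,
  73755251445760, 101292803607552, 147616443231744, 124893039856128, 134494100178432,
  130152681452352, 84495575023008, 38132342932736, 9720180922048, 287691753560, -934058811180,
  -413812332456, -86949607980, -8124118392, 812291484, 286137672, 12304252, -725824, -34976],
  [-9270742450176, -47342326456320, -56510686473216, -3914083869696, 21628635833088,
  2308925541888, -17786055231936, -27431132686272, -24233631949008, -14686490957472,
  -6519479070936, -1967480400792, -347504925438, 11258834724, 23386676310, 6124707648, 905202126,
  25482996, -7708014, -288096, 5808], [-751088271360, 3128515166208, 14767136673792,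
  14535038361600, -5211698162688, -19130583412224, -14825966178816, -4172989237632, 2136976016256,
  3001624975776, 1783693980528, 701776665192, 201057055236, 41169710232, 4513036212, -19361448,
  -127634868, -38383704, -1911828, 124896, 6432], [332634853376, 1127494402048, 492542382080,
  -2438978795520, -3644392583424, -743532845568, 2461516194432, 2733160872192, 1217667118512,
  42123303232, -258851520664, -163977735848, -55198738671, -12081898506, -1961063241, -300723252,
  -55942401, -5295066, 618497, 34336, -448], [-5303468032, -36701609984, -79310172160,
  -4142257152, 247835742720, 413869910016, 242810416128, -65011692864, -182217703776,
  -107995691840, -18017472544, 12991350400, 9708793248, 2864224032, 375487392, 5932128, -305472,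
  1363872, 206336, -5408, -640], [35405824, 281403392, 751375360, 36123648, -4570471680,
  -12472278528, -16756562496, -11721409728, -1763371632, 4058692064, 3490460560, 945254144,
  -249350448, -252373056, -66605664, -2923968, 1963632, 371040, 14224, -1408, -80]]

def cA8 : List (List ℤ) :=
  [[245366784, 23701487616, 109693108224, 180073857024, 68520812544, -139297646592, -164545108992,
  -16629705216, 66595841280, 34307894016, -4878100224, -8633039616, -1853397504, 513824256,
  300278016, 38990592, -4969728, -2052864, -230400, -9216], [118578216960, 1645295960064,
  5887476498432, 7972871012352, 285953052672, -12381107152896, -16841507558400, -11122996269312,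
  -3819617716608, -143775002304, 645721226880, 436991570304, 161362187640, 33188867928,
  1943921448, -726381432, -182837232, -16020864, -410256, -3840, -1536], [2567635861504,
  22890528997376, 78881219928064, 130519450208256, 99254714188800, 3241435481088, -60512200232448,
  -61975680789120, -39110537635392, -19617596929216, -8252534485376, -2949762361696,
  -912151913664, -225225098160, -34418616240, -805338048, 737071680, 128144112, 8384368, 245408,
  8704], [12516215193600, -27749599297536, -135926701811712, -189250064068608, -199709187798528,
  -187055875266048, -94128991095168, 9528794341632, 45680849055072, 36687560828448,
  19657577689824, 7834800151872, 2408246186544, 609073293600, 119147250672, 11894068224,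
  -929741184, -396088272, -38264160, -1318512, -20160], [70361897172992, -220893794729984,
  -860390503763968, -865665046026240, -337042996690944, 94148816848896, 312229911196416,
  293237342261376, 154655463736704, 52318956021568, 9169064189312, -2036030528288, -2038427860416,
  -764529423312, -202342272144, -35410463232, -1782454368, 532510032, 90134864, 4176736, 32480],
  [193504203243520, -127571420741632, -523601113726976, 382454170662912, 1036722996913152,
  702773472003072, 216267622190592, -113362798031232, -198616785303360, -130351128778048,
  -57141155916032, -17721112644640, -3291026908152, -173276441160, 107625416856, 46348518696,
  7956116688, 189803760, -89842160, -7179280, -51296], [152831818465280, 48950365978624,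
  402901985841152, 1402232291364864, 747584312607744, -345519189832704, -581648742396672,
  -401211738905088, -136284671203008, 7069700968576, 30527798236928, 18830883544192,
  6890005126848, 1547924956224, 201848614464, -3846494688, -8490753696, -1307390784, -25977664,
  4838368, 54176], [-81356507283456, -260865374306304, -99027578947584, -23591452981248,
  -813997870170624, -668763121144320, -26825432079744, 252646492143744, 249757745782176,
  126702565757856, 37087703415264, 4550744336160, -1921276513152, -1216812097728, -330138074016,
  -51881202432, -1330019424, 998283456, 118867680, 2218560, -7392], [-62044530606080,
  -170811419754496, -131825344815104, -148894664503296, -216927279181824, 200484704145408,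
  282483205255680, 94441451748096, -34836938254848, -68160592329856, -42117778469888,
  -15657065436736, -3681806307456, -323002207392, 91432621536, 41651581056, 7399714368, 331092384,
  -52456544, -4527040, -37184], [48148165230592, 125798459211776, 289588001652736,
  254708416720896, 101886720964608, 37281031010304, -102957904800768, -127457593322496,
  -68212861300992, -17275568228416, 5208372423040, 6419910546752, 2931676244232, 800913077832,
  117849048792, 2491784664, -2990081616, -600673440, -35852144, 647264, 20032], [-15303172620288,
  1955657220096, 3344857497600, -103684574877696, -108994844279808, -23421919915008,
  32692999302144, 62599962676608, 52160223684672, 27323750434368, 9710038119552, 1632777405600,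
  -265517273664, -277705669680, -89267783472, -14746922496, -1144145664, 60684912, 24388080,
  1408224, 9024], [2675886489600, -5329154555904, -48379949217792, -58543045779456,
  -4085572004352, 26890943307264, 13371000624000, -7599523650048, -16327970303328,
  -12702736084128, -6305936954208, -2211978801024, -504250364304, -54960236064, 10665605232,
  5105369664, 870539328, 100438704, 5309664, -290928, -5760], [27504541696, -1010173444096,
  4205466284032, 19385859950592, 23322679873536, 8132464029696, -5216837359872, -6006597175680,
  -1302231642240, 1574949488192, 1666242725248, 856621308512, 286360194624, 64662615408,
  8952339120, 277729152, -83585760, -14288880, -3406064, -250528, -1952], [-93432381440,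
  149295988736, 1105832574976, 828844283904, -1697267641344, -3147139200000, -1583861841408,
  502683788928, 1015951201728, 478638822464, 202460416, -116383273120, -70259384712, -22831859544,
  -4567316376, -541070472, -33891216, -4508112, -791312, 17072, 544], [576258048, -6146850816,
  -51885158400, -132064100352, -124680619008, 41981524992, 189432808704, 139560226560,
  -4385676096, -67185280512, -42947744256, -8420944320, 4102954560, 3400025760, 1072706976,
  172633248, 11599200, -30240, 98784, 24480, 288], [6324224, 106283008, 634284032, 1896056832,
  2969018880, 1584228864, -2659081344, -6048812928, -5021833632, -1192666400, 1290261152,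
  1243731232, 366046176, -60479040, -76867008, -22802496, -2561376, 96096, 47264, 3232, 32]]

def cA9 : List (List ℤ) :=
  [[-4169400320, -18602721280, -15362293760, 51735552000, 122758339584, 75669497088, -41600689536,
  -74014744128, -19900109280, 17126145536, 11847214528, 425687744, -1766131104, -543054336,
  25228032, 44094336, 8738112, 356352, -95744, -13312, -512], [-136566341632, -458779590656,
  280891596800, 3254721097728, 5330349466368, 2260286533632, -3457414757760, -5940969470976,
  -4389064883088, -1942069405952, -500222305168, -6380038400, 63811160112, 32198158896,
  8287992444, 1113517632, 42533592, -7036080, -684100, 14176, 2432], [-423179763712, -57273823232,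
  11076651533312, 43657347327744, 78004469864832, 77768060193408, 46620122598912, 17809841951664,
  4388023401816, 7511268928, -972017330704, -773634792944, -408368968440, -167979777168,
  -50782030368, -10004288928, -1092569088, -38408208, 3143936, 228736, -496], [21964200333312,
  84197789177856, 96977114206464, 22477383053568, -40720463122752, -66629816319744,
  -68605390267920, -41943622523184, -12638983463964, 337611461280, 2864054580600, 2131094348304,
  1007071721676, 368783319456, 115787903832, 28190979360, 4340351232, 320022432, 186888, -1122528,
  -32568], [75755214274560, 275681309368320, 143697961371648, -279655938634752, -385082908876800,
  -233636050573056, -85980754365696, 7527384051840, 31347550876320, 18983238684672, 7123171684032,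
  1567102909200, -105316326864, -211710834432, -95974100784, -32327021664, -7189753536,
  -811147536, -22869120, 2472480, 134688], [29232912834560, 200349463121920, -115583453346304,
  -361484100151296, 91256845080192, 365012762956032, 272692911109152, 124710067638528,
  16411844754552, -20513888274560, -16799076789352, -8025552222464, -2653761079608, -574120928496,
  -80434743972, -295808640, 4169303448, 954064272, 60698756, -2234816, -247312],
  [-103126211182592, -89740930994176, -322962552347648, -61918771143936, 451823808874368,
  227443761172608, -74912390874624, -130898904199440, -89186839843656, -28421314742176,
  274246440832, 4627667104784, 2878908555264, 1030584578880, 243754266336, 41875863360,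
  3514663416, -325137216, -72929024, -1065568, 188464], [-38470465196032, -1956092106752,
  -144280886234368, -50563084773120, -78161958766272, -349492428782592, -233664628906032,
  -39186731976240, 39250823969532, 44665595327296, 21037563043184, 5591146656160, 539783501736,
  -315437676096, -166555554000, -43587880080, -7259647404, -485048544, 28610240, 3637504, 39128],
  [67723598036992, 119984876896256, 22177920372736, 74670416056320, 110158463188992,
  98915666885376, 175063174670976, 118718283279936, 36816968063904, -3849629253760,
  -12910727424512, -7446430466848, -2544414698496, -543035538816, -45643991232, 9414714048,
  4029274848, 606274656, 24130048, -1736128, -143168], [459718246400, -34198937968640,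
  -29869590191104, 130059487266816, 142591373210112, 43624209474048, -16305567734976,
  -59422940851584, -44769940701504, -18635709006080, -3533002557472, 1441801454848, 1311158686512,
  512439250992, 122105324244, 15718201824, 389313240, -197826576, -26675068, -937760, 37664],
  [-16864076513280, -47424857395200, -19118382044160, -17135816811264, -104877969231744,
  -119933313584256, -62950895972352, -12688382161008, 12982959608904, 12774331235712,
  6288894393648, 1898889946032, 196122055176, -90801117648, -53898418944, -13635254304,
  -1648578672, -72436752, 4240896, 772032, 40560], [5743255334912, 26756355352576, 37243770918656,
  9438324867840, -3476694265536, 21325283090688, 33393769114512, 21991748132976, 6642959854044,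
  -1452345614048, -2464255616104, -1343036059568, -445924461588, -86590273152, -5005604904,
  2866266912, 806481816, 79317984, 3425768, 85792, -13576], [-506921484288, -3550302855168,
  -9845973276672, -10381709638656, -622321044480, 5236384958208, 963749680128, -3634724571264,
  -3566259856224, -1428553564800, -19342871040, 289332093648, 175773178800, 59324148864,
  12424759920, 1356927264, -43540128, -23325264, -1448832, -83040, -7392], [-14989484032,
  -96648359936, 192224916992, 1175864291328, 1434470278272, 143237418240, -905032547808,
  -598775687040, 87898986840, 304740270976, 167582183192, 25134109312, -18651329160, -13918499184,
  -4701010092, -927858336, -98751720, -2186448, 238268, -17024, 1136], [964444160, 6958796800,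
  14027303936, -7000514304, -64098115968, -86034579072, -21536812032, 52665140688, 52731290280,
  10063537888, -13028241952, -10304535632, -2597914320, 572817696, 636298176, 210937728, 36390840,
  3098208, 54272, -1760, 848], [-3665920, -26224640, -43965184, 161870592, 906106560, 1887914496,
  1946664624, 526450416, -1101403068, -1380419072, -527966080, 182770048, 260639040, 87618336,
  -6163296, -13390512, -4209996, -581280, -27184, 1216, 104]]

def cA10 : List (List ℤ) :=
  [[-959447040, -9464709120, -30583554048, -39370457088, -3022073856, 44475927552, 39407196672,
  -2081094912, -19780295040, -8309200512, 2154497280, 2517696000, 449854848, -181037952,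
  -90630144, -10225152, 1974528, 698112, 76800, 3072], [-61496885248, -423645937664,
  -1097355231232, -1141282406400, 201863897088, 1581336394752, 1218213691392, -260996846592,
  -1117392914976, -982029040160, -522013696336, -193646475104, -47861136762, -5061580482,
  1203736332, 575780412, 94338942, 5731302, -218176, -40064, -1024], [-1258196369408,
  -5715039698944, -12398314360832, -15878220635136, -10057045424640, 1805186660352, 8881888390656,
  8338867325760, 5372360346336, 3006811086752, 1420695348736, 524478744272, 142788253992,
  20555857704, -3921390048, -3057205728, -761537688, -94009944, -5180048, -45088, 2944],
  [-8768237617152, -5205128355840, 33594646318080, 51689996107776, 25050588542208, 269442286848,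
  -9386918580672, -11711425030272, -8089320290256, -3688894555344, -1412935354608, -449287637280,
  -91173302244, -2939150196, 9897225768, 6577395048, 2127328956, 363221964, 31102272, 1098096,
  8448], [-33039631319040, -5755006033920, 124952496592896, 105213421753344, -31097005277184,
  -68379722601984, -43934172011136, -21155549499072, -5252651454528, 235225909152, 516727321344,
  280961545392, 81117015624, -3029502168, -8906588064, -5521432608, -2502149400, -610121592,
  -72036144, -3584160, -48672], [-50084619509760, -51074489057280, 29340079607808,
  -108407419665408, -163595390870016, -6420259501056, 68467113407232, 56295948038976,
  30608051963616, 9594217565376, 1242226847616, -304615905120, -332168228118, -129599322606,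
  -29156544540, -4913418348, 145283346, 383246154, 77735136, 5270448, 78624], [560027533312,
  -15320175714304, 32093856335872, -51967852124160, 43251833372160, 146418611928576,
  58152502356864, -7975680468864, -20867790110304, -14883696922624, -5001309915872, -685029107968,
  199640123376, 195664910448, 72171038112, 17636072928, 3196345872, 237560208, -22810112,
  -3497056, -39392], [43696457203712, 75464127225856, 176333134908416, 91673075426304,
  46785336020736, -31141383449856, -100700293995456, -59299802651712, -17163629173104,
  929060365744, 4334003450912, 2007200989504, 480335598984, 22175772072, -35921658768,
  -15583476624, -3911641032, -590014824, -35511232, 39520, -24736], [-10078040031232,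
  -9899164712960, -21219488886784, -158476278810624, -133902037180416, -54715138179072,
  4929531052800, 40996127907456, 27632522438400, 10416604347712, 1543409280128, -957559124960,
  -659198551920, -215486621904, -39594864480, -1326918048, 1404731760, 398008272, 42452384,
  1465408, 26816], [-18107491041280, -27797340815360, -76341846925312, -77326897809408,
  45266682135552, 78391951021056, 43708438682112, 10718411784576, -8401273311840, -7568109374240,
  -3337706637520, -757648100192, 106454109018, 131886529602, 49784148372, 11041663332, 1176193986,
  -27610566, -16547968, -930464, 6464], [13161303244800, 22822583500800, 25894060351488,
  64010856932352, 64840405934592, 5680853554176, -23480981243136, -18734448795840, -7108414610400,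
  341565272352, 1398702485952, 791945419536, 233332960392, 18015370920, -11885698944, -6111068544,
  -1398161304, -138431160, -3299472, 199584, -9792], [-3850826104832, -9325400743936,
  -4160989838336, -2246496061440, -16939464854784, -20631398663424, -6532302953280, 3447494985216,
  4418271795408, 2024059828112, 248440544080, -186231659104, -140849533092, -47787707796,
  -8503527576, -165530712, 378594588, 86170956, 6600640, 102320, -2624], [460287377408,
  1814995492864, 1866472134656, -1084148173824, -2195224375296, 1090725210624, 3117569142144,
  1642454889792, -104275339584, -567649249376, -317223591808, -63809368784, 16984378920,
  17094054696, 6228955776, 1286965056, 125980584, -7432152, -2390128, -113312, 2912],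
  [-5746352128, -79627550720, -275434565632, -274906807296, 171457469952, 436776158208,
  107682951936, -228082526400, -194176454496, -33687953024, 38111636384, 28775776288, 7444229430,
  -835928850, -1329803268, -489295284, -97262994, -10298922, -250144, 25456, 416], [-101908480,
  744448000, 6763489280, 16930099200, 14450366976, -8918149632, -26243212416, -14476032768,
  6429426528, 10978202944, 3844374560, -1105554656, -1427403552, -467508288, 13000512, 60499200,
  21230880, 3680256, 329504, 9184, -352], [-573440, -8888320, -51436544, -150002688, -222238464,
  -77820672, 294684864, 539186880, 353762160, -39982960, -216864128, -123336640, 1455360,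
  31136736, 12600960, 195072, -1251024, -398064, -53312, -2944, -32]]

def cA11 : List (List ℤ) :=
  [[438829056, 1220935680, -2208301056, -13317488640, -20236179456, -8930787840, 8698897152,
  11532751488, 2603005632, -2772541440, -1827614016, -84240000, 263964096, 88853760, 150336,
  -6117120, -1544832, -165888, -6912], [14348451840, 31009013760, -63637192704, -281282199552,
  -301321294848, 94369876992, 541777658112, 586793069568, 312843553488, 65199567072, -28131436776,
  -32131033296, -16164912735, -5130922518, -958171077, -59556996, 14404167, 3519594, 280725, 5376,
  -192], [86058172416, -133931212800, -1072235096064, -2437733500416, -3948338098944,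
  -4512707824896, -3311070900480, -1605448957536, -545003284464, -51856360320, 116316691152,
  106301834280, 54387486900, 19741094784, 4864895100, 602667720, -31297572, -21860496, -2822604,
  -136320, -1440], [-1391717785600, -9312159346688, -10548991281664, 5489629524480,
  15185980544640, 10037124311808, 4345794256800, 1710779132832, 262862286168, -154193078288,
  -155904515680, -118933906808, -64684072086, -25134742452, -7571530770, -1385161296, 9878046,
  61723020, 11468834, 810592, 18512], [-439194632192, -18868427149312, -10486587883520,
  33307010331648, 30820696863744, 3173641605888, -3306147308544, -1889837620800, -1124928634368,
  -272371427584, -37608995792, -22352940616, 7644806772, 8791856112, 3583427388, 1124592504,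
  58038060, -84811008, -23415020, -2240992, -70688], [13991338004480, 4297331187712,
  4052359875584, 10454085120000, -38957167803648, -47475871226880, -15033655590720, -615692438400,
  2213075283888, 1957813877824, 725115534896, 215176545256, 65450363511, 9048871518, -296949507,
  -693516660, -251709519, 22084878, 23038523, 3291616, 136064], [13614531461120, -208030945280,
  -30213109897216, -21403769915904, -24631190434560, 10432008818688, 25838054962176,
  10196889518688, 1667915449104, -1051446216416, -1132346011312, -414399713072, -108756485592,
  -19868007936, 553426968, 1393897584, 605696424, 116937120, -1214152, -2265440, -138112],
  [-14398903885824, -36044767580160, -30563485017600, 47581678803456, 48487048864128,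
  31585923926784, 5435260742880, -8827720497504, -5250565384056, -1857178890288, -112938071352,
  260014719504, 118181771820, 30707386344, 3709478196, -737965728, -602067780, -189810504,
  -22879260, -274368, 50064], [-5777985208320, 2704308805632, 37317544919040, 51670203734016,
  -20913713197056, -33313962516480, -19132687164672, -5245898372352, 2540781692352, 2179499242752,
  975044863968, 219614032176, -22959480888, -26542493568, -8294828040, -1556295984, -26808552,
  97645248, 23689800, 1708608, 39360], [9476983185408, 17947948843008, 19666019543040,
  -19450171478016, -39190448153088, -1977930233856, 10264739230080, 7217564368896, 2553377652144,
  -423856079136, -560117240712, -283480396992, -77242928049, -738341082, 4964603157, 1992160980,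
  480662937, 39345318, -6211557, -1088064, -48960], [-3569663803392, -7251816972288,
  -15470636390400, -17961468664320, 4382240419584, 15268331480832, 4560270223104, -1249740165024,
  -1873952227152, -853836268608, -37134835152, 80025081096, 54768195684, 15807043872, 1111614444,
  -539290872, -303721236, -68251536, -5492988, 960, 11616], [646902374400, 569051934720,
  684529248768, 5157878294016, 6517328738688, 279436043520, -3212174595744, -1643650458912,
  -112226302296, 313759641744, 186142276272, 33637306728, -6009664374, -7693718868, -2436756498,
  -369533232, 13145742, 23113548, 4448466, 298464, 8304], [-76104482816, -25284628480,
  499270598656, 533657859072, -618066521088, -1171657724160, -329122232832, 346914293952,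
  277614402432, 59206979840, -30072561488, -25668906088, -6787868988, 115275792, 797032140,
  296763576, 55971516, 3920064, -610652, -111712, -5024], [4036874240, 16175423488, -1138914304,
  -82260713472, -108524100864, 11772622848, 104419058880, 54190066560, -14920521648, -24339679232,
  -8473654720, 1355932840, 2121521817, 694371858, 26063859, -61442268, -23712753, -4377822,
  -420235, -10400, 128], [-116277248, -699731968, -1296312320, 388999680, 4660393728, 6099777024,
  1294923264, -3821276256, -3362247120, -198661216, 1063668016, 540921344, 4843392, -96055584,
  -39298368, -2169408, 3013392, 1056768, 167056, 13856, 448], [188416, 1445888, 3261952, -4108800,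
  -37306752, -86354688, -96206304, -32981280, 46505976, 61649840, 19359976, -14117632, -13467936,
  -2103648, 1959216, 967200, 51960, -68304, -20024, -2176, -80]]

def cA12 : List (List ℤ) :=
  [[198180864, 1224474624, 2894856192, 2702868480, -853880832, -4080374784, -2952654336,
  340685568, 1562578560, 682439040, -115081344, -185963904, -48995712, 5616000, 6037632, 1448064,
  158976, 6912], [5523111936, 26778009600, 45938147328, 15206400000, -64900279296, -118864419840,
  -92970581760, -25327472256, 16624120320, 19127396448, 8323490304, 1433634336, -550490472,
  -534457440, -208740672, -45021096, -4793472, -52056, 35784, 2304], [80264232960, 275064471552,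
  389718306816, 496176768000, 716369223168, 641477431296, 231774852096, -48084811200,
  -97507421856, -66834370464, -28429597056, -4816060656, 2146323888, 2055813768, 918046152,
  249504336, 36452448, 1414728, -289848, -33360, -768], [529845960704, 267577188352,
  -2973180507136, -4512536070144, -1579312623360, 437665075968, 198719400000, 33327882240,
  91202231856, 63718613776, 33567498608, 12017433568, -672144000, -2653115016, -1478282640,
  -525118920, -108374880, -8031192, 861584, 168568, 6464], [1086471176192, 750874476544,
  -4742573049856, -3676168264704, 3077677326336, 2158788550656, -463594519680, -262073083584,
  -379334976, -6280813280, 6692246528, -6246187760, -6490892112, -844150872, 524877960, 402254688,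
  145459680, 19963848, -943480, -422336, -23392], [-343816765440, 4788501430272, 7827243737088,
  9153757559808, 7055837747712, -1709422060032, -2716881020928, -529904546496, -159226672032,
  -14707109280, 23109208032, 1186625616, 7001679816, 5016687624, 1387238688, 193826160, -56963808,
  -25438896, -706632, 554280, 46560], [-1707769790464, 7047181189120, 4373948303360,
  -9208720951296, -7958089560576, -4362602053632, 961875654528, 1689766521216, 555922776864,
  173528766208, -18027019072, -28890327008, -8067821568, -4471206960, -1848779952, -554391456,
  -78199968, 14716560, 3283088, -275936, -52768], [1586034524160, 1950883110912, -13315349677056,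
  -17438452706304, 4586367714048, 5893978311936, 2496200998464, 125800445376, -537289610544,
  -257472555696, -81913743408, 2829294672, 9155602368, 3294394704, 959616576, 322157520,
  106871472, 2028096, -4036464, -226752, 28128], [1410546499584, -3451282341888, -5908299190272,
  8139826759680, 15419727194112, -1278489194496, -3058167976704, -1374451975296, -411141858048,
  126212373696, 92224428672, 34406894880, 6627709152, -925746480, -535153392, -51212160,
  -46731456, -9734256, 2174352, 437568, 5184], [-1831178108928, -2108156952576, 2686008434688,
  7231007692800, -2045559306240, -6903122531328, -92952559872, 811278397440, 530293614912,
  202861981344, -27627163584, -23459425344, -11626823448, -3072179088, 7632576, 29697336, 9148608,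
  8517960, 101688, -244848, -16704], [509793042432, 1564178448384, 2173244227584, -1095481617408,
  -3720253459968, 800861184, 1760412605184, 258123260736, -73274677344, -130237099680,
  -52329952512, 1978782672, 3784629168, 2567133864, 566763624, 14135760, -3218400, -4869144,
  -928536, 2736, 7872], [8086339584, -26714480640, -629481126912, -1009042956288, 190481059584,
  945041746176, 162405335232, -252044150400, -95070004272, -10745523792, 18074615568, 8891411712,
  772208640, -395257896, -337418064, -65064168, -4443264, 1357416, 577008, 61752, 768],
  [-13641973760, -74408722432, -76577810432, 113841558528, 211976767488, 12678337536,
  -123187718784, -46378838976, 18082184640, 15136050848, 3887362048, -1203978160, -1069071888,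
  -198928248, 18387816, 28624416, 6578400, 523176, -103448, -26368, -1760], [557449216,
  4534304768, 13064716288, 12753447936, -7028823552, -20187840000, -6384930816, 7866871104,
  5320028256, -125013856, -1159084064, -506207536, 22521912, 77416680, 23117280, 555648, -1908960,
  -495552, -46136, 584, 352], [-10125312, -103809024, -409516032, -784134144, -644267520,
  170210304, 758821248, 444960000, -145490976, -260568768, -63936576, 42465792, 28550304, 3058560,
  -3170304, -1460736, -73440, 90432, 23232, 2304, 96], [16384, 253952, 1537024, 4936704, 9092352,
  8759040, 1007808, -7566144, -7740624, -1007632, 3365296, 2183120, -177600, -661920, -173280,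
  64608, 38064, 1968, -2192, -496, -32]]

def cA13 : List (List ℤ) :=
  [[21233664, 164560896, 541458432, 956178432, 899195904, 258349824, -348997248, -405466560,
  -127487520, 51840000, 53986176, 13405824, -2089152, -2011392, -497664, -57024, -2592],
  [557383680, 3433365504, 8460066816, 10928590848, 8104478976, 2989108224, -1269036288,
  -3087002880, -2105833680, -364214016, 340462296, 259520544, 79966170, 1931040, -9754290,
  -4390416, -911466, -88992, -2214, 144], [6427951104, 26047819776, 10016160768, -73651910400,
  -107201510784, -30728564352, 32114227968, 25984527696, 6975885672, -131137536, -1636840128,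
  -1141387776, -363752136, -29083896, 34750944, 22091040, 6309000, 870696, 41664, -1248, -72],
  [83740078080, 382372030464, 446863273728, -29267502336, -244706565312, -8101518336, 63493968528,
  -9004748688, -16487153604, -3698078256, 113869488, 1401192192, 849173436, 165856176, -20292948,
  -32978448, -14919516, -3050208, -226116, 3840, 636], [8659320832, 71782977536, -149997615104,
  -494230149120, -61439216640, 332038593024, 53573356032, -69215766720, -9895289376, 782148512,
  2138608672, 1855116176, -314113800, -347528760, -66816336, 285936, 11699688, 4847352, 589744,
  -2656, -2432], [-522903879680, -1686507999232, -970607379968, 634120470528, 718920702336,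
  123791117568, -204433454496, -27742563456, 17644317576, -1372255840, 3675002176, -1307051152,
  -1274536074, 125343120, 117080250, 40309728, 7653450, -2679312, -833018, -14224, 5176],
  [-451432448000, -723893518336, 2357860596736, 2173187477760, -1169703470976, -812081965440,
  -11844224256, 90197165136, 11983138440, 16176584576, 3692689840, -2770615648, 493838952,
  165183888, -87102912, -32912400, -18397608, -2250480, 581680, 46400, -6440], [162577158144,
  1309288912896, 2346333768960, -1571787373824, -2613311044416, 914766859008, 505154488752,
  -34359669648, -2083694940, -8665591920, -13786393368, -461973120, 598140108, -71538912,
  86089320, 18498384, 9674172, 4329648, -6384, -66336, 4164], [43376640000, 258026594304,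
  -1130852757504, -2250891823104, 659411951616, 1763607156480, -432762781824, -159723944640,
  130667616, -23164915776, 6456069888, 4063217952, 36064368, 187236432, -25041600, -23447520,
  -1281456, -2537424, -347808, 49728, -192], [64097452032, -207443042304, -499395486720,
  434188486656, 1239593771520, -208075341312, -673922881728, 126041530752, 15350981472,
  14018722752, 11002515288, -2344397568, -452469258, -214551648, -97378974, 5135760, 274554,
  555264, 308742, -13200, -1776], [-38581813248, -69574692864, 120823698432, 335591172864,
  -102653209728, -410291051904, 45758820096, 145780785648, -16107337224, 3947521920, -6303969312,
  -2236031040, 256276296, 38457000, 80252928, 17685504, 1381464, 133128, -129120, -8544, 1128],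
  [-897822720, 21029984256, 50650523904, -32854540032, -106471971648, 15701884416, 76459457520,
  -2957702832, -17817145596, -845288208, -1082952192, 1058848512, 307939860, 13606992, -10420308,
  -11354256, -2460708, -283968, 15084, 8256, -60], [2031108096, 4160507904, -5279619072,
  -13296402432, 4137302016, 15558312960, -243042048, -7654903488, -829357344, 1257968544,
  383853024, 130743120, -77670504, -36742680, -3117168, 820656, 1043496, 213336, 15600, -2016,
  -192], [-66027520, -327716864, -380368384, 482322432, 1085557632, -61446912, -998733984,
  -224855040, 383643624, 135585952, -36530800, -30959888, -13212006, 3262128, 2238870, 389280,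
  -38010, -61008, -9766, -368, 56], [1015808, 6283264, 13792256, 7650048, -17620608, -30046848,
  -6293760, 20016240, 14652696, -3101696, -6657616, -1323488, 1091928, 572352, 22368, -71952,
  -25464, 1344, 1904, 256, 8], [-4096, -38912, -156928, -335616, -359616, -36096, 383952, 400848,
  17436, -240464, -137368, 40960, 63300, 8160, -12480, -4272, 996, 624, 8, -32, -4]]

def cA14 : List (List ℤ) :=
  [[], [24772608, 180486144, 444579840, 374906880, -182601216, -486881280, -158381568, 165556224,
  119107584, -4360608, -25500096, -8018352, 685422, 1356102, 391068, -18468, -33210, -6642, -432],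
  [148635648, 2463694848, 7066828800, 5971636224, -2318893056, -5510384640, -1282770432,
  1221302016, 576512640, 34561728, -25504992, -24160032, -8829000, -1033344, -456840, 24624,
  167400, 54432, 5832, 144], [-4933091328, -6364299264, 5223591936, 1705734144, -12013618176,
  -2296415232, 7929395712, 2188108800, -1418947200, -563518848, -169856976, -10624176, 59354172,
  17407188, -747576, -480096, -304596, -162540, -27168, -1176], [8712683520, 19016171520,
  -11530100736, -43459301376, -1662160896, 33335663616, 5068564992, -10620714240, -1376168832,
  732959616, -31769664, 282117600, 68357016, -48580416, -10621800, 452448, 119592, 190944, 60648,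
  4128], [52689346560, 38837698560, -123238084608, -41097867264, 123028250112, 13557459456,
  -53591583744, -2082979584, 10098861408, -583673472, 139429296, 278605440, -284017374, -45641934,
  24353028, 3315276, 463050, 45306, -63936, -7992], [41886056448, -63785189376, -161706958848,
  180002082816, 133394798592, -167030719488, -18737671680, 49246265088, -2862749952, -4816931328,
  1285380288, -637476480, -136231632, 158733216, 8549712, -6080832, -844560, -357696, 6480, 8928],
  [-4071555072, -74824630272, 34900623360, 214722662400, -139748696064, -148084429824,
  134953938432, 5429147904, -25931864448, 4247907840, 368249184, -596995488, 467429832, -671976,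
  -45233424, -11232, 357480, 335448, 60480, -5040], [-10654875648, 1825652736, 78999625728,
  -13304991744, -154177689600, 75272647680, 84733005312, -69634480896, 4762775808, 6957795456,
  -2089034496, 649893888, 36419760, -147501216, 14105232, 5763744, 489456, -24192, -66096],
  [204226560, 14256783360, 1603141632, -52463628288, 7247162880, 67721453568, -31104718848,
  -26352393984, 22292947008, -3972143520, -398448864, 369195408, -266641038, 40514634, 20194596,
  -2300940, -569862, -163134, 24912, 1872], [1302036480, -65617920, -9953501184, -762642432,
  21011761152, -4129726464, -17882145792, 8912125440, 4126128768, -4068068544, 1100782368,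
  -213789024, 12802968, 37698912, -9261000, -1429488, 55080, 113184, 3816, -1008], [-86704128,
  -1183924224, -181039104, 3714121728, -111172608, -4669028352, 1340153856, 2529439488,
  -1419413760, -282455424, 385306992, -130810032, 43450236, -9289836, -2022840, 675648, 153900,
  -22572, -6048, 72], [-87195648, -20840448, 360529920, 26025984, -588478464, 78741504, 476246016,
  -165934080, -174489984, 105102336, 8298048, -18169056, 6728760, -2789280, 656856, 112896,
  -51480, -4320, 1608, 96], [2039808, 6979584, -1658880, -19611648, -50688, 25173504, -2539008,
  -17524224, 5129568, 5809344, -3135504, -235872, 490878, -202050, 92988, -23580, -2250, 1782,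
  -96, -24]]

def cA15 : List (List ℤ) :=
  [[], [-589824, -1769472, -221184, 3649536, 1914624, -3469824, -2142720, 2025216, 1139616,
  -782208, -327024, 190944, 51111, -25974, -4887, 1836, 297, -54, -9], [-15335424, -30965760,
  24993792, 71608320, -20210688, -73101312, 14515200, 41257728, -9251712, -13135104, 3614112,
  2223720, -690660, -201096, 64044, 9720, -2700, -216, 36], [-154238976, -157040640, 421300224,
  321435648, -550181376, -237745152, 411049728, 56643840, -171930816, 12109248, 36921960,
  -7178760, -3873474, 1068012, 184410, -64800, -2862, 1404, -18], [-738754560, 21012480,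
  2152452096, -602228736, -2440737792, 1231248384, 1224930816, -937675008, -204422400, 308844576,
  -23050224, -44437032, 9774540, 2584440, -904500, -32184, 27972, -1080, -108], [-1642106880,
  1981808640, 3432278016, -5675636736, -1266437376, 5571915264, -1529985024, -2098725120,
  1277668944, 175724352, -305643672, 43573032, 25879473, -7834914, -450657, 361260, -20385, -3186,
  153], [-1323270144, 3961847808, -609583104, -7968043008, 6949103616, 3304267776, -6760765440,
  1692126720, 1787695488, -1141203456, 6321024, 169474896, -39986568, -5708016, 3116664, -185328,
  -49464, 4752, 72], [-201867264, 2260500480, -4007964672, -1118195712, 8178416640, -5418952704,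
  -2960727552, 5115723264, -1595865024, -763611264, 636152400, -90334224, -45716508, 17214984,
  -642708, -500256, 61020, 1512, -252], [179011584, -28753920, -1756864512, 2738368512, 839116800,
  -4786587648, 3052256256, 1266789888, -2457357696, 1004977728, 92870496, -199467792, 52371576,
  2446416, -3257064, 403056, 23112, -5616, 72], [41656320, -274268160, 215543808, 815726592,
  -1402755840, -48121344, 1679989248, -1234075392, -193909248, 706664448, -370387296, 45828720,
  28553769, -12181050, 1169991, 233604, -52137, 1350, 153], [-13271040, -4423680, 143106048,
  -168818688, -192070656, 463712256, -132682752, -330082560, 320398848, -33619968, -108178848,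
  74029896, -18453204, -460296, 1255068, -232200, 3780, 2376, -108], [-1622016, 12828672,
  -13326336, -32237568, 61779456, 4783104, -79812864, 48847104, 27357696, -44479296, 13798728,
  7608600, -7836642, 2698380, -341766, -36288, 15282, -1188, -18], [589824, -1105920, -1880064,
  4921344, 691200, -8156160, 3939840, 5425920, -5892480, -79200, 2855952, -1450440, -123012,
  405432, -180900, 36936, -2700, -216, 36], [-36864, 0, 165888, -55296, -311040, 207360, 276480,
  -311040, -71280, 221760, -64152, -61560, 49599, -6318, -7695, 4644, -1215, 162, -9]]

/-- The incidence correspondence between the roots of the polynomial and of its dual. -/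
def cA : List (List (List ℤ)) :=
  [cA0, cA1, cA2, cA3, cA4, cA5, cA6, cA7, cA8, cA9, cA10, cA11, cA12, cA13, cA14, cA15]

def cB0 : List (List ℤ) :=
  [[-5308416, -26542080, -39149568, 12939264, 80932608, 36080640, -64509696, -51570432, 27425952,
  31700160, -6766416, -11207808, 953775, 2404728, -51516, -305208, -8262, 21384, 1620, -648, -81],
  [-254803968, -1019215872, -859963392, 1481048064, 2403717120, -671846400, -2424619008,
  -50761728, 1367207424, 154400256, -479188224, -58786560, 104567760, 10859184, -13331952,
  -1318032, 921456, 104976, -27216, -3888], [-5308416000, -15840313344, -1693384704, 33005076480,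
  16722008064, -31766888448, -18922678272, 18785323008, 10119188736, -7349792256, -2912630400,
  1821906432, 456048792, -254873952, -43922736, 19097856, 2760480, -660960, -94608, 5184, 648],
  [-62426972160, -121286688768, 110361968640, 282593525760, -101353254912, -288508760064,
  76918947840, 160881831936, -46033795584, -49771749888, 16444124928, 8108626176, -2864946672,
  -770675472, 255966480, 46457712, -11349072, -1714608, 190512, 27216], [-449622835200,
  -386006777856, 1275089485824, 734771036160, -1668965243904, -442193375232, 1196498967552,
  10595515392, -457014773376, 74033761536, 85215654720, -20583424512, -8876518812, 2392340832,
  573196176, -137876256, -23745960, 3538080, 535248, -18144, -2268], [-1995879481344,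
  620702466048, 5528131338240, -3022914650112, -5459343224832, 4350456262656, 1942872293376,
  -2510295846912, 18020040192, 586436433408, -90749465856, -71888124672, 15647267664, 5288585904,
  -1199000880, -249108048, 43844976, 7103376, -571536, -81648], [-5088392773632, 8621759397888,
  6184469200896, -19272934195200, 4763292936192, 12510393090048, -8190387394560, -1754689112064,
  2701587748608, -176316424704, -414430805376, 69501970944, 36359718696, -7525605024, -2002471632,
  384507648, 70271712, -8545824, -1315440, 36288, 4536], [-5586576998400, 22527728418816,
  -21588234338304, -15387850506240, 36882757914624, -13693833105408, -10236347301888,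
  8119974408192, 427752285696, -1679869186560, 190479714048, 184239878400, -33530442480,
  -12269793168, 2410493904, 524261808, -81239760, -13471920, 952560, 136080], [2170558218240,
  10308529815552, -45007491317760, 49827184680960, -4028064671232, -27834417690624,
  14757150094848, 3764176344576, -4626985425984, 210494381184, 670799441952, -101458490112,
  -56016453798, 10771466832, 2946499416, -530848080, -98555940, 11294640, 1746360, -45360, -5670],
  [5586576998400, -22527728418816, 21588234338304, 15387850506240, -36882757914624,
  13693833105408, 10236347301888, -8119974408192, -427752285696, 1679869186560, -190479714048,
  -184239878400, 33530442480, 12269793168, -2410493904, -524261808, 81239760, 13471920, -952560,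
  -136080], [-5088392773632, 8621759397888, 6184469200896, -19272934195200, 4763292936192,
  12510393090048, -8190387394560, -1754689112064, 2701587748608, -176316424704, -414430805376,
  69501970944, 36359718696, -7525605024, -2002471632, 384507648, 70271712, -8545824, -1315440,
  36288, 4536], [1995879481344, -620702466048, -5528131338240, 3022914650112, 5459343224832,
  -4350456262656, -1942872293376, 2510295846912, -18020040192, -586436433408, 90749465856,
  71888124672, -15647267664, -5288585904, 1199000880, 249108048, -43844976, -7103376, 571536,
  81648], [-449622835200, -386006777856, 1275089485824, 734771036160, -1668965243904,
  -442193375232, 1196498967552, 10595515392, -457014773376, 74033761536, 85215654720,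
  -20583424512, -8876518812, 2392340832, 573196176, -137876256, -23745960, 3538080, 535248,
  -18144, -2268], [62426972160, 121286688768, -110361968640, -282593525760, 101353254912,
  288508760064, -76918947840, -160881831936, 46033795584, 49771749888, -16444124928, -8108626176,
  2864946672, 770675472, -255966480, -46457712, 11349072, 1714608, -190512, -27216], [-5308416000,
  -15840313344, -1693384704, 33005076480, 16722008064, -31766888448, -18922678272, 18785323008,
  10119188736, -7349792256, -2912630400, 1821906432, 456048792, -254873952, -43922736, 19097856,
  2760480, -660960, -94608, 5184, 648], [254803968, 1019215872, 859963392, -1481048064,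
  -2403717120, 671846400, 2424619008, 50761728, -1367207424, -154400256, 479188224, 58786560,
  -104567760, -10859184, 13331952, 1318032, -921456, -104976, 27216, 3888], [-5308416, -26542080,
  -39149568, 12939264, 80932608, 36080640, -64509696, -51570432, 27425952, 31700160, -6766416,
  -11207808, 953775, 2404728, -51516, -305208, -8262, 21384, 1620, -648, -81]]

def cB1 : List (List ℤ) :=
  [[-169869312, -976748544, -1953497088, -875888640, 2255413248, 2929747968, -310791168,
  -2321726976, -695796480, 885914496, 480033216, -172764576, -145523952, 11819520, 23499072,
  1570752, -1920672, -342144, 51840, 18144, 1296], [-5110235136, -14906032128, -16806445056,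
  -22610755584, -30798931968, -2637868032, 29888663040, 18640191744, -425347200, -4556903616,
  -5643952992, -2135731536, 1736595504, 1085795928, -98527752, -164630232, -23438808, 6553224,
  2539944, 309096, 8424, -864], [-137045606400, 180523302912, 1195689517056, 280584069120,
  -2009258680320, -1252371704832, 822781753344, 784551308544, 71196309504, -141755486400,
  -114326549280, -5201012592, 22051306080, 3629041704, -1347833520, -137241216, 89799192,
  -1405512, -12087360, -3247776, -309096, -4752], [-3838621777920, 1156565827584, 22107840675840,
  9773994221568, -19713571375104, -7255712941056, 6862779468288, 1637963451648, -456259070592,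
  -643150953792, -132010790688, 218781623376, 34674927120, -30092818680, -5746745880, 1022674248,
  295470504, 16914744, 14745240, 9036360, 1573992, 64800], [-39324922675200, -41156159864832,
  102695085785088, 2772342374400, -91593322850304, 36225675463680, 19676642508288, -6817685075712,
  -2906549889408, -1859943180096, 1277997147360, 480532242096, -236251345248, -43078587048,
  16493137056, 3334149216, -307054800, -149688000, -253152, -6318000, -3233520, -239544],
  [-12533991211008, -136461963755520, 393915171078144, -333192412348416, -48432988440576,
  183591085040640, -47902295517696, -11446042639104, -5816219043456, 2951678836800, 3714668483616,
  -1399904074512, -367062687504, 146299197816, 24639782040, -4245373944, -1730364120, 24671304,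
  3843720, -12570552, 2211624, 437184], [-49245931044864, 89295758622720, 419649290919936,
  -943496476876800, 653814031675392, -36702416673792, -132841033731072, 26406717901056,
  -3130824068352, 16511780155968, -4358267723808, -2657990727216, 883085512032, 135710428104,
  -42019307280, -11308209120, 1131172776, 575865288, -19237824, 24512544, 2569320, -401760],
  [-170657788723200, 562687859884032, -686027363549184, -66394921328640, 854654539880448,
  -665091767522304, 129590607794688, 13484708907264, 20339801053056, -1184269972032,
  -12654649598112, 3616399230480, 860590254672, -274931523864, -51318048312, 7836941160,
  3832430760, -515461320, -7705800, -6886296, -6082776, 81216], [68529951866880, 11833860685824,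
  -610956970721280, 1052006637109248, -507255950555136, -254014610936832, 302174113724928,
  -62967731685120, 17369779003776, -29747611568448, 6617052028512, 4316882422320, -1324041287616,
  -206956877256, 48851678016, 19067965056, -2920502304, -389309328, 33968160, -18044208, 3973536,
  198936], [38533791744000, -226903315709952, 462800542629888, -110035215728640, -484323688986624,
  404467745946624, -13352352118272, -57478332665088, -8372774812032, 146213470656, 12439250318304,
  -3528475290864, -877873291632, 251155739016, 64389134952, -11818732680, -2783409480, 508194648,
  -16931592, 19620792, 382968, -184032], [-55060203700224, 174365290856448, -108850254520320,
  -243296808247296, 272222817140736, 49637056379904, -121257056194560, 5477126563584,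
  10560633002496, 11179560821184, -3543117818976, -2675969961552, 822716465184, 179890211448,
  -43579375056, -12052120896, 2190839400, 64671048, 9951552, -5243616, -1837080, 22896],
  [43090720063488, -76240288088064, -56304614080512, 154394876141568, 3042745067520,
  -97686928641024, 10102325681664, 24205242099456, 3686001012864, -4554473088960, -2894392204128,
  1133281848816, 433613285424, -132288420456, -30891876552, 7129033560, 947235384, -107372952,
  -14702904, -3352104, 725112, 47520], [-19627868160000, 8308297433088, 50086644793344,
  -21368696832000, -45184989321216, 16667584275456, 18690184954368, -2943062906112,
  -5023614722688, -1078185525696, 1206979639200, 434627432208, -198575082144, -57768660216,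
  17563674528, 3034949472, -568515024, -73273248, 2060640, 2601072, 151632, -21384],
  [4572952657920, 3973752815616, -10691680665600, -7888085434368, 9885461833728, 6083994405888,
  -4121820753408, -2601936877824, 504590829696, 823160505024, 120543290208, -184048084656,
  -44714986416, 24685050024, 4974453000, -1486981800, -249444360, 27295704, 5405400, -226152,
  -156168, -3456], [-458027827200, -1057823981568, 272760348672, 1927517921280, 334861185024,
  -1423478043648, -443956681728, 498441413376, 240307575552, -62658093888, -83561816160,
  -5899206672, 17677262880, 2436316056, -1895092848, -300182112, 88632792, 16665912, -1048896,
  -261792, 12312, 3456], [8153726976, 52266663936, 66543648768, -54900301824, -124502095872,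
  7788192768, 86985819648, 15860613888, -28897140096, -12610074816, 4274459424, 4742835120,
  -171519120, -889969032, -56576232, 86354424, 10865016, -3843288, -686232, 40824, 9720],
  [-99090432, -573308928, -1151926272, -507838464, 1378031616, 1776909312, -231206400,
  -1470410496, -412283520, 600626880, 306506592, -134313552, -100106064, 14865768, 18024768,
  -165888, -1796256, -136080, 87264, 11664, -1296, -216]]

def cB2 : List (List ℤ) :=
  [[-2335703040, -15245770752, -38183436288, -38451511296, 8688715776, 53289861120, 33208372224,
  -16833235968, -26709502464, -3531133440, 8236531008, 3442274496, -973335528, -845951040,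
  -42589152, 85178304, 20042640, -1695168, -1246752, -176256, -8424], [34398535680, 89220317184,
  -605225779200, -2523173068800, -3160207927296, -628332650496, 1871166624768, 1586588311296,
  231064804224, -333560602368, -256623102720, -80364238128, 12882579552, 25778517192, 9435489768,
  65611944, -928849680, -299984472, -41854320, -1381752, 343440, 32400, -216], [2305365442560,
  18234441695232, 24314419482624, -23938030227456, -67919004472320, -37163152760832,
  11616034459392, 20644515318528, 8209058923584, -282263616000, -1753774948224, -862004835648,
  -101416688928, 45490216032, 6890570208, 41383872, 2631038436, 1484743608, 355382316, 37059984,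
  -567972, -366120, -10476], [-14114028257280, 218384182738944, 472240593911808, 135117668929536,
  -227905207971840, -118955850227712, 39289171654656, 35673360062976, -5973347379456,
  -9553199649408, -2684131413696, 1249440902352, 1299337328160, 171543109032, -87937299432,
  -25651975752, -4364570520, -2073517704, -813544632, -155675592, -6440904, 1411488, 91296],
  [-669833265807360, 20554067017728, 809549941432320, -310046743904256, -540230266109952,
  123294251741184, 286517161433088, -1938462755328, -69075913038336, -17149109981184,
  3145339223712, 7042016360736, 943583116320, -923120315568, -162253903896, 28048062240,
  6875017992, 404353296, 344069352, 226340064, 29647512, -2154240, -316080], [-1313237898362880,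
  640162495070208, -16675496165376, -1478845339951104, -230597760927744, 1004764692160512,
  290880762577920, -338239908857088, -50404268525184, 22227273978624, 23014426459392,
  4622441056848, -6523940373408, -1039693525560, 459235089000, 102873651912, 8906954832,
  1408104648, 959425488, 17788392, -48965904, -292752, 572328], [143835716321280,
  1822635434999808, -1624861880340480, -51024878014464, 922736088990720, 1159935662149632,
  -1128800397383424, -354720708580608, 229373129965248, 54135012303360, 25051762105920,
  -22870768131072, -5424835414752, 3217561187328, 409601869200, -113584812192, -38639372004,
  -3964059000, -1023504876, -392823216, 22205988, 5684040, -530820], [502503116636160,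
  -1144151139483648, 68173108199424, 2150867120984064, 316028783775744, -719461856378880,
  -1578719604289536, 932486249240064, 159802321644288, -26422191909504, -47107917918144,
  -26016223296816, 14240333906208, 2149507592424, -878975367912, -158394593448, 11496197160,
  6228733464, -125634456, 353479896, 37085688, -7883136, 110592], [-1014737586094080,
  -737825017430016, 3615607812538368, -1639058886918144, -1232331689871360, -1156950258425856,
  965064828335616, 934049948179968, -439808153390208, -60422606678016, -50975591220000,
  34151158349280, 9979135113168, -4571158369680, -586715449896, 165609484416, 47157255216,
  -754551936, 538887168, 38155104, -57951936, 3593808, 263304], [-285730233384960,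
  3006031611691008, -855954144460800, -3517337656221696, 939995015104512, 855812693090304,
  1086240917044224, -702526068013824, -302870296547712, 78237070836480, 43474309542144,
  27220169655792, -13317183541728, -2509589065320, 875361654648, 139411973880, -28237531824,
  -5732426376, -313971984, -231093864, 24430896, 1598832, -242568], [393166459699200,
  132770727493632, -3340277645414400, 1646006447443968, 1685942315136000, 43259037106176,
  -688895969160960, -436620485299968, 232565559238080, 92690728026624, 4891950153216,
  -19121167001664, -7241841003744, 3052380399840, 495303688512, -128358857088, -20759061348,
  2374702920, 131232852, 129614256, 7841124, -2331288, 26892], [189815614341120,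
  -1209961423503360, 858027512217600, 1413663395475456, -695587765800960, -674976366157824,
  -110302894761984, 277855530868224, 117839646630144, -43955929653120, -27011241391680,
  -5124241669392, 4849189466976, 1326613812408, -463068554616, -64586374488, 13573354680,
  2017279080, 138273048, -7613784, -10105560, 555552, 63072], [-235669009858560, 318662063751168,
  469403565613056, -485376315899904, -371818639577088, 153512450961408, 198215693208576,
  34195914201600, -63933387174144, -23849002745856, 5031468980064, 5825595324384, 1148380306848,
  -799621881552, -168446032488, 44845825824, 5697349704, -777593520, -197441208, -24927840,
  1963224, 295776, -26496], [73792125665280, 31972703993856, -159902241619968, -72077965664256,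
  111409743144960, 70007944273920, -21614054003712, -37179949342464, -5457195545472,
  8776976931072, 3561421079808, -355116512016, -838864161504, -127093664808, 84061519416,
  15330555288, -2643091344, -465427944, 23630256, 12525048, 905040, -149616, -4680],
  [-8795299184640, -16276479049728, 5347823800320, 24261063561216, 6320755252224, -12840056008704,
  -8546966767872, 2129863645440, 3886507904832, 557185439232, -710812225728, -361653420672,
  27216538848, 71468390592, 7715726928, -5549637024, -1012853916, 116597880, 31689324, -20880,
  -389988, -2952, 4068], [212372029440, 797032120320, 821181431808, -457323466752, -1351893307392,
  -426458234880, 691797417984, 503839388160, -96915149568, -196128183168, -40043356992,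
  34188572016, 19498739040, -1937505096, -3213006264, -244399032, 226026936, 39056904, -4823496,
  -1373112, -17496, 8640], [-707788800, -4728029184, -12103188480, -12338528256, 3372945408,
  18668371968, 11249736192, -7178347008, -10293153408, -609154560, 3852925920, 1236329568,
  -714227112, -393051312, 53520264, 58921344, 2093040, -4315680, -568080, 123552, 25272, -432,
  -216]]

def cB3 : List (List ℤ) :=
  [[-17836277760, -131096641536, -394181738496, -581574131712, -311647150080, 278862538752,
  520556295168, 202860661248, -148237496064, -161955884160, -22333340736, 34908493536,
  16847819856, -713276928, -2477200320, -591458112, 48498912, 47682432, 9362304, 816480, 27216],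
  [522277355520, -2309557321728, -20669942071296, -50714616250368, -57053653198848,
  -21694978538496, 20151049425408, 30266123081472, 15133587405696, 694651139136, -3628365382944,
  -2518988853744, -823707804528, -18028452312, 120945600360, 60624383256, 14707794024, 1650314088,
  -60522984, -46390536, -5652504, -150768, 12096], [51805610311680, 132535578525696,
  -57949937565696, -614671210561536, -985673076111360, -717994270614528, -158437434143232,
  141910856789760, 137000138908032, 54992210226624, 9122582842272, -2434368718512, -2054396902752,
  -718868278872, -324276776928, -187100361648, -68735472048, -13323799728, -799514496, 221877504,
  52912368, 3348648, -59040, -4608], [695013196431360, 2409697283407872, 3222338479030272,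
  1583157047623680, -524363342518272, -635171047130112, 212352219477504, 324815743385856,
  26753481604224, -95899261431360, -60082606786272, -13577447528400, 3842695111920, 3641027400984,
  908567671128, 147953901816, 70515347544, 25952620680, 4006600968, -188775624, -166776936,
  -18377664, -58080, 37632], [301274930872320, 1166799444639744, 1863422806032384, 70222668840960,
  -1207885346617344, 897293301955584, 1758489196349952, 338291569762560, -499991608886400,
  -320105202842688, -51772506504096, 29562160976112, 22877383894176, 3626878167096, -853906353504,
  -80989265376, 51112625760, -1910493360, -4981834848, -705595344, 179778048, 44396664, 1055712,
  -129792], [-4315567305523200, -9617329766793216, -9879999946063872, -6011929426329600,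
  -984025129912320, 3785801721443328, 1866212737270272, -1126837473014016, -807347228273280,
  151900027411776, 221619678634848, 86175649659984, -3939506094000, -17929054960440,
  -4025599338936, -150483191112, -89089897176, -34621975224, -2035221288, 1563837144, 135374952,
  -47174640, -3230688, 237504], [-6820756326973440, -8810874126729216, 719465527443456,
  10645048252661760, 7280444716517376, 1988609872813056, -3872413354332672, -3292088004184320,
  438825593284992, 834874827959232, 162297229911840, -41131309773168, -67317311337696,
  -8305691602680, 6226790450400, 1176255682128, 53171999856, 17697703824, 7519200192, -570818592,
  -503913456, -2195640, 4762656, -224352], [-3133678768619520, 5374622845894656,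
  25815771999043584, 16887521082753024, -5254827599099904, -8640209135612928, -5337229177981440,
  1214764273983744, 2741916477667968, 78292388524224, -335222673089376, -174270440953104,
  -17443170761424, 34045257291000, 5514302172792, -910521228456, -144432368424, 8288696808,
  -2318260728, -1236726888, 380599512, 58704000, -3283584, 49920], [7612881960960,
  12402546283118592, 14024310746775552, -20283323570749440, -20740670926239744, -1296012899128320,
  5369952325059072, 5504955964040448, 230703061970304, -1384829798794560, -244615113880992,
  15002169536880, 91731560058432, 12953115099864, -9654278374944, -1579408962912, 53147370240,
  5454785808, -2811751200, 1434703248, 85531968, -54985320, -69408, 110880], [1106437558763520,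
  6687683218243584, -15687978101047296, -23627992501370880, 6473291805149184, 13190767728823296,
  4298556401542656, -1326445119910656, -3054155204969856, -368635926162240, 373035642231456,
  162421554103344, 27762600405168, -29779207661448, -4444650314568, 1551067690824, 228434652792,
  -3163524552, 1661941512, -410971032, -283749768, 8597808, 1722240, -104832], [309838369259520,
  -4242869639184384, -11347844434329600, 9308834007957504, 16435202583582720, 216375122506752,
  -4870443508360704, -3247143692569344, -36119359078272, 984053377882944, 214255359253728,
  -40505317755408, -55722789059616, -10695041695368, 6256752191712, 914325220080, -136782034128,
  -14717999376, -914547456, -263888064, 138027024, 16342776, -927072, 12096], [253379708190720,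
  -2298145194639360, 4238138450608128, 8089508751998976, -3296692483246080, -6104332811308032,
  -1297525892083200, 1163031637199616, 1218114015477120, 131906515090752, -194668815056544,
  -74784161262960, -4634291991600, 11740654411848, 2099736436104, -828144036504, -110348529336,
  3363629976, 843211224, 332621352, 11322504, -9493056, -98784, 27648], [-665601139015680,
  926462939234304, 1936738470690816, -2095158832840704, -2792868597491712, 494084690285568,
  1393724858494464, 567219371440896, -181347332819328, -259632387125952, -46595325499104,
  23942328999888, 16155749912160, 2014231672104, -1594144699296, -267207480864, 60987537504,
  8821878768, 331548000, -131273520, -34230720, -132888, 218784, -11712], [278101245296640,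
  213138174640128, -658321285742592, -557122470051840, 461801827608576, 546996293188608,
  21885567616512, -205555927511808, -114292854926208, 15459427838400, 32770458103584,
  8830767957360, -1937999182224, -2118128769384, -268344632424, 137790004968, 25729519608,
  -2078396136, -528590328, -24735288, 10577208, 1455024, -30432, -2112], [-38914236088320,
  -89201928044544, -7195699052544, 118170027294720, 74863300712448, -41388057504768,
  -61865618167296, -13036389735168, 17938590733440, 11745486670656, -132718049184, -2498264455632,
  -922638844320, 115010159064, 160412614176, 19423887984, -7836434928, -1761037776, 14873280,
  26584032, 1244400, -297192, -17952, 1824], [687239331840, 2973821829120, 4193114259456,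
  91684159488, -5618969487360, -4745841933312, 1009491116544, 3283436065536, 1130170133376,
  -676163399616, -604181196576, -68723749296, 107638035984, 47395741608, -4446043992, -6513417144,
  -738912888, 289816056, 68715288, -219384, -1122552, -61056, 2880], [-2257059840, -17837064192,
  -57495846912, -90239336448, -49319086080, 53979552768, 98703659520, 32364262656, -40913096832,
  -36234387264, 1517853792, 12277541616, 3155442288, -1817623608, -920930592, 72059040, 108302688,
  10097712, -5209440, -1045488, 50736, 23304, 672, -96]]

def cB4 : List (List ℤ) :=
  [[-81006428160, -669009051648, -2362322092032, -4513999601664, -4639903865856, -1486507438080,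
  2185133884416, 2874596594688, 1013711739264, -522603083520, -610420442688, -156218461056,
  59196140388, 48348951840, 9565525872, -1643683104, -1239756840, -279834912, -32105808, -1832544,
  -38556], [-9303069818880, -64541456400384, -202264354308096, -364725656285184, -383606591975424,
  -167625055033344, 132152222545920, 279585088874496, 224952553403136, 98365876153344,
  13660585166016, -13278602793168, -11934952851168, -5441583643560, -1551669100344, -236811805416,
  6914339064, 12437576136, 2912564520, 324146520, 9322632, -1622592, -119376, 1152],
  [-126930639912960, -875103056166912, -2866346437361664, -5766221392084992, -7644729221302272,
  -6701080521031680, -3678854298766848, -992310161499648, 155453502096000, 281389660188672,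
  152684403293472, 61831761856032, 24853418552352, 10927397408208, 4282438146888, 1095714106272,
  88835675328, -41401233360, -16557562560, -2745615840, -179732352, 8781792, 1611192, 27456,
  -576], [325888624558080, 1111418234535936, 1642419032211456, 476476875042816, -1793780651950080,
  -1447519062116352, 1333357054537728, 2368566533085696, 1184202207078912, 60494355869184,
  -222310594118208, -132688072745232, -36055258823136, -1974494932104, 896490133608,
  -366719384712, -215295176952, 15121342728, 27928665432, 7610250360, 846094776, -4813152,
  -7346976, -265728, 4800], [1068832124764160, -1260013227737088, 1510820578492416,
  12645903009366016, 18188874084728832, 18650208025239552, 14881220377118720, 6334052707814400,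
  -370807080754176, -1833506857327616, -974307163210368, -259742322693504, -21578720986768,
  4609844243904, -3686455262880, -2382859841024, -165787054272, 82333125216, 3691965920,
  -6554837568, -1631518272, -64742816, 15303264, 960192, -16912], [-7220676671569920,
  -37949320381267968, -35939900078800896, -3159667281801216, 11933190780801024, 9751860659484672,
  674050035345408, -7524014814600192, -6729151034587392, -1618583362941696, 707889398964288,
  667132640117040, 250466962338336, 31307305196760, -7836610450200, -727957888200, 413085387960,
  -83985575256, -56374021848, -6667562184, 1005271944, 190759776, -12309360, -1799040, 31680],
  [-26352142940897280, -61010073673924608, -4685055001214976, 43025753113804800,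
  23399849138669568, -14726815247130624, -24828751427756544, -16942842734464512,
  -2268704450549376, 4052494421876736, 2329168017978720, 459346469942880, -94446247901472,
  -98735194831248, -11263547752488, 5120817710112, 719269800480, 10153390608, 45873202752,
  16735413024, 1169939520, -213975648, -8239320, 1749312, -30816], [-23926780425666560,
  11224814374944768, 105752600711479296, 81928932397395968, -13755439142633472,
  -46359216150607872, -16462917285945344, 5303096652418560, 12471466245585408, 4947623084692736,
  -822399005360064, -1106820282316176, -448086448244192, -44293342713672, 31703634623880,
  4126277215640, -963269752248, -46242063000, 14241117208, -8142515880, -2319389640, 46985600,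
  25692672, -479232, 7552], [5775078478970880, 68126839546576896, 63215054641299456,
  -49202608490348544, -98421362431690752, -21669734030450688, 26810497015944192,
  22771584742044672, 7216755066157824, -4174765121249280, -3066471358444224, -481136016640320,
  168437261832408, 166389321065760, 21828023810640, -8299434289536, -1180241124480, 11891012544,
  -35719367040, -6062584320, 1135629720, 125883936, -18518544, -730944, 15120],
  [10954972047605760, 11462487909138432, -55871536872996864, -95918215977160704,
  -12676589372952576, 57551900506527744, 28489061505779712, -1162683322712064, -10555067454379776,
  -5806809136747008, 350852038413120, 940591038920976, 361876156608096, 27724298502600,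
  -38166372962856, -5054733766584, 1314837121320, 149776200792, 16965574200, 8392622472,
  398647512, -123919488, -582192, 740736, -14976], [-2886504323481600, -23531440742203392,
  -33099608374198272, 14020633133187072, 65548704208177152, 24801927544258560, -16100745531781632,
  -15116835110699520, -4857606035625600, 2318984723982336, 2033004948104160, 289133912042208,
  -132804100843296, -106956283850064, -15078703384584, 6179877823200, 800366933952, -75763897776,
  -1387111488, -2727248544, -659297088, 27377952, 7798536, -106560, 1920], [-1109041612062720,
  758163592642560, 13334844511174656, 29264959201824768, 3151185407803392, -23584267630786560,
  -12718636430413824, 852347046680064, 4453418533400064, 2289945585149952, -131230683215808,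
  -405931918483632, -133750537152672, -103122674520, 17920121330616, 2674958568552, -670247456040,
  -91796888808, -7085678136, -977091096, 222755304, 21258912, -3317664, -176640, 4032],
  [-289127941079040, 1414073079693312, 4448935073316864, -3549929130835968, -11275986593169408,
  -3120117990383616, 4378928168030208, 3515190360634368, 665792859543552, -755036297183232,
  -506029286635008, -55962589281024, 49325684821104, 27960180994560, 2846728662144,
  -1815479793024, -289264654368, 39573494496, 7405336224, 1187050560, 46504704, -14320992,
  -528384, 77376, -1776], [414455576657920, 625189873188864, -1228605881204736, -2301745903538176,
  279002501935104, 2076928620447744, 934094665799680, -354757568449536, -552396001542912,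
  -180274841519872, 66689611325376, 63657171592848, 14744651286112, -3756758295288,
  -3282450272136, -448444688536, 113892212520, 24221674296, -488701064, -349843992, -56156904,
  1429856, 672240, 12672, -320], [-78940868444160, -255163153907712, -180427316084736,
  223219782303744, 353300598011904, 50810945101824, -178062623350272, -128518719588864,
  1290419118720, 45860641880064, 20360121214368, -1872869929824, -4713876689376, -1544036263152,
  170135666664, 221640708960, 34259074272, -4844796048, -1548416832, -77623968, 9115392, 1252704,
  -89832, -11328, 288], [197201756160, 2735270461440, 8406280617984, 7655093932032,
  -6180123082752, -16450091255808, -7976752791552, 5535417401856, 7250815471104, 1528959202560,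
  -1599715391040, -1117342087344, -97863382944, 185121367848, 75688532568, -3552103800,
  -8066946600, -1312568712, 155585736, 60079176, 3794472, -301248, -35136], [-2090598400,
  -24310972416, -111843901440, -264271806464, -320474717184, -106266488832, 217476042752,
  280782157824, 60202624896, -110672125184, -79237862016, 5020653888, 23416915940, 5878253568,
  -2602265760, -1410273248, 1342728, 119041056, 18952784, -2806176, -943164, -34592, 8880, 576,
  -16]]

def cB5 : List (List ℤ) :=
  [[-212846247936, -1994393124864, -8237387612160, -19453693722624, -28131502694400,
  -23664682137600, -7020043656192, 7586079846912, 9985731114240, 4359881635200, -343963029312,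
  -1280012370336, -573976594800, -61158053376, 44223278400, 22821704640, 5233691232, 668642688,
  45360000, 1179360, -9072], [-5371687600128, -40517886541824, -141142577577984, -264001833566208,
  -178256122177536, 364803038512128, 1205804179883520, 1771738628348160, 1685018382445440,
  1136876545088064, 562256032479264, 201858187708656, 46951023286512, 2371116546936,
  -3484836297576, -1747714870584, -461579305464, -72786356568, -5249838456, 393217416, 134394696,
  11804256, 179712, -18432], [-283078716948480, -1624203329863680, -4852037032796160,
  -10136588396863488, -15646095489024000, -17550584254872576, -14013139304884224,
  -7890048678792960, -3203673689839104, -1066646248548288, -386021632071456, -162387784880496,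
  -56428030040736, -7114621767192, 6501316352976, 5151400810176, 1923376378104, 420376644504,
  48433339968, -28058400, -916920072, -125383920, -5002560, 126720, 6144], [-2985764187013120,
  -11583619891200000, -19688209222139904, -20488860853723136, -16602416616572928,
  -11648213797868544, -5061214252996096, 294345951881472, 1102445891134848, -246549330546752,
  -837155394785952, -578274770860656, -224280414991408, -49640990402520, -4413054901560,
  -1175836739480, -1528838799480, -668963784456, -131654497960, -7690456152, 2003197704,
  460574080, 29018016, -270336, -48640], [-8419035402731520, -31792071083950080,
  -43144169775022080, -6937362694619136, 46311070909814784, 67787812994006016, 59647470518693376,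
  37066420697695488, 14051743892956800, 1907377044166080, -745071361559712, -372290069025360,
  -12192348753504, 40947408664920, 7204921254144, -6513187451904, -3021467052240, -245661393888,
  97408404000, 22024486512, -469970928, -720743832, -74504160, -144576, 161280],
  [-16329903218622464, -72623913853648896, -91973644710346752, 3833795248603136,
  88893752362481664, 73283854311699456, 24242333726348800, -10759464287887104, -19675445467655808,
  -10748584113137344, -1702797631652448, 1034498998090032, 796603004593072, 270430837085592,
  40888437282744, 3624512473832, 3739215221064, 1438264521864, 138915317704, -20098643544,
  -4689396600, 215216288, 92815200, 1733952, -278912], [-37746394128842752, -126217936832495616,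
  -71649865366118400, 107274537736806400, 109242271911481344, -25291587079400448,
  -92276302126756864, -75227841834262272, -31650794962161408, -1058848576995008, 5651872570856160,
  2519178036642768, 341734481229920, -175448161629432, -104652442766544, -12519180137888,
  1387309758408, -518524360632, -257006956096, -9012140928, 7221279624, 858960160, -33717888,
  -3465696, 235904], [-45174059950407680, -49610930358190080, 153131347875102720,
  247156016512950272, 25011912854870016, -140237892088366080, -94558922516555264,
  -6245124548122368, 29842489267493760, 24316416509754560, 6188285121823200, -1331781078292656,
  -1425534335099888, -519890310136824, -51265760055000, 17118964070600, 287979795144,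
  -979567285608, 29814677080, 30915585096, -2222624568, -1187842624, -52465152, 3129216, -13952],
  [-380457131704320, 111251809507737600, 221172273476960256, 23016466507137024,
  -220531356181297152, -140318155116979200, 36192227165348352, 75140326003214592,
  39757738661769600, 3933624338493888, -8182753535133216, -3910192681264848, -538294782691776,
  265694037318072, 183375867339360, 25936737655584, -2417815722528, 240950765232, 154327515360,
  -17650575792, -4176736992, 384125016, 69275808, -719136, -153984], [22905807443066880,
  57076949963243520, -46449971586662400, -223262420330151936, -142083774738118656,
  81438484317834240, 114184527163458048, 29777745230832384, -15865468588103040,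
  -20418496127288640, -6813906686863776, 929730984066000, 1208380194884304, 434979802696680,
  20990232709704, -31705712384040, -4017595472424, 430635629304, -43809567912, -4065104232,
  4459694616, 388467360, -20983104, -1111680, 112896], [-1715216845504512, -43986596498178048,
  -99179784229036032, -41910551893303296, 111285879059128320, 119320515825011712,
  6154255923707904, -37960367661630720, -23723872586385408, -3562377409105728, 4671951057295776,
  2520322463310768, 322736372220192, -176417833920840, -119446366411728, -15720458409600,
  3118771953288, 281095211304, -31659806784, 7180103520, -910775160, -382531056, -14582592,
  970560, 3840], [-4658649176211456, -2982859143118848, 21643509955166208, 67683731583000576,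
  52220144620431360, -26127221844556800, -45744808841900544, -15350772017454336, 4480922689276032,
  7317527801846592, 2584317156823584, -360057681409104, -489183256971408, -155165823626760,
  3155239128024, 16976730437688, 2586813190488, -177139683864, -14973531960, -3228836616,
  -939574440, 61582080, 12258720, -133632, -37632], [1113572276961280, 3521019466874880,
  9515702868787200, 1729406012407808, -21990414935365632, -21045472571821056, 225910735929856,
  8759819497916160, 5240041241152896, 482671773978944, -1166864968691424, -601399093703664,
  -62256848336288, 55255035243528, 29575697663040, 2915033056832, -1276543718352, -222577123392,
  3967617760, 1468489104, 619255632, 64941080, -1169568, -162816, 11008], [224107883397120,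
  871236373708800, -1159529349021696, -5291177227567104, -3285792924309504, 2765154226093056,
  3827582396097024, 1062973336806144, -780751162320768, -822646131465792, -205076593656864,
  91520500196880, 75196398462096, 17749481100552, -3518163011736, -3102721354632, -479884621608,
  43060923864, 12753886296, 407716920, -78203880, -31182240, -1656864, 67392, 4224],
  [-87090372935680, -437174838558720, -670316072263680, -95586641321984, 682024538935296,
  581677650779136, -39044579402752, -318873228201216, -178637881381632, 16743562614208,
  63177444784800, 25005678943728, -1920725112544, -5299654087080, -1758820650288, 92480319328,
  186725700792, 35721195768, -84121024, -614146752, -56754696, -233792, 509184, 2976, -2176],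
  [-1609152069632, -4615810449408, 1496586289152, 17814332579840, 15941615192064, -12982917147648,
  -28872688964096, -11256458409216, 9370764736128, 10238555097152, 2000259647136, -1991222105232,
  -1393244615504, -160135181352, 186990476856, 81101820056, 1592003160, -5984427384, -1302298232,
  -20914920, 23029464, 2631104, 61632, -4992, -128], [4804050944, 25174474752, 17961517056,
  -167731724288, -547863963648, -700015875072, -239063709184, 411126315264, 508015617408,
  104906232256, -172005809952, -118479117648, 2917662512, 28697753832, 8066421024, -2103420704,
  -1427324832, -113314320, 74500256, 18099408, 114672, -383960, -36384, 480, 128]]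

def cB6 : List (List ℤ) :=
  [[-263679639552, -2970037518336, -14901355413504, -43811081846784, -83129585043456,
  -104626797133824, -84042602155008, -33923222516736, 7650064009728, 19596578738688,
  11988541930176, 2964281189184, -580429522008, -737020928448, -281425034016, -60104576448,
  -7338222864, -395067456, 11884320, 2540160, 86184], [4924460498944, 3537656610816,
  -115625278439424, -539204730044416, -1185584521353216, -1447565905354752, -729616558920704,
  681851686719744, 1783211190738048, 1949414626741760, 1420140305228928, 767335436516880,
  320037695404384, 103158166647912, 24557753530728, 3692129384072, 82847981664, -121153559544,
  -34648098368, -5040101400, -376839072, -2124016, 1788600, 82944, -512], [174477681295360,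
  841741981876224, 1817617324781568, 1658663191777280, -1767256181812224, -7848518572290048,
  -11948867006250752, -10968519740965632, -7091791871722560, -3800476104473344, -2029164360656832,
  -1117545499335936, -565267896668384, -236954205069696, -76226759691888, -16640682403840,
  -1537697543220, 383474492280, 182524549012, 35452410768, 3677779668, 126497912, -12696804,
  -1171968, -18944], [-2258279989248000, -14405629953441792, -36255667518357504,
  -48319958564204544, -39487978581676032, -23761382440464384, -12773753718945792,
  -5556961411997184, -1939765891053312, -1775386098259584, -2092307581033152, -1502511935100528,
  -678243585206880, -186337204435896, -15787829000136, 9840235015032, 3752492796648, 105810416568,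
  -260447508408, -82328669256, -11970015432, -700849728, 32728704, 5627136, 155136],
  [-12692976530882560, -67183265014677504, -154186745604759552, -172429454737817600,
  -76156956495249408, 31311963412574208, 73636932794476544, 66218949000368640, 39798249829005312,
  16406450168171008, 5240769074180064, 2013773125662048, 1079394249761504, 536208192959472,
  194694662137656, 41115479157088, 1106225832888, -1505841113520, -205699143400, 42654752352,
  15542611944, 1597611424, -22719600, -12883584, -487360], [-24689139889471488,
  -121281680621371392, -249074141823369216, -169710080457719808, 82809689279809536,
  197071716603580416, 133949854338739200, 42388401444970752, -9068316703279488,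
  -18079667302625280, -8504645734260864, -1256660239942512, 479413251598176, 292058752509288,
  33976203451560, -26001899515800, -8965206009216, 816322239432, 805675392288, 122534052552,
  12928320, -1662414192, -62920296, 13887360, 763776], [-30682571539677184, -159611457080819712,
  -219462746649882624, 97943320084762624, 363351461705972736, 208743232588185600,
  -46901348530968832, -132282264780645120, -97399825514903232, -37824944944620800,
  -4347316530030336, 2245998028281408, 757485897716960, -175885672344288, -228218180366592,
  -74920900714016, -4184894101068, 1478848104648, -327693483604, -194420012016, -22834555092,
  228865000, 165173460, -1560960, -526336], [-31559962521763840, -121908328408743936,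
  61590362017087488, 455497720000614400, 322562827089408000, -132162306240602112,
  -272993360173109248, -136771361359123968, -8404715417617152, 35451315155799424,
  24438430256412480, 6131607809787024, -291310424497504, -692895574492536, -210088145906184,
  13250348525656, 15999788192040, 73666924344, -587532285112, 23001831768, 22536064056,
  1368292864, -148540416, -12649344, -116608], [-9299846037504000, 60420607531941888,
  355074087543422976, 323154153030844416, -188716720312350720, -396836111060656128,
  -135673683703887360, 82499569029812736, 101242195771927680, 47263445580905472, 4025132319705120,
  -6367901451664608, -2835138914288976, -397751516482032, 183959797854312, 104371527962496,
  10049585132304, -1282905864000, 379374925056, 132438198816, -269358912, -1471287696, 12274488,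
  12123648, 453696], [18444923020247040, 106991743713017856, 99571238556008448,
  -227562473913139200, -390247192309794816, -86786569168945152, 183128998365864960,
  144174141862822656, 31521058433513856, -20697874171098624, -21377962755222144,
  -6293184067112016, 276454515505440, 753106396080504, 267860874759288, 190534562328,
  -18331240757472, -1781076360744, 90682257600, -72450151752, -12049327968, 393805104, 83064552,
  -1142016, -231168], [7285593855819776, -19466874544619520, -147193158257061888,
  -195117738313011200, 15202389287144448, 212616534611005440, 129189166957731584,
  -13801545298540800, -47897042760013248, -26754807037877504, -3030770026701504, 4106118651844224,
  2044527665152736, 343073208849984, -100144117087152, -70327691475008, -7491925703628,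
  1252999907208, 23771737580, -14271919056, 5672360940, 353066824, -58457916, -4530432, -65536],
  [-5770132342177792, -22168161661353984, -6388824489148416, 73163260143087616,
  131987865110630400, 49871179339173888, -53290170723309568, -54054603783700992,
  -16051540586160384, 5260577585951872, 7286231587520448, 2289945695526192, -175470195634720,
  -343577256660072, -116005469952408, 685981138792, 9180486616248, 1334759619816, 14898563672,
  14559180840, 949007400, -282101696, 421056, 2333184, 98048], [1010871588618240,
  5477761311768576, 16671883029553152, 20486472322990080, -11035863144198144, -41240106261172224,
  -25080147749489664, 2301206639095296, 10048443175302912, 5701830112492032, 550660903285536,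
  -966654063420768, -496071187916448, -75418972509168, 31516165440648, 18492797237088,
  1831139774712, -557288555760, -102468338760, -6266597472, -1103882328, 31264320, 14746464,
  289152, -15168], [-45567475712000, 684927496814592, 97370084081664, -6097830043795456,
  -9952180214802432, -2980837322846208, 4708474318799872, 4623322013289216, 1206116948108160,
  -801255155955712, -811178465796480, -210979234510416, 55880285402656, 57123678135480,
  15761767001976, -1187010556168, -1675399332096, -281692045224, 4144864096, 3541720728,
  310198464, 28538672, -4513848, -503424, -13952], [-35594277027840, -390561364279296,
  -1099146616639488, -1085791888281600, 141885365658624, 1076489033490432, 724794609514752,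
  -54513887977728, -355132198096704, -195468162884352, 6711699864960, 54112125105216,
  23601415090464, 496243406880, -3618391004640, -1369463677344, -40579842996, 86893255224,
  19785863124, 1246921776, -48526956, -11090088, -793908, 74880, 4608], [-1286644957184,
  -8751614459904, -16670362288128, 1135756488704, 37613425102848, 34874222297088, -12399434620928,
  -36937432041984, -16030581748992, 7988965229696, 10216891767744, 2685892750512, -1377685673504,
  -1205044644456, -217068597912, 108115006664, 57396336696, 5396546088, -2293736168, -673425720,
  -57135768, 1149440, 478656, 31872, 640], [9482272768, 86416293888, 317333176320, 558247116800,
  307147567104, -564753776640, -1143160166912, -598124404224, 391105378944, 635666451968,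
  179434628640, -158652215904, -124120951448, -6651269712, 22660795896, 7739964800, -760963248,
  -925795296, -147909104, 19266912, 8604552, 775856, -33192, -8448, -320]]

def cB7 : List (List ℤ) :=
  [[33124515840, -486293372928, -6744406228992, -33601684045824, -95401932005376,
  -175941724354560, -221475102612480, -190955851716096, -106158716722944, -27502846780032,
  9514924500672, 13311701219808, 6735679282512, 2004816904704, 352655954496, 26114063040,
  -2795277600, -884317824, -87371136, -3600288, -34992], [-8343616225280, -70084741300224,
  -319998886871040, -1039827494993920, -2513911707101184, -4481529700543488, -5829404507809280,
  -5473227047733504, -3606788850141312, -1507205531452096, -189341323828896, 259496943969744,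
  250913948906704, 135773406691080, 52835095273032, 15453311310200, 3353960675016, 509281526088,
  44564377720, -372585768, -714168504, -97274032, -5523072, -46080, 4096], [47868178595840,
  209392190619648, 1010636958007296, 4014957647036416, 9156709420763136, 12199397999275008,
  9942291359524352, 5176008525447936, 1963715337062784, 695407369755328, 84149342078880,
  -296724706142256, -383989227103072, -276943839462744, -140791385394720, -53089658037680,
  -14714947995120, -2858423354064, -342994432096, -11926537536, 3849686640, 772976776, 62608704,
  1824768, -1024], [1814313453486080, 531661465583616, -19185518906769408, -49125033906077696,
  -53508686617024512, -26510907453821952, 726143151400448, 11101465766202624, 10382327737593984,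
  5728747351266496, 1322457173264544, -669211113178128, -776104624383184, -366294229168008,
  -89831347758984, 2105170444504, 10988930394360, 4321399945608, 835489348232, 65471615832,
  -6580978440, -2302082528, -248145216, -10387968, -85504], [3868125781032960, -19349434323959808,
  -133435541128151040, -283291955339526144, -296004648439511040, -160747172664972288,
  -32543956970460672, 19534158990298368, 23580174818542464, 12220496581552320, 3396612708862176,
  886925527162224, 828389361866400, 718430769424632, 400654626697536, 148744886688384,
  33759330941088, 3047108074992, -459453033696, -137323596720, -4161990336, 2689200792, 450375360,
  25106304, 281856], [-1211371586846720, -73503394693644288, -305033029428117504,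
  -479180487420706816, -277818067129829376, 65104193696105472, 179238777232314880,
  113658700236546816, 32350541783430528, -7259396376061888, -11299641210062880, -4292991833359344,
  -377057607191408, 242531988534696, 53029515386280, -53509383175336, -41492995728696,
  -12170720523960, -1325947225832, 84849423864, 30396626376, 1024573040, -301838016, -28577280,
  -356480], [-2292071299809280, -105835270242828288, -344525103371059200, -240807121344659456,
  317878052003432448, 559654832064900096, 299298948861300224, 18333803119765248,
  -77385101043664512, -60610233712002368, -21505610422447584, -2087575003011312, 837742600709408,
  60924632421000, -243858564782496, -151016496210224, -34054292583504, 1811434734288,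
  1883179364960, 151359114624, -33562278000, -6110248760, -233928768, 8109504, 109184],
  [7962525161226240, -84023102233116672, -125350023553941504, 357231281545936896,
  758884181677934592, 361103283691846656, -168634172621099520, -267289114275770112,
  -133868114155896192, -19431378316991040, 19775070121079328, 13875027902209200, 3574359155965296,
  168733528043352, -166094048510952, -10317758709384, 36782669120184, 12458756505096,
  553674676200, -233498336712, -8382200520, 5202435840, 552003456, 15775872, 185472],
  [5906756277370880, -16282306437709824, 220611863706796032, 600265605524291584,
  282050482460018688, -375075813544485888, -449751887122888192, -139105155978535680,
  54589994660168064, 76154523462513088, 35522842895688672, 4263186415269360, -2673007791517120,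
  -1315635374505960, -202580933357760, 73787788196992, 31354613336448, -1907034322608,
  -1653822057952, -6691363056, 36051388224, 1056655384, -279088704, -16761792, -181120],
  [3711760659906560, 60270721590362112, 216081934876999680, 55155494885687296,
  -424210309833406464, -445794026894312448, -34917365198483968, 182868449523528960,
  129284472029927040, 34688949059419072, -11041510155454944, -13043398755632784,
  -4039102513085584, -272539969451496, 254427944822616, 91706886458344, -9167678718696,
  -7411172409576, -241585118488, 111873619080, -13815186024, -3807251408, -128203776, 2563584,
  8960], [6477174380953600, 25810293395816448, -56731765381201920, -261688477490741248,
  -237568164615137280, 75587990172361728, 226653132170424832, 108910597515118848,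
  -9135496076330880, -37089240076751296, -21270311575158048, -3295023273125520, 1791399268698592,
  1067405577926520, 241591555756704, -23245182152464, -21704038656912, -623778730416,
  666494101600, 5762766912, -7042220400, 1316267480, 183784128, 4889472, 58624],
  [-1392302012497920, -24717830038487040, -56790138082099200, -14918685030875136,
  114458341867173888, 152498724573250560, 37895418914615808, -48869756505614592,
  -44433986651307648, -14843103253179840, 2591547862851552, 4574702494568400, 1560629577262224,
  77379825446760, -139467585797400, -54946751372664, -1139938008408, 2686791806424, 251628469272,
  -12591530616, 4595714472, 632628384, -32462400, -2750208, -23808], [-870130282659840,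
  648868123901952, 12037351087079424, 34150154780934144, 28967337046628352, -18305610523352064,
  -42920467465167360, -22708282486728960, 307463234279040, 7246293134999616, 4438690888402080,
  711343545455952, -431123228629920, -277262762473368, -61945902609984, 7606270785024,
  6688294653600, 622107013392, -152116585632, -21629831184, -1398538368, -436555512, -32859072,
  -161280, -4608], [-80296298414080, 420604545859584, 2121572130029568, -705833583017984,
  -9718725049079808, -11539913339851776, -2754653116283392, 4025606472937728, 3941252332149888,
  1268173822205632, -409625645246304, -529625855878992, -172323108151504, 6434943392568,
  26794899364536, 9253039792456, 314473910616, -468733917096, -79738733176, 18653352, 492744024,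
  54861328, 13293888, 552960, 5504], [45577118679040, 6891557879808, -629296108339200,
  -1540208573218816, -1265935595415552, 168868609655808, 1037666080201216, 717691889749248,
  42354744312960, -253266772198336, -161382134420640, -15952990876752, 27898159178848,
  15838500346200, 2187918468384, -1385634703888, -679382052912, -72829826640, 17560794016,
  5009498496, 424482672, 20440280, 742464, -115008, -896], [1530813480960, 1368521441280,
  -14719716753408, -33510591234048, -6010777479168, 51152664646656, 53452050332160,
  -1072626382080, -32867542537344, -18561081351360, 2338093288800, 6949683383184, 2719770775248,
  -375447328056, -682346731896, -183064189656, 28409975208, 24931523736, 4147723128, -220618008,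
  -149324760, -18111936, -1004544, -35712, -384], [-4312268800, -3061579776, 139132600320,
  661623341056, 1337428015104, 1192953400320, -146624280064, -1321552472832, -995027025024,
  116046841792, 555339984864, 231270056304, -77953022608, -89593632120, -14044662912, 10685577280,
  4842260064, 142462512, -349324576, -86692272, -3722064, 1484872, 245568, 12864, 128]]

def cB8 : List (List ℤ) :=
  [[346161807360, 3481821904896, 15078341984256, 35345783365632, 42301770324480, 82287249408,
  -93027618740736, -179798721255936, -197612794539072, -145542093667200, -74189256131808,
  -25461924673536, -5120947397286, -157597626672, 239274489240, 76016344752, 11482209756,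
  856981296, 12492792, -2222640, -98982], [4334549729280, 51504699998208, 261840295182336,
  755898322956288, 1318209474256896, 1244473964906496, 43565232218112, -1679049523782144,
  -2684498649444864, -2461517162066688, -1556112594228672, -714044776262928, -234270838832064,
  -45852644256744, 2300278544040, 6031734339672, 2697604396200, 746587711944, 143505414168,
  19261542360, 1677687288, 67593984, -2625504, -392448, -9216], [-189128338964480,
  -1387611430649856, -4973187690553344, -10210052010532864, -11822974495211520, -5930399998464000,
  2981830365356032, 7940778167144448, 7964873977321728, 5954744934913280, 3787722405985248,
  2008332533141088, 835858142166736, 251038107414576, 39257785087512, -8580517368352,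
  -8609254950312, -3280734203472, -788945861576, -127986656544, -13711642152, -836189824,
  -8069040, 2190720, 74368], [1452023325655040, 8162032292855808, 9317461085503488,
  -17646775680389120, -55646710623436800, -59026806831421440, -27064850990891008,
  3471747835433472, 14941863935972352, 13323047843997184, 7464160289555904, 2614054530822192,
  344033715727424, -197986942374216, -152258309266968, -51402032226728, -6883625839896,
  1854699862824, 1178357524472, 288572686296, 40169253240, 3126591424, 80349504, -6045696,
  -314752], [10529990102548480, 50529283817865216, 64612438630711296, -48500496863150080,
  -206049342049019904, -224320656556572672, -123510133560344576, -37732424218527744,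
  -6071811198741504, -2652269990381056, -5359733923547328, -5251529564676672, -2845396645383464,
  -894373505819232, -95321732832816, 63809106410816, 40228269763824, 10841439562272,
  1216251249808, -88922099712, -44479689672, -5289528640, -202036800, 10374144, 779296],
  [23492829000499200, 82653817557221376, 23620694792650752, -278341562072616960,
  -472667160821735424, -279075438134753280, -4354450475225088, 81307257902212608,
  49482584801376768, 8782943992634880, -7625166368246592, -6032162261000208, -1412629930769856,
  344992323735192, 367151414232840, 118493217987384, 3319824617064, -11616939484344,
  -4197869193672, -608361532104, -22739443080, 3312725568, 282619104, -8218752, -1044480],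
  [30387629699235840, 64332520989720576, -140402021781774336, -493282268614533120,
  -319975825296211968, 235087602618077184, 422047441132683264, 238653251075487744,
  56713350422207232, -13776518041976064, -15762879829247712, -2743049383565664, 2083309419121584,
  1322365910310480, 269918235845160, -62788943792736, -59028179866200, -13440015025200,
  546225317832, 705549440544, 101474105448, 3231857280, -245253648, -6464256, 505152],
  [30692447552798720, 23856154700611584, -203165445898420224, -187247188287770624,
  443146310218481664, 753466504387307520, 358840903905751040, -41943360777463296,
  -131194638774116352, -74367628812312320, -15283275622963392, 5649636360779952, 4104464218753088,
  711765156397560, -188855761181880, -137297526957128, -12695070114072, 13910343263208,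
  4616185260824, 295907208888, -58519969224, -7299921536, 25216896, 20233344, 437120],
  [16473874057789440, -30285600318554112, -74581925707579392, 332075908545331200,
  687858586800233472, 255654389350821888, -289187743466628096, -320565983907161088,
  -123802873475640192, 1007079926394624, 28538378665089984, 14094377655558912, 1586227837545372,
  -922105006805664, -458543572427952, -53205213465696, 34513402548744, 9917559424224,
  -1386503655504, -700904618784, -51109913700, 3040541376, 223886880, -12525696, -673440],
  [-4294886622494720, -23605406397825024, 101733460348747776, 296837414786600960,
  12709176591556608, -439024942031038464, -382463340459376640, -62542951557760512,
  85733593835862528, 72723740215890176, 25243529217640896, -1128148512041904, -4095823715190080,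
  -1344964734106872, -109123874105352, 90588610470536, 26413792891704, -5162422713192,
  -2278275067832, 7155093768, 53213358120, 2744410496, -181952544, -5666304, 173056],
  [-4063052121374720, 18314736462004224, 59446996106895360, -75192199663919104,
  -300101365949743104, -221844039512961024, 56003905292099584, 150962830298578944,
  77932781210757888, 8190169499906816, -14965649331485664, -10121408583946848, -2145981378109520,
  297757212719568, 319325570055144, 81768797179424, -7385928509592, -5140120018608, 390058255816,
  252273096480, 8128492776, -2110314880, -24242640, 8800128, 173056], [1585781819310080,
  -651412395786240, -42604442963263488, -90366696386686976, -30338334296506368,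
  102932065871296512, 121371396325793792, 34857322158601728, -20914036736689152,
  -24307162176708608, -10209237775367616, -252105552626928, 1543460634867392, 645637929954408,
  90532340359608, -33837568575608, -15660202411656, -142813699272, 558802485992, -1644512760,
  -13742563800, -389638976, 61975872, -885504, -111232], [-1001052713451520, -4334499234054144,
  -4610505963749376, 13939648576405504, 42336206919309312, 32275453420584960, -9759973946036224,
  -27141734247634944, -15950813994353664, -2517224452120064, 2885860788729408, 2234090616017088,
  564573832236248, -53945578653408, -87224783877744, -25466959982528, 627956727984, 1500752213280,
  93353261840, -33410098944, -1638465096, 324487744, -5086080, -1922304, -2848], [21779864616960,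
  152072350728192, 2212574861279232, 5089074880942080, 976569633939456, -7844959375681536,
  -9011735644704768, -2946771020496384, 1634173776576000, 2247340831884288, 969589401876288,
  -21655067354928, -203663447376192, -91480419657144, -12107103129000, 6184681216488,
  2931404889528, 244306966104, -71797054104, -9513306648, 780535656, 71873856, -3948768, 404352,
  18432], [57036804587520, 287603092291584, 357241367076864, -373102928486400, -1313578595696640,
  -1156737136594944, -118064536289280, 583228496885760, 518922594461952, 126443708269824,
  -99748515155232, -89836819025568, -22776568442160, 6339902355888, 6619017912024, 1680477699168,
  -183390620904, -178658879184, -27651794376, 823196640, 446852184, 15142272, 97680, 130560,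
  -4032], [1602660597760, 9399550279680, 13037073383424, -15642502033408, -53500135735296,
  -30018031650816, 36153632026624, 52565135777280, 12537648304128, -17375079507712,
  -14283362684736, -2005233697776, 2821254796480, 1747356820200, 162876490008, -221048627608,
  -88560596808, -2857185864, 5380728328, 1257159528, 74005032, -6834688, -834048, -18816, -896],
  [-13625589760, -117922725888, -404209287168, -619905769472, -99495421440, 1137838835712,
  1684043959808, 598970359296, -834133962816, -970175315840, -163320797280, 306362956416,
  188230820954, -7113560304, -41921202504, -11721978320, 2296277244, 1816683696, 250123448,
  -54376368, -22504038, -2795456, -96864, 6528, 416]]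

def cB9 : List (List ℤ) :=
  [[-33124515840, 486293372928, 6744406228992, 33601684045824, 95401932005376, 175941724354560,
  221475102612480, 190955851716096, 106158716722944, 27502846780032, -9514924500672,
  -13311701219808, -6735679282512, -2004816904704, -352655954496, -26114063040, 2795277600,
  884317824, 87371136, 3600288, 34992], [2121077882880, 4925841997824, -643731554304,
  66021915377664, 489793237420032, 1452271582854144, 2481721249171968, 2728517137005312,
  1984848555235968, 906107763261888, 169410123797472, -98405077596912, -109968959632752,
  -59173240102776, -21747326830488, -5532576708744, -823150460808, 7790119704, 39694092408,
  11315788344, 1872294840, 202523616, 13526784, 423936], [160498103746560, 864111128543232,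
  1215926999998464, -2352759381762048, -11391827297083392, -19772194677163008, -20104588001789952,
  -13499691868350720, -6267372052340736, -1788184977857088, 176014385150880, 683447090202672,
  551802865114656, 294955437852984, 118435081842672, 35962706659200, 7613549712648, 816180109416,
  -86097380160, -53920279776, -11067543672, -1344850992, -100065792, -3766272, -24576],
  [-380502545530880, 2889489351573504, 16055923021676544, 22003136197320704, -6272986098898944,
  -49095418434653184, -61860649738531328, -41659806648031488, -16364504594090880,
  -1725244175574976, 2892253642407072, 2516345965670640, 1098852020797744, 249893494132248,
  -16772092726728, -41671165364008, -19082899794312, -4768696782360, -561150242552, 33389933400,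
  23234980152, 3839174816, 331517376, 14329344, 165376], [-1917534710005760, 15958455060922368,
  85746920530919424, 135658878000103424, 60979072955025408, -56681916093373440,
  -79929112112846336, -33303217441326336, 2795089559766912, 10767341943745088, 5781020948266656,
  264522143854992, -1612845007333664, -1211790814647864, -504896386982496, -130571892941728,
  -13594247194608, 4021011283968, 1880318527072, 289190069808, 5766280368, -4014584872,
  -548810688, -27860736, -367616], [1824323306782720, 60099542572597248, 197154464660914176,
  196204629830352896, -52385980484917248, -215093469078180864, -119683043774844416,
  11467049858756352, 45035608880674944, 25898363628108992, 4502491904641632, -3668203472395824,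
  -2854836438544688, -754572541053720, 83704228227144, 155280200791448, 65956477137912,
  12975345208728, 92920226008, -479845300776, -85230168840, -4126016896, 257767104, 25993728,
  251776], [11030085588090880, 103267033067225088, 198504048240500736, -37263483578982400,
  -395910844582735872, -297229156698706944, 40141706033191936, 153772551173493504,
  89149936759015680, 20477779567479488, -6406406494613856, -5844694023186960, -420891963786464,
  1162629760479768, 695819576227920, 194495319356768, 8420295936312, -13985738060328,
  -4295052094400, -286021595232, 69401292024, 12607206176, 560181888, -1216320, 146560],
  [13566182461276160, 84496334741962752, 22491850231087104, -317832103362142208,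
  -313810555998124032, 178380973453476864, 388439111295317504, 199060051432243968,
  15493968769569408, -37449392910994112, -25158409102352352, -5127323349359568, 1733865506955248,
  1112032303570104, 102466325831640, -132972710611784, -76720839104520, -14483101485528,
  1317408977576, 830147527992, 74524249848, -4714825664, -831073920, -22293888, -184192],
  [6703465045688320, 12921569627602944, -139992202296262656, -207286880138100736,
  208860309866846208, 483513921476232192, 206566849790299648, -88185696828910848,
  -125238715537147776, -59227806652073920, -8474045771209440, 6577672598478864, 3518633813354176,
  263655320015976, -315306090148608, -150764658881344, -12694642149600, 13023431948880,
  3798257179360, 25013299440, -95714692128, -8714682232, 70128192, 17968320, -66176],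
  [-4016513139343360, -37838794996580352, -83928279488004096, 101264228594335744,
  294431323234768896, 57468890621457408, -232946067793043968, -207007136671166208,
  -61862930192121984, 13397053953121600, 22941005343942048, 9650368419769392, 665520525852080,
  -732313178866920, -264636193421640, 1504412354920, 37006673411880, 8841915437832,
  -1119939491608, -529931157720, -21858951192, 5883202528, 469411968, 2560512, 33536],
  [-5919702210969600, -14729171732594688, 35392428766175232, 101235914589708288,
  -28178345999548416, -203906451351800832, -149240179894345728, 2703446833427712,
  56299522175608320, 36837061045937472, 9868427852369376, -2438433848708976, -2641825994134176,
  -709979068169304, -13629618234480, 61432080472896, 13938835356792, -4225902512616,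
  -1546083102144, 29983501536, 43325154552, 2525750352, -152396544, -8721024, 79104],
  [314000350904320, 9863681041367040, 14220283551842304, -31863571535945728, -84709004408604672,
  -39436207106761728, 48630245028989440, 62107877697668352, 25414087045905792, -942141432352576,
  -7479165548483616, -4105616919442992, -662509713204848, 219606138086856, 148292216248104,
  28932880407560, -6634291293144, -2898466503048, 204851573656, 142591636488, 3999336552,
  -1927350496, -121392960, 1006848, -4352], [392209467965440, -791088887365632, -7157456789028864,
  -11473513160507392, 5647393505359872, 29708742332918784, 24190415740974592, 1342073970471168,
  -9320958823512960, -7382736798571840, -2415934158327072, 353825208223152, 612750505360672,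
  224565626510424, 25135112915232, -13351230285856, -5061964069872, 244904805216, 280879809568,
  4489636752, -7525568400, -471466264, 34382016, 1856640, -35072], [70635164794880,
  -75549806690304, -29553993252864, 2716073886662656, 5824041614407680, 2913074383905792,
  -2866545865054720, -4362568243133184, -2208860153188992, -28268508367808, 717604446671904,
  438047261939952, 80410695658736, -32976230591112, -26504303938920, -6666569059448, 334890881640,
  429406391880, 20241410504, -14157519672, -1138488984, 194587072, 18188736, -36864, -640],
  [-5162342154240, 92024120082432, 431931413815296, 618939410620416, 125712161181696,
  -589178790091776, -725836785103872, -308941919739648, 121847444050176, 229604210854464,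
  104212325918688, -6966412489392, -27722410528416, -12267388285176, -843883623888, 1435140806112,
  561724966728, 35449450920, -18687943488, -2617033632, 303468936, 59937216, -110976, -169536,
  5760], [-820206632960, 1114505871360, 16282376503296, 29025333813248, -1397431363584,
  -51466115896320, -46313785839104, 5592385605888, 30960380951424, 15597914902976, -2858302140576,
  -6289614992112, -2343165605552, 386607240552, 619000312008, 157965693032, -28644465816,
  -22173553800, -3232607048, 281200488, 104598888, 2880512, -1007616, -61824, 640], [4312268800,
  3061579776, -139132600320, -661623341056, -1337428015104, -1192953400320, 146624280064,
  1321552472832, 995027025024, -116046841792, -555339984864, -231270056304, 77953022608,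
  89593632120, 14044662912, -10685577280, -4842260064, -142462512, 349324576, 86692272, 3722064,
  -1484872, -245568, -12864, -128]]

def cB10 : List (List ℤ) :=
  [[-263679639552, -2970037518336, -14901355413504, -43811081846784, -83129585043456,
  -104626797133824, -84042602155008, -33923222516736, 7650064009728, 19596578738688,
  11988541930176, 2964281189184, -580429522008, -737020928448, -281425034016, -60104576448,
  -7338222864, -395067456, 11884320, 2540160, 86184], [-2124253495296, -16437921841152,
  -90697431416832, -362415814778880, -944712886376448, -1596575205384192, -1766702263145472,
  -1249162990845696, -483013994617728, 10912314223872, 140337839877120, 97223984513136,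
  38657223901728, 8583548819544, -447028251912, -1271164534920, -562549385232, -142372999944,
  -22000528944, -1673124840, 83509776, 41407920, 5803416, 433152, 13824], [-18524841246720,
  238071112040448, 1967347189444608, 5442033148121088, 6993988376122368, 2793079015243776,
  -4422039791447808, -8573401366113024, -8011176073579584, -5305936565901312, -2788911209452032,
  -1183548578753088, -389550571596000, -88971796023840, -6720356947392, 5550041792448,
  3290509166652, 988279156008, 174994051860, 14403306672, -869268924, -382573368, -48084660,
  -3230208, -96768], [-620577230684160, -3297403927855104, -1747558854967296, 14304822136958976,
  30441984508932096, 20757136550461440, -6021711605348352, -21440452161950208, -19089223608801024,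
  -10338211341633408, -3529230975925824, -343994981830800, 424308143634528, 311029426130424,
  120310208992200, 28081074074472, 1767714812280, -1422625336920, -576769978344, -98948098968,
  -5727320472, 753150624, 162322464, 11933952, 336384], [-4059653788794880, -21499276082085888,
  -25524215981334528, 26029464797495296, 77151818740924416, 49777345244614656, -7837175963883520,
  -22938232136394240, -6963440953351680, 6378611828005888, 9012617652183648, 5896974731285472,
  2359278817038560, 525842271323952, -6680953923240, -58325777505056, -24848993991240,
  -4977822923856, -147027787624, 153623859744, 30811736424, 1527632704, -176556048, -23805312,
  -756928], [-10548294755811328, -39706504986624000, -7979889476272128, 121785581018718208,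
  160254841144461312, 34137706640277504, -54439639051543552, -28037267146826496,
  13436446368196224, 22379664557001472, 13510753983555072, 3705949304313072, -617628261397984,
  -994884237385896, -440862874279176, -100860752420264, -630094685040, 7811931842712,
  2327841026000, 210108619704, -24103467600, -5990252912, -257807400, 15666816, 955520],
  [-13229172703821824, -19105877312962560, 97506433724141568, 232452367185612800,
  90607204250090496, -140462894770483200, -130341535400397056, -11721240494131968,
  30055524804309312, 17098495917178880, -58843862292672, -6119694616158336, -4039277292009248,
  -1181721196998720, -50091911729328, 112641684204320, 52806613755204, 9083518313112,
  -768798793556, -521395537680, -54572889156, 2688306968, 689160996, 22673280, -220928],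
  [-8694920119582720, 21806687962595328, 138176015982870528, 80794914745888768,
  -209369174209056768, -247198595956899840, -18860730871975936, 87470352732658176,
  49604659265795328, 5098530666610816, -9994159921563456, -6767680540778640, -989470520265376,
  789693384732600, 518620206599496, 144857341519816, 3928845650616, -11816554010040,
  -3226605028552, -92899157304, 69055295400, 7159866880, -175119744, -38146176, -877696],
  [-3108857555189760, 26854554281312256, 24301360231071744, -169669123593437184,
  -248480053263759360, 8179438082727936, 173514633499298304, 93510385351377408, 883529201674368,
  -21767517834000384, -12528030552847584, -1066402381197792, 2211665006978736, 1083519029524368,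
  158375763932712, -64701341474688, -46232526063600, -8468395663104, 1201430726400, 546773263008,
  29594472384, -5766958032, -547431816, 786432, 719424], [-468647128596480, -1732302145978368,
  -67091979093639168, -121254748048318464, 40731973756041216, 183005568815603712,
  80845594998752256, -42926455378605312, -54184768678366848, -23495463743473920,
  -1969973370352128, 3810195568707024, 1701180724401504, -8327536751928, -220467212860632,
  -94465841512344, -9433202559408, 7024487394024, 2028405992880, -21209775288, -52747992912,
  -3179998512, 277167432, 23472384, 271104], [-518064209854464, -12140602159300608,
  -24448779512770560, 38007095152766976, 103830542457474048, 28808507958730752,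
  -68121096739549440, -60372122285281536, -14525818329470400, 7138207473659904, 8428311682220928,
  3098577020323776, -108507949894944, -406677164260128, -126138180878688, 1055291444736,
  17205907802436, 4110933319128, -524640437652, -239752034544, -7312229124, 3060689400, 198484116,
  -4906752, -388608], [-284710923927552, 1232504256528384, 17496080817733632, 29153433762385920,
  -4831101727813632, -45246812902490112, -29775552942594048, 5922413945768448, 16206476861193984,
  9883721683526016, 2492743859966784, -785830663508016, -727415763362784, -161658240576216,
  20200851618072, 27098574567864, 5626347104232, -1516400661384, -585647509368, 7091341368,
  15965750712, 805040928, -102705312, -7240704, -59136], [431679364792320, 1863316963786752,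
  1581358158323712, -5767129550143488, -12473261162459136, -3721355439796224, 9547428603196416,
  10045404794893824, 3528878799479040, -832017018455040, -1761253472930400, -893194709427936,
  -133483123331232, 54305435761488, 35232294757032, 5785398831840, -2368274427144, -897793768080,
  48417665592, 43924498272, 1831907880, -612991776, -42643008, 1240704, 99264], [21440466780160,
  -5404127133696, -659821559906304, -1142133883150336, 708354890029056, 2970919394131968,
  2283314008536064, 121764046821120, -986681798757504, -866782684184320, -283875615492096,
  69487878929616, 95574835064416, 35455966262664, 2996501381352, -3042647126584, -1036854999504,
  63024231816, 66407913904, 2721606888, -1743459696, -141924112, 12592200, 1236096, 19072],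
  [-21270622699520, -84911677734912, -62188104241152, 180095921106944, 399548932137984,
  294970468257792, -13485537761024, -223409447057664, -198227491036992, -45629158266880,
  44995300567872, 38653313658624, 9890891969824, -2660408648832, -2915901936432, -735347554528,
  89992593468, 70025691240, 4119111892, -2433691824, -298279548, 29493032, 4812924, -24192,
  -10496], [-952644665344, -5605153898496, -7627257102336, 10339130380288, 34464697503744,
  21231004680192, -19296191782912, -31380589711872, -9457486785792, 8375131706752, 8060139719232,
  1761491933520, -1225115294176, -959325952728, -149462466600, 94828387096, 43777639656,
  2232352152, -2079095512, -356882280, 23544120, 8334400, 37632, -81024, -3712], [9482272768,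
  86416293888, 317333176320, 558247116800, 307147567104, -564753776640, -1143160166912,
  -598124404224, 391105378944, 635666451968, 179434628640, -158652215904, -124120951448,
  -6651269712, 22660795896, 7739964800, -760963248, -925795296, -147909104, 19266912, 8604552,
  775856, -33192, -8448, -320]]

def cB11 : List (List ℤ) :=
  [[212846247936, 1994393124864, 8237387612160, 19453693722624, 28131502694400, 23664682137600,
  7020043656192, -7586079846912, -9985731114240, -4359881635200, 343963029312, 1280012370336,
  573976594800, 61158053376, -44223278400, -22821704640, -5233691232, -668642688, -45360000,
  -1179360, 9072], [1869029572608, 22487724195840, 122643427885056, 380449425014784,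
  730412802902016, 893308229471232, 676188611089920, 259483294506240, -31718869211520,
  -100823049062208, -61695570130272, -20213575193808, -2072393233488, 1898716007160,
  1324681777080, 422558514504, 59196567096, -5947235784, -4341977784, -899622936, -107083080,
  -9047376, -637632, -27648], [-21344456540160, -173113681379328, -256259861544960,
  1072323805593600, 4906799464421376, 9081313393923072, 9920983923177984, 7154377192574208,
  3601239535762560, 1258419129926976, 220439366421984, -79540409300112, -92040527425824,
  -47037947421384, -16729883667360, -4263577110288, -591969634128, 57778391664, 50361940800,
  11448777600, 1214531856, 27024696, -7166880, -751104, -27648], [187797853962240,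
  -80709941723136, -2511316801191936, -2304973412401152, 8940435213711360, 23518261177119744,
  25096060690371072, 14432231335428864, 3897195789379968, -897598885578432, -1654037726236320,
  -1004062400429424, -358455003460656, -64707601797048, 8376191803272, 11157824223720,
  4361611079304, 873381199320, 32268621912, -27282580440, -6411043128, -510279168, 9899040,
  3892992, 179712], [1350705771970560, 355792956162048, -13976511126994944, -24895907261890560,
  -3585204449667072, 21881735857566720, 13674578348035584, -8327320532704512, -15904836118475136,
  -11184901581954240, -4705642461164256, -864283288216752, 330043617229536, 319252479954408,
  127913386300704, 29021575862304, 1158860168352, -1664870149584, -538731980064, -54518952240,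
  5248741248, 1624010472, 91658592, -4295808, -430848], [2279346268012544, -7590877054107648,
  -45927268429627392, -52949784650055680, 3652512222849024, 27082096630127616, -13027473450469888,
  -37619349047292672, -24939375127860096, -6894939198042176, 1905684255640608, 3152252158781424,
  1602351723521264, 393150435300312, -1538313015720, -43605442359896, -18523662586632,
  -3190907311848, 181866027080, 165223182216, 20573958072, -435755792, -220882272, -6516672,
  382592], [-194054120275968, -26165808242884608, -62666871561781248, -5402422308470784,
  82326511715358720, 44411667689739264, -30181568764392960, -26946241629168384, 3609632427080832,
  13945110052481856, 10279181603372640, 3808802930063664, 179378090348640, -502869877606056,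
  -266642270094048, -68384196919056, -2235018092400, 4719925624176, 1317572646912, 50794499424,
  -28003574928, -3447465000, 34558752, 15400608, 140160], [-4350833640079360, -29049845627486208,
  -10677358957363200, 92623762347212800, 92931196200769536, -27829786335206400,
  -53499011823574528, 2214535802948352, 24105827995433856, 14893403284849216, 3426552725580768,
  -2052546735913776, -2016092538064240, -679972714811160, -63762682775832, 48228150698632,
  27078313932936, 4748636283192, -533815626472, -277809983544, -18179433720, 2725537024,
  277253376, -3173760, -455296], [-4218225017487360, -6198433325776896, 44508392655028224,
  67857877328560128, -42209843412461568, -97946683400616960, -21086179280509440,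
  26734847592589056, 14277086379234432, -1329570408764352, -6096539347460832, -4063597457329968,
  -915921337156416, 220091939878344, 208962376108896, 69414000652704, 5095912026240,
  -4797881031888, -1331369196000, 3910438704, 33600977088, 2259084168, -148599456, -10984800,
  124800], [-91404765757440, 9639426985033728, 21738225010016256, -32618718332436480,
  -81140346263169024, -16268691971693568, 41137714287211008, 22215479886266112, -3050200198177920,
  -7927292507829696, -4464637610394144, -404271440215152, 866015412899856, 445477131054312,
  84115489473192, -15052491821352, -16827795822744, -3463815504600, 422542128024, 190956040248,
  6143166312, -2287891824, -135982464, 4788096, 198912], [1532723453755392, 3585085913432064,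
  -10886408371863552, -29188265447374848, 4710326777776128, 41945799105715200, 22494563084705280,
  -5428558603120896, -8793352011835008, -3375495011426880, 558623724893088, 1468887654645840,
  612293764634784, 30134084397864, -59412255017568, -30833859627312, -4430857297968,
  1951916300496, 614210539584, -10606535232, -15827871504, -755917272, 83542944, 3958080, -88320],
  [154154330750976, -1908925680058368, -3351783051264000, 8168450341797888, 19649640480172032,
  7513738775927808, -9011435568634368, -8591180311367424, -2061233110866816, 1127072235043776,
  1442092661286432, 508212457808304, -81134333364624, -108462334658088, -36104586408168,
  -1669671750600, 4247111901528, 1160883652104, -102531467064, -57580562184, -1583690088,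
  744137088, 39952416, -1655040, -52992], [-90521779568640, 124180584726528, 1759080479293440,
  2856307270041600, -865591411931136, -5141994032268288, -3485332346537472, 178519512031488,
  1408020605769600, 1016628767881152, 249622259568480, -150483406626576, -120361389773280,
  -29175500893896, 3097782086112, 5471222055648, 1294392896928, -262653185520, -120353293536,
  -579713616, 3141882432, 179856312, -17454816, -945216, 21504], [-20185601802240, 34520155815936,
  71714552119296, -440920290459648, -993603695069184, -516427531078656, 333048206688768,
  575432520079104, 353345513484672, 37028723449152, -112809622314144, -72039189813936,
  -10655531416752, 7233911923272, 5142536530248, 971204503608, -340747609752, -147581915256,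
  2386798296, 6560393304, 401120808, -92044848, -7515744, 172608, 10368], [726351216640,
  -19574755688448, -83459244097536, -124867541401600, -67200660486144, 47662992915456,
  125301517442560, 102302796531456, 11258857639296, -40885027622464, -27293330610144,
  -3004902979824, 4500795471904, 2732029046856, 347433026784, -295077343408, -113660680464,
  4296860496, 7463423104, 550818144, -185183088, -23271736, 829152, 125472, -1664], [340356759552,
  -370617090048, -6944347127808, -14222525054976, -4173331249152, 17835884891136, 21144078558720,
  3324657090816, -8959818492288, -6580788234048, -645869538144, 1534453289712, 910609813296,
  54988133112, -146278382472, -50945060520, 3964752792, 4865655528, 489142728, -146920680,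
  -26392680, 1639296, 508608, 12672, -1152], [-4804050944, -25174474752, -17961517056,
  167731724288, 547863963648, 700015875072, 239063709184, -411126315264, -508015617408,
  -104906232256, 172005809952, 118479117648, -2917662512, -28697753832, -8066421024, 2103420704,
  1427324832, 113314320, -74500256, -18099408, -114672, 383960, 36384, -480, -128]]

def cB12 : List (List ℤ) :=
  [[-81006428160, -669009051648, -2362322092032, -4513999601664, -4639903865856, -1486507438080,
  2185133884416, 2874596594688, 1013711739264, -522603083520, -610420442688, -156218461056,
  59196140388, 48348951840, 9565525872, -1643683104, -1239756840, -279834912, -32105808, -1832544,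
  -38556], [-1868102369280, -18829830979584, -80843187732480, -192571017891840, -274826372788224,
  -229033686730752, -83115641825280, 32546424941568, 54988507853568, 28565079252480,
  6065202860352, -1524904816752, -1965503600928, -921206987640, -212159677032, 5605361352,
  17956505736, 4659614424, 403579800, -22408056, -2416392, 1242432, 218160, 10368],
  [-8522036674560, -139364362616832, -792717938786304, -2283941471698944, -3828845620758528,
  -3940531398844416, -2472622627051008, -817714605030912, 36971676422784, 220284206240256,
  158498219524320, 72043577339616, 21262828254624, 2986999398576, -784238705352, -780485337504,
  -328628982384, -79763246640, -8420659632, 862185312, 390877488, 46885536, 1746936, -70848,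
  -5184], [-27794146590720, -263157722578944, -2036301120258048, -7086092883111936,
  -12264783873490944, -11231227698886656, -4827481681268736, 313060681797120, 1666532223263232,
  1136716717082112, 437329073012544, 58451928595920, -42592122141984, -32571944792856,
  -12247556676552, -2713617092952, -52507000872, 202166026200, 67962941640, 8542038312,
  -254746008, -188935776, -17107488, -175104, 29376], [92618449551360, 1158458972700672,
  355052245155840, -8041383997784064, -14845853529833472, -6562610302574592, 6376008113584128,
  9011352383806464, 4656638500775424, 941023866147840, -492511656978432, -568921519722240,
  -259608245711760, -59179344150528, 825782867712, 6875782433280, 3000089076480, 564546736800,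
  -10246603392, -24484371264, -3638651328, -6433056, 35163360, 1546560, -60048], [858672318382080,
  5678305207713792, 5808272197533696, -7537405078818816, -8176189659181056, 13982005086898176,
  23370309817460736, 11140864511883264, -166660487020800, -3096637349883648, -2196084944397888,
  -732791960471664, 7558784109024, 114331038040584, 55780836585336, 14190089575080, 471798603720,
  -1005444115272, -297634992168, -18976623192, 4830920568, 737263200, 585360, -2833920, 38976],
  [1989460270776320, 7698333228859392, -1368536781127680, -18664270916550656, 223401233319936,
  27286632181039104, 14547777044653568, -7112711914034688, -9757631313936000, -4621724615111168,
  -718462407946848, 769824852748704, 602378948912480, 186605549297040, 17364680413416,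
  -12930730625696, -7405680565296, -1367193266064, 110295145520, 72090349152, 5705879184,
  -607025696, -68861208, 1017792, 33824], [1737922572451840, 328134560514048, -18336367215919104,
  -17729096884056064, 18138745628540928, 18041172510185472, -13692499393249280,
  -18361157503053312, -5884480796788224, 989783755465472, 2421664266900672, 1396965447674448,
  231594215971552, -104070839340888, -76536716237544, -24760263697528, -1915448686056,
  1606239700920, 467004989128, 7886412360, -9929233176, -676377856, 46901376, 2158464, -56576],
  [157769074606080, -6434019340713984, -13147917208977408, 10625511666745344, 23651110669940736,
  -7930157642391552, -20780512555355136, -3982048232795136, 4983060539508480, 4221314987384832,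
  1768162567467072, -107638103830080, -474230130709800, -199826650356576, -35444019319536,
  6928154335872, 7379346182400, 1531653519168, -157664022720, -77487499776, -2810234472,
  803629344, 35822832, -1776192, 3600], [-391714972631040, -2173823631556608, 6053769978101760,
  17243944490520576, -1341313801752576, -17223609337608192, -2457992577619968, 7953350372969472,
  4855891337775360, 1105713788344320, -696675396376896, -854942314709712, -267900076568160,
  17087338811352, 39010490340936, 17763813739608, 2467634700888, -1060413438456, -330125861496,
  3084279576, 7142629800, 250889472, -36531120, -650112, 27264], [92351161958400,
  1989711632007168, 5539841172111360, -1068252222701568, -10234763575818240, -1764008876433408,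
  6803317065831936, 3606315538355712, -248229162221184, -1159748700940800, -891874353787872,
  -193064071735776, 122378045943648, 81110383729104, 22426475455752, 308992698912, -3123458330256,
  -803473341264, 73243052208, 36388396320, 762145680, -379367328, -10194744, 829632, -6528],
  [123640766791680, 337254687375360, -1398199009689600, -3508817867575296, -146236837085184,
  3732600261605376, 1779431743107072, -819160409673216, -1029112785971712, -558976817574912,
  -52885822320960, 168705416254704, 88342580001696, 11090251544952, -6247196558040,
  -5246564223240, -1120106993976, 267999687432, 105280654872, -507868680, -2245570440, -71744352,
  11598432, 148224, -7488], [-44795324989440, -244175879405568, -395761207934976, 232564517781504,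
  921880737447936, 265434921984000, -567641241108480, -493789516397568, -192891917477376,
  32897663299584, 128256272082048, 60824693353344, -1305368567952, -10028224531392,
  -5090090941920, -757729465728, 492988720032, 173366484768, -8111139264, -7424101056, -271616640,
  78328608, 2666112, -188736, 1680], [-8329820897280, -32694181625856, 5774159659008,
  88548438675456, 31120277581824, -87551950866432, -107739418748928, -70256909021184,
  3076366558464, 52151208925440, 27916037668416, -3013615252560, -7140000244320, -2967572772456,
  -105049479000, 531564984888, 168697936728, -17699426712, -12691806456, -464335176, 280295400,
  17737056, -1543440, -40704, 1344], [1998339440640, 8678811107328, 14388181893120,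
  10614890594304, -7287465216000, -35088241164288, -39442613282304, -5617939530240,
  20444541563520, 13369320970752, -140305794720, -3326492258976, -1550185033824, -10891321872,
  310838261208, 94138024992, -18645875280, -11641096944, -306236208, 476206368, 47596080,
  -4713696, -480936, 17472, -96], [274337628160, 1886460641280, 3743635095552, 172684685312,
  -8112966156288, -9246669232128, -725984583680, 5241991638528, 3446920392192, -40599131392,
  -1095104795328, -550840462608, 22942434976, 132816603384, 38132098440, -9530046760, -6087064248,
  -202825368, 334348888, 41978520, -6894024, -1343296, 7488, 6528, -128], [-2090598400,
  -24310972416, -111843901440, -264271806464, -320474717184, -106266488832, 217476042752,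
  280782157824, 60202624896, -110672125184, -79237862016, 5020653888, 23416915940, 5878253568,
  -2602265760, -1410273248, 1342728, 119041056, 18952784, -2806176, -943164, -34592, 8880, 576,
  -16]]

def cB13 : List (List ℤ) :=
  [[17836277760, 131096641536, 394181738496, 581574131712, 311647150080, -278862538752,
  -520556295168, -202860661248, 148237496064, 161955884160, 22333340736, -34908493536,
  -16847819856, 713276928, 2477200320, 591458112, -48498912, -47682432, -9362304, -816480,
  -27216], [882683412480, 7153840816128, 24303738617856, 43946799464448, 42551416571904,
  14531548179456, -12576003743232, -16514534036736, -6544226639232, 485456898240, 1598054096736,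
  817026483024, 218392367184, -15400257624, -44105295096, -17109126504, -2062654632, 380302776,
  125159256, -649512, -4466664, -681696, -34560], [11999043256320, 102787992059904,
  366357447991296, 701511900143616, 764277954232320, 433141361667072, 40921510901760,
  -114839682888960, -90479592165888, -39161037614400, -10439460510048, 586846363824,
  2315545125408, 1295163982008, 487201815792, 136037109312, 14994071784, -6709261752, -3350702016,
  -621518688, -41802264, 2705328, 553536, 20736], [47388441968640, 417212874620928,
  1498041991692288, 2726969923952640, 2538072077395968, 852223308162048, -486731448009216,
  -622398348631296, -286969114210176, -61731495320256, 20315137895712, 27852799785264,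
  12575778134256, 2726972017848, -79488478440, -401246784648, -200752041384, -44367960600,
  -821590776, 1694861496, 329408856, 16189632, -1397088, -124416], [54486950215680,
  722092028461056, 2812802819014656, 4419973733990400, 2146165526366208, -1775893064002560,
  -2552693466797568, -975197303490816, 69939218275200, 267786732398400, 183659122317600,
  59582857839120, -2193132787488, -9772782618744, -4847782692672, -1425618733248, -114310022256,
  85685146272, 30373266528, 2781800208, -336271824, -71157384, -980064, 271296], [-84475694284800,
  665197019529216, 3164536688443392, 2690199309434880, -3530411201353728, -6601224075297792,
  -2609592162541056, 946782753073920, 1186845597260928, 579785787423168, 129719788596192,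
  -69240328256496, -61159264167792, -18768125571576, -2091811049112, 1379076414840, 937111907736,
  197704237464, -7951344936, -8951723976, -888722088, 50861856, 7182816, -197952],
  [-254067586498560, 742221776879616, 2456943783419904, -2320975573524480, -8934828718018560,
  -4607074134598656, 2936654937105408, 3202836361396992, 919259609506560, -53991520927296,
  -329646050933088, -208664628401040, -33545102663904, 13488790881048, 10496339026320,
  4047124601376, 459450163800, -234918970344, -77176467264, -2449223232, 1452897816, 102691104,
  -6874368, -141024], [-94963543572480, 1141767835090944, 215497450684416, -6255784389894144,
  -5114495333185536, 4712177283290112, 5955303556505088, 885971401526016, -902514524095872,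
  -768528990515136, -405513340860768, -9282586729872, 78490487252400, 32257142661720,
  7005479054136, -907222629096, -1495048292712, -344742539256, 24844043208, 14987229720,
  553926936, -139230528, -2918784, 279552], [231342515159040, 729861601886208, -2066329281134592,
  -3479601334026240, 3947716216166400, 6830206145934336, 468179273258496, -2288204951917824,
  -1112806710889344, -364478950809792, 104799565996704, 203986460703888, 60721178712768,
  -2140965521496, -7541903678112, -4497168723552, -780506279136, 252375483024, 83711294496,
  -725238288, -1606361760, -28828152, 6663456, -33696], [178445069844480, -193869790838784,
  -1090750927601664, 2013496696995840, 4605925309470720, -74487576148992, -3055171958548992,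
  -1142504423532288, 23753462951808, 261228173424192, 292309909104672, 73239635546352,
  -31973125530384, -20044102976136, -6714219958632, -514703155896, 1010947415112, 279241070760,
  -21691048248, -10504999800, -38864376, 91720800, -265536, -137088], [-29442380267520,
  -205652936687616, 530466395627520, 1551554811518976, -480360461672448, -2252826202438656,
  -690031603814400, 418672217532672, 332087839414272, 234070436907072, 46426916629728,
  -64387529446896, -32046502923936, -4374420424920, 1441033647120, 2087955363456, 534539978136,
  -110423638152, -41786671680, 811283616, 733918104, 1139760, -2715840, 39744], [-26118751518720,
  44992977960960, 124591952166912, -466053446393856, -898174111205376, -144127409476608,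
  403533480282624, 226169037271296, 101069715081600, 10387803483072, -63948266343072,
  -31715531679600, 961655261904, 4035920683176, 2470871244744, 523906774632, -275016457656,
  -99905210568, 5173590744, 3387782952, 10205640, -28693440, 231840, 39168], [-3662028472320,
  -22600018427904, -82560903561216, -75028093157376, 85330842826752, 145239665753088,
  51826650121728, 19815008673024, -103817842560, -37351613657664, -20618758523808, 3469484154672,
  4802097922848, 1927736446104, 222553329408, -375427633536, -133548495984, 15154957440,
  9027796896, 61864560, -158403600, -1644408, 619488, -10368], [2595013263360, 7133200515072,
  10930090770432, 10735267921920, 356380489728, 2608186070016, 20994138662400, 9775991312640,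
  -15360712470144, -11402941065408, 1523573580960, 3122259743664, 1119574703664, -13100944680,
  -313395929352, -103438989144, 23386301640, 13115441160, 74471688, -438503832, -18118008,
  4249440, 16992, -7488], [410574520320, 1481882271744, 805358690304, -47178670080, 6318836133888,
  11690670142464, 2734581445632, -7519056295680, -5217716185344, 490450338624, 1610789385696,
  646608512208, -38940678816, -184740619512, -56951679120, 17498267424, 9947787048, -218739672,
  -620006592, -45775104, 10881384, 794112, -67200, 672], [-120811683840, -366553989120,
  218144538624, 1993412370432, 2395738871808, 64156670976, -1796635584000, -1131647033088,
  136788700032, 465077227200, 212863807200, -27876722736, -73230435696, -19602479544, 8561556456,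
  4647372552, -153864504, -393297192, -35133864, 12580872, 1849800, -93120, -14016, 768],
  [2257059840, 17837064192, 57495846912, 90239336448, 49319086080, -53979552768, -98703659520,
  -32364262656, 40913096832, 36234387264, -1517853792, -12277541616, -3155442288, 1817623608,
  920930592, -72059040, -108302688, -10097712, 5209440, 1045488, -50736, -23304, -672, 96]]

def cB14 : List (List ℤ) :=
  [[-2335703040, -15245770752, -38183436288, -38451511296, 8688715776, 53289861120, 33208372224,
  -16833235968, -26709502464, -3531133440, 8236531008, 3442274496, -973335528, -845951040,
  -42589152, 85178304, 20042640, -1695168, -1246752, -176256, -8424], [-171214110720,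
  -1127380156416, -2952748007424, -3579686977536, -1093806581760, 2149986115584, 2457274143744,
  536126770944, -609932115072, -441099979776, -80919948672, 29001280176, 29860658208, 14577137784,
  2216434104, -1454301864, -783805248, -116995752, 11789280, 6386040, 870912, 48816, 648],
  [-3083207639040, -19947419762688, -52195959484416, -67350180630528, -36651594617856,
  8228379561984, 21266411265792, 9641207243520, 1086378785856, -319195779840, -443166890688,
  -411379502976, -169445118240, -40715220672, -7187920560, 5512717440, 5629136148, 1897699752,
  242744364, -12762576, -7489908, -821016, -29052], [-16578135982080, -100892765454336,
  -240308907687936, -259617891373056, -75736792608768, 92353819299840, 85177932134400,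
  20009701873152, -1919305435392, -3530428977024, -3845938485312, -1739221178832, -145448117280,
  112876479000, 91811738088, 49486413672, 8988939576, -2498715864, -1296834984, -168693336,
  4665384, 2824704, 172224], [-49571073884160, -264290911322112, -506571433353216,
  -316244446396416, 197790844796928, 331166971072512, 80568931129344, -48125622182400,
  -27730270881792, -14783106221568, -6541239153888, 1705086988704, 1924964502048, 593439167376,
  163718517384, -20292637536, -45816623352, -13105236240, -243348120, 421898400, 52191000,
  -1637856, -399312], [-104162104442880, -431254915448832, -488741679857664, 244732188819456,
  784826656339968, 288281761910784, -218012489763840, -139570897713408, -25515171206784,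
  -13570035752448, 8797689062784, 10438679537712, 1819648662048, -134588082312, -276410704392,
  -243149209992, -48255492960, 14187350232, 5716051776, 285158808, -89604576, -7190928, 335592],
  [-143485307781120, -369568645742592, 126044605771776, 1045038310502400, 640103501251584,
  -441721424535552, -415445272102656, 299710907136, 17163462796992, 14585973302016,
  30971013123456, 3623214348864, -3833225100000, -1234674597600, -661427780832, -83693614176,
  115519513068, 33665945112, -1659274092, -1279113552, -41395212, 11796408, 175500],
  [-85972191805440, 57374152261632, 807790042497024, 778313520525312, -517522680999936,
  -769322107183104, 27649853411328, 151207494280704, 10296478778112, 48785616084096,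
  11983718158272, -15726173424336, -3831827282208, -570696583464, -40244073048, 422119946376,
  114100112376, -26115252120, -9471489768, 129117960, 162632232, -296064, -461952],
  [31656373125120, 348081534664704, 496976304881664, -385348308074496, -846973878552576,
  9242909761536, 325436728997376, 11241595473408, 23922518859648, 29735067497472, -30987117220896,
  -10820058647328, 2081499939792, 482807288304, 861957927576, 279472070016, -122583113424,
  -41145143616, 3449456640, 1357758432, -31416768, -9666288, 97992], [49369896714240,
  100650387898368, -253667547611136, -559118811856896, 9170946164736, 369172410531840,
  28231505206272, -29521027093248, 40806098994816, -34029903320064, -22675878882432,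
  6404647689360, 2597211593568, 908232120360, 465747903720, -299187135864, -118693543104,
  19918820808, 7133708448, -348670872, -98464896, 3032208, 231768], [-6162377932800,
  -102753079492608, -198230466613248, 42584810508288, 233498255569920, 12844562190336,
  -50112400654080, 35608629991680, -22786953265728, -30167280628992, 8210114250048, 6296961517056,
  478432526112, 294105512448, -449488967472, -234619578432, 53855079660, 23633189208, -1909419948,
  -640598256, 25915572, 3789144, -88164], [-11083099668480, -16687796060160, 52524902006784,
  85105855107072, -11999570153472, -25132593033216, 24434097002496, -15153799472640,
  -27369727393536, 6703348943232, 8785678697280, 284321838096, -348841033056, -500959221624,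
  -290598482952, 86343212088, 49360005288, -5122813896, -2529958392, 105433848, 31770360,
  -1210752, -70272], [2227151831040, 10595443212288, 6210459426816, -10244723392512,
  3867774529536, 15090956439552, -12501933437952, -17430785293824, 5012502683904, 7707425831424,
  214386160608, -931043585952, -489808874592, -211049501328, 103058639928, 65244413088,
  -7732472760, -5575554000, 190385352, 153304416, -3949992, -927360, 23904], [504547246080,
  705069121536, 1710642364416, 5357678985216, 1447773087744, -9486957883392, -6989967664128,
  4010284940544, 4579361889408, 15730232832, -914642305920, -383604811632, -79188509088,
  95859363816, 53884256616, -8645643864, -7160133024, 180891144, 354583872, 4106376, -5404320,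
  123984, 14904], [-105009315840, -82796249088, 49488039936, -1177932754944, -2633384715264,
  -804738613248, 1926514222848, 1436386722048, -200778326208, -484473256704, -182333002752,
  2877643584, 64434083040, 27460649376, -7406655552, -5490931680, 154396692, 415391976, 18569196,
  -11935728, -507060, 121608, -1836], [-5273026560, -89703383040, -305580294144, -356971180032,
  14638510080, 348388687872, 217125494784, -44648879616, -106395151104, -50608637568, 5833919808,
  23074928784, 7636445856, -3726313848, -2241375624, 169047000, 254983464, 14861880, -11867256,
  -1337256, 170424, 13824, -1728], [-707788800, -4728029184, -12103188480, -12338528256,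
  3372945408, 18668371968, 11249736192, -7178347008, -10293153408, -609154560, 3852925920,
  1236329568, -714227112, -393051312, 53520264, 58921344, 2093040, -4315680, -568080, 123552,
  25272, -432, -216]]

def cB15 : List (List ℤ) :=
  [[169869312, 976748544, 1953497088, 875888640, -2255413248, -2929747968, 310791168, 2321726976,
  695796480, -885914496, -480033216, 172764576, 145523952, -11819520, -23499072, -1570752,
  1920672, 342144, -51840, -18144, -1296], [9215410176, 46055817216, 70182567936, -18717474816,
  -165350356992, -152345650176, 15758654976, 99486455040, 43448026752, -11264588352, -12889349856,
  -3411778320, -606736656, 264557016, 468490392, 163682856, -9640296, -17758440, -4237272,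
  -460728, -29160, -1296], [164277780480, 811147198464, 1354118529024, 450961440768,
  -1098296174592, -986636049408, 242892919296, 500402831616, 22207105152, -116082707904,
  -18676648224, 6789141360, 1760760288, 2927860344, 905118624, -580122000, -270460944, 5392656,
  19746720, 4038336, 364176, 15768], [676009082880, 3090708430848, 4038027116544, -860878209024,
  -4941446694912, -1106250587136, 2686180299264, 812881702656, -865150015104, -233319116736,
  132598568160, 21011131728, 7143145488, 6801400872, -4970996568, -2399408568, 414754344,
  268460568, 11721240, -8112312, -1365336, -76896], [893158686720, 3107313156096, -799893356544,
  -11026260393984, -6489179744256, 8848020759552, 6738444172800, -3403717873920, -2419753627008,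
  773285064768, 268194190752, -67865168304, 42699540960, -14827558680, -16004314368, 4017708864,
  2216105568, -221884272, -148517280, -9254736, 1601856, 183816], [-293760663552, -4079793733632,
  -15782228656128, -14349673857024, 15191284672512, 22038085020672, -6409107638784,
  -11714318122752, 2200643676288, 2541218892480, -575331131232, 11616404400, 24986669616,
  -90738367560, 15896595384, 14884130376, -2292331752, -1158295464, 72215496, 43528104, 2002968,
  -188784], [-1646260125696, -9402648625152, -11390300061696, 18539554406400, 36410149804032,
  -8001560484864, -31382533375488, 1673682289920, 11485359370368, -1193392198080, -1257035181984,
  397237109040, -283681833120, 4540346136, 78639613344, -11000262672, -7345742256, 959437872,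
  370349280, -15443136, -6284304, -42984], [-915454033920, -518398672896, 19292424044544,
  37077890531328, -9438798440448, -50247117794304, -2511458846208, 27860185301760, 529880434560,
  -6625517439168, 967758728544, -80525465712, -199278700848, 278998033608, -19827223416,
  -37823248728, 4870169064, 2218821336, -273670920, -65320344, 2538216, 252288], [1046536519680,
  9838660681728, 19522756214784, -12965845008384, -51245341452288, -2797226265600, 43188156108288,
  4862962407168, -16240473260928, 101945321280, 1837802869920, -609793529904, 495899534016,
  39333222216, -135356738688, 12231487296, 11235573504, -1497233808, -402785568, 46390320,
  4784832, -104760], [1266517278720, 3038622253056, -13528864456704, -34303447793664,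
  3365861382144, 44779497919488, 5905164114432, -24446489575680, -2066593647744, 5541626131776,
  -531898070688, 227870264016, 180799260624, -284964313464, 4128222024, 40547225592, -4143249144,
  -2042640504, 289798776, 38016216, -3275640, -130032], [-513656487936, -6149906104320,
  -11984752410624, 8922873102336, 30759140247552, 246220508160, -24972757166592, -2432275008768,
  8565389442432, 200039848128, -645858995040, 195021733968, -335154095712, -25820645400,
  87811794144, -4244528304, -7641245808, 852393456, 214051680, -28185408, -1940112, 80136],
  [-669964566528, -1022740660224, 6938269581312, 12845182943232, -4914798778368, -16619964797952,
  191020488192, 8299914718464, 418018942080, -1471450266432, -1458515808, -195041552400,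
  -25713009360, 116331426936, 189215352, -16619689512, 1001200824, 872737416, -95037624,
  -14062248, 1321272, 44064], [345684049920, 2227920961536, 2008577212416, -4634090569728,
  -6358229415936, 2273484672000, 5022092524032, -153973322496, -1479241139328, -108922750272,
  6988133088, 16563562992, 95186640672, -208029384, -21812861952, 421630272, 1923292512,
  -96838416, -63822816, 5900688, 580608, -23976], [28240773120, -414205083648, -1429206073344,
  -755565428736, 1603881990144, 1534732821504, -518465981952, -791669396736, -18566070912,
  94688004672, 38804663520, 45992355984, -6589277424, -17804398104, 332810856, 2389908888,
  -11969208, -137178360, 4066200, 3146040, -191160, -11664], [-38149816320, -86824452096,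
  76834013184, 326400344064, 146123606016, -221422408704, -177689977344, 28014315264, 47010367872,
  18916984512, 11322563616, -7347136752, -8429312736, 867387528, 1729296864, 856656, -155329488,
  -4731696, 5836320, -15552, -102384, 2376], [5081923584, 21637103616, 28617670656, 344162304,
  -28206102528, -17952482304, 2125979136, 6789816576, 6430036608, 2384856000, -3093248736,
  -2255409360, 586903536, 638193816, -35441064, -86640840, -3116232, 5557896, 424872, -135432,
  -5832, 1728], [99090432, 573308928, 1151926272, 507838464, -1378031616, -1776909312, 231206400,
  1470410496, 412283520, -600626880, -306506592, 134313552, 100106064, -14865768, -18024768,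
  165888, 1796256, 136080, -87264, -11664, 1296, 216]]

def cB16 : List (List ℤ) :=
  [[-5308416, -26542080, -39149568, 12939264, 80932608, 36080640, -64509696, -51570432, 27425952,
  31700160, -6766416, -11207808, 953775, 2404728, -51516, -305208, -8262, 21384, 1620, -648, -81],
  [-148635648, -599851008, -510935040, 890818560, 1462136832, -418535424, -1521856512, -25256448,
  896417280, 95945472, -334746432, -36903600, 80392176, 6113880, -11852568, -480168, 993384,
  21384, -42120, -648, 648], [-1645608960, -4995219456, -429318144, 11177533440, 5632063488,
  -11739893760, -7052645376, 7755844608, 4248744192, -3527297280, -1412896608, 1090394784,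
  250062552, -212218704, -19282536, 23413536, 118584, -1302480, 47304, 28512, -1296],
  [-8918138880, -17262968832, 20093681664, 47922057216, -23233941504, -59282233344, 20609261568,
  41577960960, -14623483392, -17285363712, 7139036736, 4048850448, -2090153808, -448883208,
  328580712, 10048536, -24675192, 1475496, 709560, -68040, -1944], [-22640394240, -10531897344,
  98976743424, 34000404480, -177953946624, -30893985792, 176360924160, -938843136, -102921052032,
  17495232768, 34283658240, -10932003648, -5731189020, 2798722368, 311646528, -308761632,
  16432632, 12488256, -1550016, -75168, 8100], [-13079937024, 70506381312, 115369132032,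
  -231490400256, -222677766144, 360819836928, 171041144832, -319612137984, -36827758080,
  160209944064, -21951746496, -41474709936, 13708889712, 4261794264, -2509651512, 24877368,
  155751336, -19714104, -1869480, 318168, 648], [44686245888, 112734830592, -183592230912,
  -384433496064, 401556621312, 510582362112, -537491303424, -300887903232, 417129087744,
  42120974592, -171392176800, 31546368864, 30883875048, -12477155760, -1184473368, 1310263776,
  -136089720, -31294512, 5468472, 54432, -19440], [52765655040, -82020335616, -354709684224,
  293258465280, 731543187456, -568701057024, -693089685504, 646279534080, 285125764608,
  -405615216384, -63353664, 123816492432, -33807338064, -12345121224, 6940956744, -340983432,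
  -326197368, 50495400, 2355480, -609768, 3240], [-47669575680, -180602929152, 180487471104,
  633767141376, -437562238464, -894690883584, 684467283456, 592974743040, -607702782528,
  -134116539264, 279569068704, -38025770112, -54786415014, 21194090640, 1492068600, -2015628624,
  237413916, 40174704, -7934760, -14256, 25434], [-52765655040, 82020335616, 354709684224,
  -293258465280, -731543187456, 568701057024, 693089685504, -646279534080, -285125764608,
  405615216384, 63353664, -123816492432, 33807338064, 12345121224, -6940956744, 340983432,
  326197368, -50495400, -2355480, 609768, -3240], [44686245888, 112734830592, -183592230912,
  -384433496064, 401556621312, 510582362112, -537491303424, -300887903232, 417129087744,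
  42120974592, -171392176800, 31546368864, 30883875048, -12477155760, -1184473368, 1310263776,
  -136089720, -31294512, 5468472, 54432, -19440], [13079937024, -70506381312, -115369132032,
  231490400256, 222677766144, -360819836928, -171041144832, 319612137984, 36827758080,
  -160209944064, 21951746496, 41474709936, -13708889712, -4261794264, 2509651512, -24877368,
  -155751336, 19714104, 1869480, -318168, -648], [-22640394240, -10531897344, 98976743424,
  34000404480, -177953946624, -30893985792, 176360924160, -938843136, -102921052032, 17495232768,
  34283658240, -10932003648, -5731189020, 2798722368, 311646528, -308761632, 16432632, 12488256,
  -1550016, -75168, 8100], [8918138880, 17262968832, -20093681664, -47922057216, 23233941504,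
  59282233344, -20609261568, -41577960960, 14623483392, 17285363712, -7139036736, -4048850448,
  2090153808, 448883208, -328580712, -10048536, 24675192, -1475496, -709560, 68040, 1944],
  [-1645608960, -4995219456, -429318144, 11177533440, 5632063488, -11739893760, -7052645376,
  7755844608, 4248744192, -3527297280, -1412896608, 1090394784, 250062552, -212218704, -19282536,
  23413536, 118584, -1302480, 47304, 28512, -1296], [148635648, 599851008, 510935040, -890818560,
  -1462136832, 418535424, 1521856512, 25256448, -896417280, -95945472, 334746432, 36903600,
  -80392176, -6113880, 11852568, 480168, -993384, -21384, 42120, 648, -648], [-5308416, -26542080,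
  -39149568, 12939264, 80932608, 36080640, -64509696, -51570432, 27425952, 31700160, -6766416,
  -11207808, 953775, 2404728, -51516, -305208, -8262, 21384, 1620, -648, -81]]

/-- The complementary correspondence. -/
def cB : List (List (List ℤ)) :=
  [cB0, cB1, cB2, cB3, cB4, cB5, cB6, cB7, cB8, cB9, cB10, cB11, cB12, cB13, cB14, cB15, cB16]

/-! ### The fundamental identity -/

/-- The difference of the two sides of the fundamental identity. -/
def relation {A : Type*} [CommRing A] (a x y : A) : A :=
  ev3 cA a x y * ev3 cB a x y -
    (4 * (ev2 cF a x ^ 3 * ((a + 1) * x - 3) * ev2 dG a y ^ 8 * ev2 dH a y ^ 4 * y) -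
      ev2 dF a y ^ 3 * ((a - 2) * y + (a + 4)) * ev2 cG a x ^ 8 * ev2 cH a x ^ 4 * x)

theorem map_relation {A B : Type*} [CommRing A] [CommRing B] (f : A →+* B) (a x y : A) :
    f (relation a x y) = relation (f a) (f x) (f y) := by
  simp [relation, map_ev2, map_ev3, map_ofNat]

/-- Absolute values of all entries of a coefficient list. -/
def abs2 (l : List (List ℤ)) : List (List ℤ) := l.map (List.map fun c => (c.natAbs : ℤ))

/-- Absolute values of all entries of a coefficient list. -/
def abs3 (l : List (List (List ℤ))) : List (List (List ℤ)) := l.map abs2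

/-- A majorant of `relation`. -/
def majorant (a x y : ℤ) : ℤ :=
  ev3 (abs3 cA) a x y * ev3 (abs3 cB) a x y +
    (4 * (ev2 (abs2 cF) a x ^ 3 * ((a + 1) * x + 3) * ev2 (abs2 dG) a y ^ 8 *
        ev2 (abs2 dH) a y ^ 4 * y) +
      ev2 (abs2 dF) a y ^ 3 * ((a + 2) * y + (a + 4)) * ev2 (abs2 cG) a x ^ 8 *
        ev2 (abs2 cH) a x ^ 4 * x)

/-- `z` has norm at most `m`. -/
def Bd {R : Type*} [CommRing R] (ν : R → ℤ) (z : R) (m : ℤ) : Prop := ν z ≤ m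

section Bd

variable {R : Type*} [CommRing R] {ν : R → ℤ} {z w : R} {m n : ℤ}

theorem Bd.nonneg (h : IsNm ν) (hz : Bd ν z m) : 0 ≤ m := (h.nonneg z).trans hz

theorem Bd.add (h : IsNm ν) (hz : Bd ν z m) (hw : Bd ν w n) : Bd ν (z + w) (m + n) :=
  (h.add z w).trans (add_le_add hz hw)

theorem Bd.sub (h : IsNm ν) (hz : Bd ν z m) (hw : Bd ν w n) : Bd ν (z - w) (m + n) := by
  rw [sub_eq_add_neg]
  exact hz.add h ((h.neg w).le.trans hw)

theorem Bd.mul (h : IsNm ν) (hz : Bd ν z m) (hw : Bd ν w n) : Bd ν (z * w) (m * n) :=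
  (h.mul z w).trans (mul_le_mul hz hw (h.nonneg w) (hz.nonneg h))

theorem Bd.one (h : IsNm ν) : Bd ν (1 : R) 1 := h.one

theorem Bd.pow (h : IsNm ν) (hz : Bd ν z m) (k : ℕ) : Bd ν (z ^ k) (m ^ k) := by
  induction k with
  | zero => simpa using Bd.one h
  | succ k ih => rw [pow_succ, pow_succ]; exact ih.mul h hz

theorem Bd.natCast (h : IsNm ν) (k : ℕ) : Bd ν (k : R) k := by
  induction k with
  | zero => simpa [Bd] using h.zero.le
  | succ k ih => push_cast; exact ih.add h (Bd.one h)

theorem Bd.ofNat (h : IsNm ν) (k : ℕ) [k.AtLeastTwo] : Bd ν (OfNat.ofNat k : R) (OfNat.ofNat k) :=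
  Bd.natCast h k

theorem Bd.intCast (h : IsNm ν) (c : ℤ) : Bd ν (c : R) (c.natAbs : ℤ) := by
  rcases Int.natAbs_eq c with hc | hc
  · have : (c : R) = (c.natAbs : R) := by
      conv_lhs => rw [hc]
      simp
    rw [this]
    exact Bd.natCast h _
  · have : (c : R) = -(c.natAbs : R) := by
      conv_lhs => rw [hc]
      simp
    rw [this, Bd, h.neg]
    exact Bd.natCast h _

variable {a x y : R} {α ξ η : ℤ}

theorem Bd.ev1 (h : IsNm ν) (ha : Bd ν a α) (l : List ℤ) :
    Bd ν (ev1 l a) (ev1 (l.map fun c => (c.natAbs : ℤ)) α) := by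
  induction l with
  | nil => exact h.zero.le
  | cons c l ih => exact (Bd.intCast h c).add h (ha.mul h ih)

theorem Bd.ev2 (h : IsNm ν) (ha : Bd ν a α) (hx : Bd ν x ξ) (l : List (List ℤ)) :
    Bd ν (ev2 l a x) (ev2 (abs2 l) α ξ) := by
  induction l with
  | nil => exact h.zero.le
  | cons c l ih => exact (ha.ev1 h c).add h (hx.mul h ih)

theorem Bd.ev3 (h : IsNm ν) (ha : Bd ν a α) (hx : Bd ν x ξ) (hy : Bd ν y η)
    (l : List (List (List ℤ))) : Bd ν (ev3 l a x y) (ev3 (abs3 l) α ξ η) := by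
  induction l with
  | nil => exact h.zero.le
  | cons c l ih => exact (ha.ev2 h hx c).add h (hy.mul h ih)

theorem Bd.relation (h : IsNm ν) (ha : Bd ν a α) (hx : Bd ν x ξ) (hy : Bd ν y η) :
    Bd ν (relation a x y) (majorant α ξ η) := by
  have one := Bd.one h
  have h2 := Bd.ofNat h 2
  have h3 := Bd.ofNat h 3
  have h4 := Bd.ofNat h 4
  have F := fun l => Bd.ev2 h ha hx l
  have G := fun l => Bd.ev2 h ha hy l
  refine ((ha.ev3 h hx hy cA).mul h (ha.ev3 h hx hy cB)).sub h (Bd.sub h (h4.mul h ?_) ?_)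
  · exact (((((F cF).pow h 3).mul h (((ha.add h one).mul h hx).sub h h3)).mul h
      ((G dG).pow h 8)).mul h ((G dH).pow h 4)).mul h hy
  · exact (((((G dF).pow h 3).mul h (((ha.sub h h2).mul h hy).add h (ha.add h h4))).mul h
      ((F cG).pow h 8)).mul h ((F cH).pow h 4)).mul h hx

end Bd

/-- Vanishing of `relation` at a sufficiently spread point. -/
theorem relation_eq_zero_of {p q r : ℤ} (hp : 0 ≤ p) (hq : 0 ≤ q)
    (c1 : majorant 1 1 1 < p) (c2 : majorant p 1 1 < q) (c3 : majorant p q 1 < r)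
    (c4 : relation p q r = 0) {A : Type*} [CommRing A] (a x y : A) : relation a x y = 0 := by
  have hD : relation (C (C X) : ℤ[X][X][X]) (C X) X = 0 := by
    have hb : ∀ α ξ η : ℤ, 0 ≤ α → 0 ≤ ξ → 0 ≤ η →
        nm3 α ξ η (relation (C (C X) : ℤ[X][X][X]) (C X) X) ≤ majorant α ξ η := by
      intro α ξ η hα hξ hη
      have n1 := isNm_abs.pn hα
      have n2 := n1.pn hξ
      refine Bd.relation (isNm_nm3 hα hξ hη) ?_ ?_ (n2.pn_X hη)
      · exact (n2.pn_C η _).trans_le ((n1.pn_C ξ _).trans_le (isNm_abs.pn_X hα))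
      · exact (n2.pn_C η _).trans_le (n1.pn_X hξ)
    refine eq_zero_of_eval_of_nm3 hp hq _ ((hb 1 1 1 ?_ ?_ ?_).trans_lt c1)
      ((hb p 1 1 hp ?_ ?_).trans_lt c2) ((hb p q 1 hp hq ?_).trans_lt c3) ?_
    any_goals exact zero_le_one
    have := map_relation (A := ℤ[X][X][X]) (B := ℤ) (eval₂RingHom (eval₂RingHom
      (eval₂RingHom (RingHom.id ℤ) p) q) r) (C (C X)) (C X) X
    simp only [coe_eval₂RingHom, eval₂_C, eval₂_X] at this
    exact this.trans c4
  have h := map_relation (A := ℤ[X][X][X]) (B := A) (eval₂RingHom (eval₂RingHom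
    (eval₂RingHom (Int.castRingHom A) a) x) y) (C (C X)) (C X) X
  rw [hD, map_zero] at h
  simp only [coe_eval₂RingHom, eval₂_C, eval₂_X] at h
  exact h.symm

/-- The numerical check behind the fundamental identity. -/
theorem relation_check :
    majorant 1 1 1 < ((2 ^ 129 : ℕ) : ℤ) ∧
      majorant ((2 ^ 129 : ℕ) : ℤ) 1 1 < ((2 ^ 5725 : ℕ) : ℤ) ∧
      majorant ((2 ^ 129 : ℕ) : ℤ) ((2 ^ 5725 : ℕ) : ℤ) 1 < ((2 ^ 183174 : ℕ) : ℤ) ∧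
      relation ((2 ^ 129 : ℕ) : ℤ) ((2 ^ 5725 : ℕ) : ℤ) ((2 ^ 183174 : ℕ) : ℤ) = 0 := by
  decide +kernel

/-- The fundamental identity. -/
theorem relation_eq_zero {A : Type*} [CommRing A] (a x y : A) : relation a x y = 0 :=
  relation_eq_zero_of (Int.natCast_nonneg _) (Int.natCast_nonneg _)
    relation_check.1 relation_check.2.1 relation_check.2.2.1 relation_check.2.2.2 a x y

/-- The cleared form of `f` in the variable `x / (α + 1)`. -/
def Fval {A : Type*} [CommRing A] (a t x : A) : A :=
  ev2 cF a x ^ 3 * ((a + 1) * x - 3) -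
    t * ((a + 1) ^ 6 * (a - 2) ^ 2 * (a + 4) ^ 2) * (ev2 cG a x ^ 8 * ev2 cH a x ^ 4 * x)

/-- The cleared form of the dual polynomial. -/
def Hval {A : Type*} [CommRing A] (a t y : A) : A :=
  ev2 dF a y ^ 3 * ((a - 2) * y + (a + 4)) -
    4 * t * ((a + 1) ^ 6 * (a - 2) ^ 2 * (a + 4) ^ 2) * (ev2 dG a y ^ 8 * ev2 dH a y ^ 4 * y)

/-- The denominator of `f`. -/
def Qval {A : Type*} [CommRing A] (a x : A) : A := ev2 cG a x ^ 8 * ev2 cH a x ^ 4 * x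

section
variable {A B : Type*} [CommRing A] [CommRing B] (f : A →+* B)

theorem map_Fval (a t x : A) : f (Fval a t x) = Fval (f a) (f t) (f x) := by
  simp [Fval, map_ev2, map_ofNat]

theorem map_Hval (a t x : A) : f (Hval a t x) = Hval (f a) (f t) (f x) := by
  simp [Hval, map_ev2, map_ofNat]

theorem map_Qval (a x : A) : f (Qval a x) = Qval (f a) (f x) := by
  simp [Qval, map_ev2]

theorem ev1_map_ev1 (l : List (List ℤ)) (a x : ℤ) : ev1 (l.map fun c => ev1 c a) x = ev2 l a x := by
  induction l with
  | nil => rfl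
  | cons c l ih =>
    change (ev1 c a : ℤ) + x * ev1 (l.map fun c => ev1 c a) x = ev1 c a + x * ev2 l a x
    rw [ih]

theorem ev2_map_ev1 (l : List (List (List ℤ))) (a x y : ℤ) :
    ev2 (l.map (List.map fun c => ev1 c a)) x y = ev3 l a x y := by
  induction l with
  | nil => rfl
  | cons c l ih =>
    change ev1 (c.map fun c => ev1 c a) x + y * ev2 (l.map (List.map fun c => ev1 c a)) x y =
      ev2 c a x + y * ev3 l a x y
    rw [ih, ev1_map_ev1]
end

/-- The roots of the specialisation of `f` at `(177, 88)` modulo `881`. -/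
def ptLabel : List ℤ :=
  [0, 38, 62, 375, 63, 258, 127, 302, 76, 462, 533, 494, 284, 355, 519, 496, 96,
  220, 526, 614, 190, 454, 738, 367, 817, 350, 717, 403, 814, 507, 300, 712]

/-- The roots of the specialisation of the dual polynomial at `(177, 88)` modulo `881`. -/
def hypLabel : List ℤ :=
  [0, 616, 778, 565, 530, 43, 522, 176, 791, 6, 757, 324, 475, 593, 750, 216, 32,
  298, 708, 470, 395, 265, 311, 821, 779, 76, 433, 389, 425, 71, 666, 600]

/-- The binary code of a vector. -/
def code (v : V5) : ℕ := (v 0).val + 2 * (v 1).val + 4 * (v 2).val + 8 * (v 3).val + 16 * (v 4).val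

/-- The root of `f` modulo `881` labelled by a vector. -/
def pt (v : V5) : ℤ := ptLabel.getD (code v) 0

/-- The root of the dual polynomial modulo `881` labelled by a covector. -/
def hyp (v : V5) : ℤ := hypLabel.getD (code v) 0

theorem pt_root : ∀ v : V5, v ≠ 0 →
    Fval 177 88 (pt v) % 881 = 0 ∧ Qval 177 (pt v) % 881 ≠ 0 := by decide +kernel

theorem hyp_root : ∀ v : V5, v ≠ 0 → Hval 177 88 (hyp v) % 881 = 0 := by decide +kernel

theorem pt_inj : ∀ v w : V5, (pt v - pt w) % 881 = 0 → v = w := by decide +kernel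

theorem hyp_inj : ∀ v w : V5, (hyp v - hyp w) % 881 = 0 → v = w := by decide +kernel

/-- The incidence correspondence at `α = 177`. -/
def A177 : List (List ℤ) := cA.map (List.map fun c => ev1 c 177)

/-- The complementary correspondence at `α = 177`. -/
def B177 : List (List ℤ) := cB.map (List.map fun c => ev1 c 177)

/-- The standard bilinear form on `𝔽₂⁵`. -/
def dot (w v : V5) : ZMod 2 := w 0 * v 0 + w 1 * v 1 + w 2 * v 2 + w 3 * v 3 + w 4 * v 4

theorem A_ne : ∀ v : V5, v ≠ 0 → ∀ w : V5, w ≠ 0 → dot w v ≠ 0 →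
    ev1 (A177.map fun c => ev1 c (pt v)) (hyp w) % 881 ≠ 0 := by decide +kernel

theorem B_ne : ∀ v : V5, v ≠ 0 → ∀ w : V5, w ≠ 0 → dot w v = 0 →
    ev1 (B177.map fun c => ev1 c (pt v)) (hyp w) % 881 ≠ 0 := by decide +kernel

/-! ### Arithmetic of coefficient lists -/

/-- Sum of coefficient lists. -/
def ladd : List ℤ → List ℤ → List ℤ
  | [], m => m
  | l, [] => l
  | c :: l, d :: m => (c + d) :: ladd l m

/-- Product of coefficient lists. -/
def lmul : List ℤ → List ℤ → List ℤ
  | [], _ => []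
  | c :: l, m => ladd (m.map (c * ·)) (0 :: lmul l m)

/-- Powers of a coefficient list. -/
def lpow (l : List ℤ) : ℕ → List ℤ
  | 0 => [1]
  | n + 1 => lmul (lpow l n) l

section
variable {A : Type*} [CommRing A] (x : A)

theorem ev1_cons (c : ℤ) (l : List ℤ) : ev1 (c :: l) x = c + x * ev1 l x := rfl
theorem ev1_nil : ev1 [] x = 0 := rfl

theorem ev1_ladd (l m : List ℤ) : ev1 (ladd l m) x = ev1 l x + ev1 m x := by
  induction l generalizing m with
  | nil => simp [ladd, ev1_nil]
  | cons c l ih =>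
    cases m with
    | nil => simp [ladd, ev1_nil]
    | cons d m => rw [ladd, ev1_cons, ev1_cons, ev1_cons, ih]; push_cast; ring

theorem ev1_smul (c : ℤ) (m : List ℤ) : ev1 (m.map (c * ·)) x = c * ev1 m x := by
  induction m with
  | nil => simp [ev1_nil]
  | cons d m ih => rw [List.map_cons, ev1_cons, ev1_cons, ih]; push_cast; ring

theorem ev1_lmul (l m : List ℤ) : ev1 (lmul l m) x = ev1 l x * ev1 m x := by
  induction l with
  | nil => simp [lmul, ev1_nil]
  | cons c l ih =>
    rw [lmul, ev1_ladd, ev1_smul, ev1_cons, ev1_cons, ih]; push_cast; ring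

theorem ev1_lpow (l : List ℤ) (n : ℕ) : ev1 (lpow l n) x = ev1 l x ^ n := by
  induction n with
  | zero => simp [lpow, ev1_cons, ev1_nil]
  | succ n ih => rw [lpow, ev1_lmul, ih, pow_succ]

theorem ev1_spec (l : List (List ℤ)) (a : ℤ) :
    ev1 (l.map fun c => (ev1 c a : ℤ)) x = ev2 l (a : A) x := by
  induction l with
  | nil => rfl
  | cons c l ih =>
    have := map_ev1 (Int.castRingHom A) c a
    change ((ev1 c a : ℤ) : A) + x * ev1 (l.map fun c => (ev1 c a : ℤ)) x =
      ev1 c (a : A) + x * ev2 l (a : A) x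
    rw [ih]
    congr 1

theorem ev1_eq_zero {p : ℕ} [CharP A p] (l : List ℤ) (h : ∀ c ∈ l, c % p = 0) : ev1 l x = 0 := by
  induction l with
  | nil => rfl
  | cons c l ih =>
    rw [ev1_cons, ih fun d hd => h d (List.mem_cons_of_mem _ hd),
      (CharP.intCast_eq_zero_iff A p c).2 (Int.dvd_of_emod_eq_zero (h c List.mem_cons_self))]
    simp
end

/-- The coefficient list of `Fval a t`. -/
def lF (a t : ℤ) : List ℤ :=
  ladd (lmul (lpow (cF.map fun c => ev1 c a) 3) [-3, a + 1])
    (lmul [-(t * ((a + 1) ^ 6 * (a - 2) ^ 2 * (a + 4) ^ 2))]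
      (lmul (lmul (lpow (cG.map fun c => ev1 c a) 8) (lpow (cH.map fun c => ev1 c a) 4)) [0, 1]))

theorem ev1_lF {A : Type*} [CommRing A] (a t : ℤ) (x : A) :
    ev1 (lF a t) x = Fval (a : A) (t : A) x := by
  simp only [lF, ev1_ladd, ev1_lmul, ev1_lpow, ev1_spec, ev1_cons, ev1_nil, Fval]
  push_cast
  ring

/-- The derivative of a polynomial given by its coefficient list. -/
def dev1 {A : Type*} [CommRing A] : List ℤ → A → A
  | [], _ => 0
  | _ :: l, x => ev1 l x + x * dev1 l x

theorem map_dev1 {A B : Type*} [CommRing A] [CommRing B] (f : A →+* B) (l : List ℤ) (a : A) :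
    f (dev1 l a) = dev1 l (f a) := by
  induction l with
  | nil => exact map_zero f
  | cons c l ih => rw [dev1, dev1, map_add, map_mul, ih, map_ev1]

theorem derivative_ev1 {A : Type*} [CommRing A] (l : List ℤ) :
    derivative (ev1 l (X : A[X])) = dev1 l X := by
  induction l with
  | nil => exact derivative_zero
  | cons c l ih => rw [ev1_cons, dev1, derivative_add, derivative_intCast, derivative_mul, ih]; simp

theorem simple_139 : ∀ n : ℕ, n < 139 → Fval 104 22 (n : ℤ) % 139 = 0 →
    dev1 (lF 104 22) (n : ℤ) % 139 ≠ 0 := by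
  decide +kernel

theorem card_139 : ((Finset.range 139).filter fun n : ℕ => Fval 104 22 (n : ℤ) % 139 = 0).card =
    15 := by
  decide +kernel

theorem factor_11 : ∀ c ∈ ladd (lF 3 7) (lmul [-1] (lmul [7, 7, 10, 8, 4, 4]
    [10, 1, 2, 1, 4, 1, 0, 0, 4, 5, 9, 9, 6, 4, 0, 2, 7, 10, 2, 0, 10, 6, 9, 1, 1, 5, 4])),
  c % (11 : ℕ) = 0 := by
  decide +kernel

section
variable {F : Type*} [Field F] {a : F}

theorem ev2_cF [CharZero F] (hu : a - 2 ≠ 0) (hv : a + 1 ≠ 0) (hw : a + 4 ≠ 0) (x : F) :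
    ev2 cF a x * (a + 1) ^ 5 =
      (a - 2) ^ 2 * (a + 4) ^ 2 * (f0 a).eval ((a + 1) * x) := by
  simp only [f0, a1, a2, a3, a4, a5, a6, a7, a8, a9, a10, eval_add, eval_mul, eval_pow, eval_X,
    eval_C, cF, ev2, ev1, List.foldr]
  push_cast
  field_simp
  ring

theorem ev2_cG (x : F) : ev2 cG a x * (a + 1) = (g0 a).eval ((a + 1) * x) := by
  simp only [g0, a11, eval_add, eval_sub, eval_mul, eval_pow, eval_X, eval_C, eval_ofNat, cG, ev2,
    ev1, List.foldr]
  push_cast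
  ring

theorem ev2_cH (hu : a - 2 ≠ 0) (hv : a + 1 ≠ 0) (hw : a + 4 ≠ 0) (x : F) :
    ev2 cH a x * (a + 1) ^ 3 = (a - 2) * (a + 4) * (g1 a).eval ((a + 1) * x) := by
  simp only [g1, a12, a13, a14, eval_add, eval_mul, eval_pow, eval_X, eval_C, cH, ev2, ev1,
    List.foldr]
  push_cast
  field_simp
  ring

theorem ev2_dF (hw : a + 4 ≠ 0) (y : F) :
    ev2 cF ((2 - 4 * a) / (a + 4)) y * (a + 4) ^ 9 = 314928 * ev2 dF a y := by
  simp only [cF, dF, ev2, ev1, List.foldr]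
  push_cast
  field_simp
  ring

theorem ev2_dG (hw : a + 4 ≠ 0) (y : F) :
    ev2 cG ((2 - 4 * a) / (a + 4)) y * (a + 4) = 3 * ev2 dG a y := by
  simp only [cG, dG, ev2, ev1, List.foldr]
  push_cast
  field_simp
  ring

theorem ev2_dH (hw : a + 4 ≠ 0) (y : F) :
    ev2 cH ((2 - 4 * a) / (a + 4)) y * (a + 4) ^ 2 = 36 * ev2 dH a y := by
  simp only [cH, dH, ev2, ev1, List.foldr]
  push_cast
  field_simp
  ring

/-- The dual value of the parameter `α`. -/
def dualα (a : F) : F := (2 - 4 * a) / (a + 4)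

/-- The dual value of the parameter `t`. -/
def dualt (a t : F) : F := -4 * ((a + 1) / (a - 2)) ^ 4 * t

theorem dualα_sub_two (hw : a + 4 ≠ 0) : dualα a - 2 = -6 * (a + 1) / (a + 4) := by
  rw [dualα]; field_simp; ring

theorem dualα_add_one (hw : a + 4 ≠ 0) : dualα a + 1 = -3 * (a - 2) / (a + 4) := by
  rw [dualα]; field_simp; ring

theorem dualα_add_four (hw : a + 4 ≠ 0) : dualα a + 4 = 18 / (a + 4) := by
  rw [dualα]; field_simp; ring

theorem Fval_eq [CharZero F] (hu : a - 2 ≠ 0) (hv : a + 1 ≠ 0) (hw : a + 4 ≠ 0) (t x : F) :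
    Fval a t x * (a + 1) ^ 15 =
      (a - 2) ^ 6 * (a + 4) ^ 6 * (fFamily a t).eval ((a + 1) * x) := by
  have h1 := ev2_cF hu hv hw x
  have h2 := ev2_cG (a := a) x
  have h3 := ev2_cH hu hv hw x
  simp only [fFamily, eval_sub, eval_mul, eval_pow, eval_C, eval_X, eval_ofNat, Fval]
  have e1 : (ev2 cF a x * (a + 1) ^ 5) ^ 3 =
    ((a - 2) ^ 2 * (a + 4) ^ 2 * (f0 a).eval ((a + 1) * x)) ^ 3 := by rw [h1]
  have e2 : (ev2 cG a x * (a + 1)) ^ 8 * (ev2 cH a x * (a + 1) ^ 3) ^ 4 =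
    (g0 a).eval ((a + 1) * x) ^ 8 * ((a - 2) * (a + 4) * (g1 a).eval ((a + 1) * x)) ^ 4 := by
    rw [h2, h3]
  have hv1 : (a + 1) ^ 20 ≠ 0 := pow_ne_zero _ hv
  linear_combination ((a + 1) * x - 3) * e1 - t * ((a - 2) ^ 2 * (a + 4) ^ 2) * (a + 1) * x * e2

theorem Hval_eq (hw : a + 4 ≠ 0) (t y : F) :
    Fval (dualα a) (dualt a t) y * (a + 4) ^ 28 = -3 * 314928 ^ 3 * Hval a t y := by
  have h1 := ev2_dF hw y
  have h2 := ev2_dG hw y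
  have h3 := ev2_dH hw y
  rw [Fval, dualα_sub_two hw, dualα_add_one hw, dualα_add_four hw, dualt, Hval]
  rw [← dualα] at h1 h2 h3
  have e1 : ev2 cF (dualα a) y = 314928 * ev2 dF a y / (a + 4) ^ 9 := by
    rw [← h1]; field_simp
  have e2 : ev2 cG (dualα a) y = 3 * ev2 dG a y / (a + 4) := by
    rw [← h2]; field_simp
  have e3 : ev2 cH (dualα a) y = 36 * ev2 dH a y / (a + 4) ^ 2 := by
    rw [← h3]; field_simp
  rw [e1, e2, e3]
  field_simp
  ring

theorem monic_f0 : (f0 a).Monic ∧ (f0 a).natDegree = 10 := by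
  constructor
  · rw [f0]; monicity!
  · rw [f0]; compute_degree!

theorem monic_g0 : (g0 a).Monic ∧ (g0 a).natDegree = 2 := by
  constructor
  · rw [g0]; monicity!
  · rw [g0]; compute_degree!

theorem monic_g1 : (g1 a).Monic ∧ (g1 a).natDegree = 3 := by
  constructor
  · rw [g1]; monicity!
  · rw [g1]; compute_degree!

theorem monic_fFamily (t : F) : (fFamily a t).Monic ∧ (fFamily a t).natDegree = 31 := by
  have h3 : (X - 3 : F[X]) = X - C 3 := by rw [map_ofNat]
  have hm : ((f0 a) ^ 3 * (X - 3)).Monic := (monic_f0.1.pow 3).mul (h3 ▸ monic_X_sub_C 3)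
  have hd : ((f0 a) ^ 3 * (X - 3)).natDegree = 31 := by
    rw [(monic_f0.1.pow 3).natDegree_mul (h3 ▸ monic_X_sub_C 3),
      monic_f0.1.natDegree_pow, monic_f0.2, h3, natDegree_X_sub_C]
  have hl : (C t * (g0 a) ^ 8 * (g1 a) ^ 4 * X).natDegree < ((f0 a) ^ 3 * (X - 3)).natDegree := by
    rw [hd]
    refine lt_of_le_of_lt (b := 29) ?_ (by norm_num)
    refine natDegree_mul_le.trans (Nat.add_le_add (natDegree_mul_le.trans (Nat.add_le_add
      (natDegree_mul_le.trans (Nat.add_le_add (natDegree_C t).le natDegree_pow_le))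
      natDegree_pow_le)) natDegree_X_le) |>.trans ?_
    rw [monic_g0.2, monic_g1.2]
  refine ⟨hm.sub_of_left (degree_lt_degree hl), ?_⟩
  rw [fFamily, natDegree_sub_eq_left_of_natDegree_lt hl, hd]

end

/-- A place of `L` over the specialisation `a ↦ a₀`, `t ↦ t₀` modulo `p`, given by a local subring
with a Frobenius element. -/
structure FrobeniusPlace {K L : Type} [Field K] [Field L] [Algebra K L] (a t : L)
    (p : ℕ) (a₀ t₀ : ℤ) where
  /-- The residue field. -/
  κ : Type
  [field : Field κ]
  [charP : CharP κ p]
  /-- The local ring. -/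
  O : Subring L
  /-- The reduction map. -/
  Φ : O →+* κ
  /-- A Frobenius element. -/
  σ : Gal(L/K)
  /-- The element `a` in the local ring. -/
  aO : O
  /-- The element `t` in the local ring. -/
  tO : O
  coe_aO : (aO : L) = a
  coe_tO : (tO : L) = t
  map_aO : Φ aO = a₀
  map_tO : Φ tO = t₀
  inv_mem : ∀ z : O, Φ z ≠ 0 → z.1⁻¹ ∈ O
  frob : ∀ z : O, ∃ h : σ z ∈ O, Φ ⟨σ z, h⟩ = Φ z ^ p
  mem_of_isIntegral : ∀ z : L, IsIntegral O z → z ∈ O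

attribute [instance] FrobeniusPlace.field FrobeniusPlace.charP

theorem isFractionRing_evalPair :
    letI := (evalPair (RatFunc.C (RatFunc.X : RatFunc ℚ) : Kαt) RatFunc.X).toAlgebra
    IsFractionRing ℤ[X][X] Kαt := by
  let _ := (evalPair (RatFunc.C (RatFunc.X : RatFunc ℚ) : Kαt) RatFunc.X).toAlgebra
  have hinj : Function.Injective (algebraMap ℤ[X][X] Kαt) := evalPair_injective
  have := (faithfulSMul_iff_algebraMap_injective ℤ[X][X] Kαt).2 hinj
  refine IsFractionRing.of_field ℤ[X][X] Kαt fun z => ?_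
  have hz := subfield_eq_top (Subfield.closure (algebraMap ℤ[X][X] Kαt).range)
    (Subfield.subset_closure ⟨C X, evalPair_C_X _ _⟩)
    (Subfield.subset_closure ⟨X, evalPair_X _ _⟩) z
  obtain ⟨x, hx, y, hy, h⟩ := Subfield.mem_closure_iff.1 hz
  rw [Subring.closure_eq] at hx hy
  obtain ⟨x, rfl⟩ := hx
  obtain ⟨y, rfl⟩ := hy
  exact ⟨x, y, h.symm⟩

theorem nonempty_frobeniusPlace (L : Type) [Field L] [Algebra Kαt L] [FiniteDimensional Kαt L]
    [IsGalois Kαt L] (p : ℕ) [Fact p.Prime] (a₀ t₀ : ℤ) :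
    Nonempty (FrobeniusPlace (K := Kαt) (algebraMap Kαt L (RatFunc.C (RatFunc.X : RatFunc ℚ)))
      (algebraMap Kαt L RatFunc.X) p a₀ t₀) := by
  let _ := (evalPair (RatFunc.C (RatFunc.X : RatFunc ℚ) : Kαt) RatFunc.X).toAlgebra
  let _ : Algebra ℤ[X][X] L := ((algebraMap Kαt L).comp (algebraMap ℤ[X][X] Kαt)).toAlgebra
  have : IsScalarTower ℤ[X][X] Kαt L := IsScalarTower.of_algebraMap_eq fun _ => rfl
  have : IsFractionRing ℤ[X][X] Kαt := isFractionRing_evalPair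
  obtain ⟨κ, _, ι, O, Φ, σ, h1, h2, h3, h4⟩ := exists_frobenius_place (R := ℤ[X][X]) (K := Kαt)
    (L := L) (evalPair (a₀ : ZMod p) (t₀ : ZMod p))
  obtain ⟨ha, ha'⟩ := h1 (C X)
  obtain ⟨ht, ht'⟩ := h1 X
  have : CharP κ p := charP_of_injective_ringHom ι.injective p
  have ea : algebraMap ℤ[X][X] L (C X) = algebraMap Kαt L (RatFunc.C (RatFunc.X : RatFunc ℚ)) :=
    congrArg (algebraMap Kαt L) (evalPair_C_X _ _)
  have et : algebraMap ℤ[X][X] L X = algebraMap Kαt L RatFunc.X :=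
    congrArg (algebraMap Kαt L) (evalPair_X _ _)
  exact ⟨{
    κ := κ
    O := O
    Φ := Φ
    σ := σ
    aO := ⟨_, ha⟩
    tO := ⟨_, ht⟩
    coe_aO := ea
    coe_tO := et
    map_aO := by rw [ha']; simp
    map_tO := by rw [ht']; simp
    inv_mem := h2
    frob := h3
    mem_of_isIntegral := h4 }⟩

theorem FrobeniusPlace.exists_lift_roots {K L : Type} [Field K] [Field L] [Algebra K L] {a t : L}
    {p : ℕ} {a₀ t₀ : ℤ} (𝔭 : FrobeniusPlace (K := K) a t p a₀ t₀) (P : 𝔭.O[X]) (c : 𝔭.O)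
    (hc : 𝔭.Φ c ≠ 0) (s : Multiset L)
    (h : P.map 𝔭.O.subtype = C (c : L) * (s.map fun r => X - C r).prod) :
    ∃ s' : Multiset 𝔭.O, s'.map 𝔭.O.subtype = s ∧ P = C c * (s'.map fun r => X - C r).prod := by
  have hc0 : (c : L) ≠ 0 := fun h0 => hc (by
    rw [show c = 0 from Subtype.ext h0, map_zero])
  have hinj : Function.Injective 𝔭.O.subtype := Subtype.val_injective
  have hmem : ∀ r ∈ s, r ∈ 𝔭.O := by
    intro r hr
    refine 𝔭.mem_of_isIntegral r ?_
    have hQ : (C (⟨_, 𝔭.inv_mem c hc⟩ : 𝔭.O) * P).map 𝔭.O.subtype =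
        (s.map fun r => X - C r).prod := by
      rw [Polynomial.map_mul, h, map_C, ← mul_assoc, ← C_mul]
      change C ((c : L)⁻¹ * c) * _ = _
      rw [inv_mul_cancel₀ hc0, C_1, one_mul]
    refine ⟨C (⟨_, 𝔭.inv_mem c hc⟩ : 𝔭.O) * P, monic_of_injective hinj ?_, ?_⟩
    · rw [hQ]; exact monic_multisetProd_X_sub_C s
    · change eval₂ 𝔭.O.subtype r _ = 0
      rw [← eval_map, hQ, eval_multiset_prod, Multiset.prod_eq_zero]
      simp only [Multiset.map_map, Multiset.mem_map]
      exact ⟨r, hr, by simp⟩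
  have hs : (s.attach.map fun r => (⟨r.1, hmem r.1 r.2⟩ : 𝔭.O)).map 𝔭.O.subtype = s := by
    rw [Multiset.map_map]
    exact Multiset.attach_map_val s
  refine ⟨_, hs, map_injective _ hinj ?_⟩
  rw [h, Polynomial.map_mul, map_C, Polynomial.map_multiset_prod]
  conv_lhs => rw [← hs]
  simp only [Multiset.map_map, Function.comp_def, Polynomial.map_sub, map_X, map_C]
  rfl

theorem exists_multiset_of_splits {L : Type*} [Field L] [Infinite L] {P f : L[X]} (hf : f.Monic)
    (hs : f.Splits) {n : ℕ} (hn : f.natDegree = n) {v c : L} (hv : v ≠ 0)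
    (h : ∀ x, P.eval x = c * f.eval (v * x)) :
    ∃ s : Multiset L, s.card = n ∧ P = C (c * v ^ n) * (s.map fun r => X - C r).prod := by
  refine ⟨f.roots.map fun r => r / v, by rw [Multiset.card_map, ← hs.natDegree_eq_card_roots, hn],
    Polynomial.funext fun x => ?_⟩
  rw [h, hs.eval_eq_prod_roots_of_monic hf, eval_mul, eval_C, eval_multiset_prod, mul_assoc,
    ← hn, hs.natDegree_eq_card_roots, Multiset.map_map, Multiset.map_map]
  congr 1
  have hc : v ^ f.roots.card = (f.roots.map fun _ => v).prod := by simp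
  rw [hc, ← Multiset.prod_map_mul]
  refine congrArg Multiset.prod (Multiset.map_congr rfl fun r _ => ?_)
  simp only [Function.comp_apply, eval_sub, eval_X, eval_C]
  field_simp

/-- The polynomial `Fval a t`. -/
noncomputable def pF {A : Type*} [CommRing A] (a t : A) : A[X] := Fval (C a) (C t) X

/-- The polynomial `Hval a t`. -/
noncomputable def pH {A : Type*} [CommRing A] (a t : A) : A[X] := Hval (C a) (C t) X

section
variable {A B : Type*} [CommRing A] [CommRing B] (f : A →+* B)

theorem eval_pF (a t x : A) : (pF a t).eval x = Fval a t x := by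
  have := map_Fval (evalRingHom x) (C a) (C t) X
  simpa [pF] using this

theorem eval_pH (a t x : A) : (pH a t).eval x = Hval a t x := by
  have := map_Hval (evalRingHom x) (C a) (C t) X
  simpa [pH] using this

theorem map_pF (a t : A) : (pF a t).map f = pF (f a) (f t) := by
  have := map_Fval (mapRingHom f) (C a) (C t) X
  simpa [pF] using this

theorem map_pH (a t : A) : (pH a t).map f = pH (f a) (f t) := by
  have := map_Hval (mapRingHom f) (C a) (C t) X
  simpa [pH] using this

theorem intCast_Fval (a t x : ℤ) : ((Fval a t x : ℤ) : A) = Fval (a : A) (t : A) (x : A) :=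
  map_Fval (Int.castRingHom A) a t x

theorem intCast_Hval (a t x : ℤ) : ((Hval a t x : ℤ) : A) = Hval (a : A) (t : A) (x : A) :=
  map_Hval (Int.castRingHom A) a t x

theorem intCast_Qval (a x : ℤ) : ((Qval a x : ℤ) : A) = Qval (a : A) (x : A) :=
  map_Qval (Int.castRingHom A) a x

theorem intCast_ev3 (l : List (List (List ℤ))) (a x y : ℤ) :
    ((ev3 l a x y : ℤ) : A) = ev3 l (a : A) (x : A) (y : A) :=
  map_ev3 (Int.castRingHom A) l a x y
end

/-- The leading coefficient of `pF`. -/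
def lcF {A : Type*} [CommRing A] (a : A) : A := (a - 2) ^ 6 * (a + 1) ^ 16 * (a + 4) ^ 6

/-- The leading coefficient of `pH`. -/
def lcH {A : Type*} [CommRing A] (a : A) : A := -729 * (a + 1) ^ 6 * (a - 2) ^ 16

theorem map_lcF {A B : Type*} [CommRing A] [CommRing B] (f : A →+* B) (a : A) :
    f (lcF a) = lcF (f a) := by
  simp [lcF, map_ofNat]

theorem map_lcH {A B : Type*} [CommRing A] [CommRing B] (f : A →+* B) (a : A) :
    f (lcH a) = lcH (f a) := by
  simp [lcH, map_ofNat]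

section
variable {L : Type*} [Field L] [CharZero L] {a t : L}

theorem exists_roots_pF (hu : a - 2 ≠ 0) (hv : a + 1 ≠ 0) (hw : a + 4 ≠ 0)
    (hs : (fFamily a t).Splits) :
    ∃ s : Multiset L, s.card = 31 ∧ pF a t = C (lcF a) * (s.map fun r => X - C r).prod := by
  obtain ⟨s, h1, h2⟩ := exists_multiset_of_splits (P := pF a t)
    (c := (a - 2) ^ 6 * (a + 4) ^ 6 / (a + 1) ^ 15) (monic_fFamily t).1 hs (monic_fFamily t).2 hv
    fun x => by
      rw [eval_pF, div_mul_eq_mul_div, ← Fval_eq hu hv hw, mul_div_cancel_right₀]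
      exact pow_ne_zero _ hv
  refine ⟨s, h1, ?_⟩
  rw [h2, lcF]
  congr 2
  field_simp

theorem exists_roots_pH (hu : a - 2 ≠ 0) (hv : a + 1 ≠ 0) (hw : a + 4 ≠ 0)
    (hs : (fFamily (dualα a) (dualt a t)).Splits) :
    ∃ s : Multiset L, s.card = 31 ∧ pH a t = C (lcH a) * (s.map fun r => X - C r).prod := by
  have hu' : dualα a - 2 ≠ 0 := by
    rw [dualα_sub_two hw]
    exact div_ne_zero (mul_ne_zero (by norm_num) hv) hw
  have hv' : dualα a + 1 ≠ 0 := by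
    rw [dualα_add_one hw]
    exact div_ne_zero (mul_ne_zero (by norm_num) hu) hw
  have hw' : dualα a + 4 ≠ 0 := by
    rw [dualα_add_four hw]
    exact div_ne_zero (by norm_num) hw
  obtain ⟨s, h1, h2⟩ := exists_roots_pF hu' hv' hw' hs
  refine ⟨s, h1, ?_⟩
  have h3 : ∀ x, (pF (dualα a) (dualt a t)).eval x * (a + 4) ^ 28 =
      -3 * 314928 ^ 3 * (pH a t).eval x := fun x => by
    rw [eval_pF, eval_pH, Hval_eq hw]
  refine Polynomial.funext fun x => ?_
  have hk : (-3 * 314928 ^ 3 : L) ≠ 0 := by norm_num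
  refine mul_left_cancel₀ hk ?_
  rw [← h3, h2, eval_mul, eval_mul, eval_C, eval_C, lcF, lcH, dualα_sub_two hw, dualα_add_one hw,
    dualα_add_four hw]
  field_simp
  ring

end

theorem exists_labels {ι O κ : Type*} [Fintype ι] (Φ : O → κ) (s : Multiset O)
    (hs : s.card = Fintype.card ι) (ξ : ι → κ) (hξ : Function.Injective ξ)
    (h : ∀ i, ∃ r ∈ s, Φ r = ξ i) :
    ∃ x : ι → O, s = Finset.univ.val.map x ∧ ∀ i, Φ (x i) = ξ i := by
  choose x hx hΦ using h
  refine ⟨x, ?_, hΦ⟩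
  have hinj : Function.Injective x := fun i j hij => hξ (by rw [← hΦ, ← hΦ, hij])
  symm
  refine Multiset.eq_of_le_of_card_le ((Multiset.le_iff_subset
    (Finset.univ.nodup.map hinj)).2 fun r hr => ?_) ?_
  · obtain ⟨i, -, rfl⟩ := Multiset.mem_map.1 hr
    exact hx i
  · rw [Multiset.card_map, hs]
    rfl

theorem eval_prod_eq_zero {R : Type*} [CommRing R] [IsDomain R] {P : R[X]} {c : R} (hc : c ≠ 0)
    {s : Multiset R} (h : P = C c * (s.map fun r => X - C r).prod) {x : R} :
    P.eval x = 0 ↔ x ∈ s := by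
  rw [h, eval_mul, eval_C, mul_eq_zero, or_iff_right hc, eval_multiset_prod, Multiset.map_map,
    Multiset.prod_eq_zero_iff, Multiset.mem_map]
  constructor
  · rintro ⟨r, hr, h⟩
    simp only [Function.comp_apply, eval_sub, eval_X, eval_C, sub_eq_zero] at h
    rwa [h]
  · intro hx
    exact ⟨x, hx, by simp⟩

namespace FrobeniusPlace

variable {K L : Type} [Field K] [Field L] [Algebra K L] {a t : L}
    {p : ℕ} {a₀ t₀ : ℤ} (𝔭 : FrobeniusPlace (K := K) a t p a₀ t₀)

theorem map_intCast_ne {z : ℤ} (h : z % p ≠ 0) : (z : 𝔭.κ) ≠ 0 := fun h0 =>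
  h (Int.emod_eq_zero_of_dvd ((CharP.intCast_eq_zero_iff 𝔭.κ p z).1 h0))

theorem map_intCast_eq {z : ℤ} (h : z % p = 0) : (z : 𝔭.κ) = 0 :=
  (CharP.intCast_eq_zero_iff 𝔭.κ p z).2 (Int.dvd_of_emod_eq_zero h)

theorem exists_lift_pF [CharZero L] (hu : a - 2 ≠ 0) (hv : a + 1 ≠ 0) (hw : a + 4 ≠ 0)
    (hs : (fFamily a t).Splits) (hl : lcF a₀ % p ≠ 0) :
    ∃ s : Multiset 𝔭.O, s.card = 31 ∧
      pF a t = C (lcF a) * ((s.map 𝔭.O.subtype).map fun r => X - C r).prod ∧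
      pF (a₀ : 𝔭.κ) (t₀ : 𝔭.κ) =
        C (lcF (a₀ : 𝔭.κ)) * ((s.map 𝔭.Φ).map fun r => X - C r).prod ∧ lcF (a₀ : 𝔭.κ) ≠ 0 := by
  obtain ⟨s, h1, h2⟩ := exists_roots_pF hu hv hw hs
  have ha : 𝔭.O.subtype 𝔭.aO = a := 𝔭.coe_aO
  have ht : 𝔭.O.subtype 𝔭.tO = t := 𝔭.coe_tO
  have hc : ((lcF 𝔭.aO : 𝔭.O) : L) = lcF a := (map_lcF 𝔭.O.subtype 𝔭.aO).trans (by rw [ha])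
  have hl' : lcF (a₀ : 𝔭.κ) ≠ 0 := by
    rw [← eq_intCast (Int.castRingHom 𝔭.κ), ← map_lcF]
    exact 𝔭.map_intCast_ne hl
  obtain ⟨s', h3, h4⟩ := 𝔭.exists_lift_roots (pF 𝔭.aO 𝔭.tO) (lcF 𝔭.aO)
    (by rwa [map_lcF, 𝔭.map_aO]) s (by rw [map_pF, ha, ht, h2, hc])
  refine ⟨s', by rw [← h1, ← h3, Multiset.card_map], by rw [h3, h2], ?_, hl'⟩
  rw [← 𝔭.map_aO, ← 𝔭.map_tO, ← map_pF, h4, Polynomial.map_mul, map_C, map_lcF,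
    Polynomial.map_multiset_prod]
  simp [Multiset.map_map]

theorem exists_lift_pH [CharZero L] (hu : a - 2 ≠ 0) (hv : a + 1 ≠ 0) (hw : a + 4 ≠ 0)
    (hs : (fFamily (dualα a) (dualt a t)).Splits) (hl : lcH a₀ % p ≠ 0) :
    ∃ s : Multiset 𝔭.O, s.card = 31 ∧
      pH a t = C (lcH a) * ((s.map 𝔭.O.subtype).map fun r => X - C r).prod ∧
      pH (a₀ : 𝔭.κ) (t₀ : 𝔭.κ) =
        C (lcH (a₀ : 𝔭.κ)) * ((s.map 𝔭.Φ).map fun r => X - C r).prod ∧ lcH (a₀ : 𝔭.κ) ≠ 0 := by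
  obtain ⟨s, h1, h2⟩ := exists_roots_pH hu hv hw hs
  have ha : 𝔭.O.subtype 𝔭.aO = a := 𝔭.coe_aO
  have ht : 𝔭.O.subtype 𝔭.tO = t := 𝔭.coe_tO
  have hc : ((lcH 𝔭.aO : 𝔭.O) : L) = lcH a := (map_lcH 𝔭.O.subtype 𝔭.aO).trans (by rw [ha])
  have hl' : lcH (a₀ : 𝔭.κ) ≠ 0 := by
    rw [← eq_intCast (Int.castRingHom 𝔭.κ), ← map_lcH]
    exact 𝔭.map_intCast_ne hl
  obtain ⟨s', h3, h4⟩ := 𝔭.exists_lift_roots (pH 𝔭.aO 𝔭.tO) (lcH 𝔭.aO)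
    (by rwa [map_lcH, 𝔭.map_aO]) s (by rw [map_pH, ha, ht, h2, hc])
  refine ⟨s', by rw [← h1, ← h3, Multiset.card_map], by rw [h3, h2], ?_, hl'⟩
  rw [← 𝔭.map_aO, ← 𝔭.map_tO, ← map_pH, h4, Polynomial.map_mul, map_C, map_lcH,
    Polynomial.map_multiset_prod]
  simp [Multiset.map_map]

end FrobeniusPlace

/-- The nonzero vectors of `𝔽₂⁵`. -/
abbrev Pt := {v : V5 // v ≠ 0}

theorem card_pt : Fintype.card Pt = 31 := by
  simp [Fintype.card_subtype_compl, V5]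

/-- A labelling of the roots of `f` and of its dual by the points and hyperplanes of the projective
space of dimension four over `𝔽₂` which is compatible with incidence. -/
structure Configuration {L : Type*} [Field L] (a t : L) where
  /-- The roots of `f`. -/
  x : Pt → L
  /-- The roots of the dual polynomial. -/
  y : Pt → L
  x_injective : Function.Injective x
  y_injective : Function.Injective y
  Fval_eq_zero : ∀ z, Fval a t z = 0 ↔ ∃ v, x v = z
  Hval_eq_zero : ∀ z, Hval a t z = 0 ↔ ∃ w, y w = z
  incidence : ∀ v w : Pt, ev3 cA a (x v) (y w) = 0 ↔ dot w v = 0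
  Qval_ne_zero : ∀ v, Qval a (x v) ≠ 0

theorem relation_of_roots {A : Type*} [CommRing A] {a t x y : A} (hx : Fval a t x = 0)
    (hy : Hval a t y = 0) : ev3 cA a x y * ev3 cB a x y = 0 := by
  have h := relation_eq_zero a x y
  rw [relation] at h
  rw [Fval] at hx
  rw [Hval] at hy
  linear_combination h + 4 * ev2 dG a y ^ 8 * ev2 dH a y ^ 4 * y * hx -
    ev2 cG a x ^ 8 * ev2 cH a x ^ 4 * x * hy

theorem FrobeniusPlace.nonempty_configuration {K L : Type} [Field K] [Field L] [Algebra K L]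
    [CharZero L] {a t : L} (𝔭 : FrobeniusPlace (K := K) a t 881 177 88)
    (hu : a - 2 ≠ 0) (hv : a + 1 ≠ 0) (hw : a + 4 ≠ 0) (hf : (fFamily a t).Splits)
    (hh : (fFamily (dualα a) (dualt a t)).Splits) : Nonempty (Configuration a t) := by
  have ha : 𝔭.O.subtype 𝔭.aO = a := 𝔭.coe_aO
  have ht : 𝔭.O.subtype 𝔭.tO = t := 𝔭.coe_tO
  have hu' := pow_ne_zero 6 hu
  have hlF : lcF a ≠ 0 :=
    mul_ne_zero (mul_ne_zero (pow_ne_zero _ hu) (pow_ne_zero _ hv)) (pow_ne_zero _ hw)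
  have hlH : lcH a ≠ 0 :=
    mul_ne_zero (mul_ne_zero (by norm_num) (pow_ne_zero _ hv)) (pow_ne_zero _ hu)
  obtain ⟨s, s1, s2, s3, s4⟩ := 𝔭.exists_lift_pF hu hv hw hf (by decide +kernel)
  obtain ⟨r, r1, r2, r3, r4⟩ := 𝔭.exists_lift_pH hu hv hw hh (by decide +kernel)
  obtain ⟨x, hx, hx'⟩ := exists_labels (ι := Pt) 𝔭.Φ s (s1.trans card_pt.symm)
    (fun v => (pt v : 𝔭.κ))
    (fun v w h => Subtype.ext (pt_inj v w (by
      by_contra h0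
      exact 𝔭.map_intCast_ne h0 (by push_cast; exact sub_eq_zero.2 h))))
    fun v => Multiset.mem_map.1 ((eval_prod_eq_zero s4 s3).1 (by
      rw [eval_pF, ← intCast_Fval]
      exact 𝔭.map_intCast_eq (pt_root v v.2).1))
  obtain ⟨y, hy, hy'⟩ := exists_labels (ι := Pt) 𝔭.Φ r (r1.trans card_pt.symm)
    (fun v => (hyp v : 𝔭.κ))
    (fun v w h => Subtype.ext (hyp_inj v w (by
      by_contra h0
      exact 𝔭.map_intCast_ne h0 (by push_cast; exact sub_eq_zero.2 h))))
    fun v => Multiset.mem_map.1 ((eval_prod_eq_zero r4 r3).1 (by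
      rw [eval_pH, ← intCast_Hval]
      exact 𝔭.map_intCast_eq (hyp_root v v.2)))
  have hF : ∀ z, Fval a t z = 0 ↔ ∃ v, (x v : L) = z := fun z => by
    rw [← eval_pF, eval_prod_eq_zero hlF s2, hx]
    simp
  have hH : ∀ z, Hval a t z = 0 ↔ ∃ v, (y v : L) = z := fun z => by
    rw [← eval_pH, eval_prod_eq_zero hlH r2, hy]
    simp
  have key : ∀ (l : List (List (List ℤ))) (v w : Pt), ev3 l 177 (pt v) (hyp w) % 881 ≠ 0 →
      ev3 l a (x v : L) (y w : L) ≠ 0 := fun l v w h h0 => by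
    refine 𝔭.map_intCast_ne h ?_
    rw [intCast_ev3, ← hx', ← hy', ← 𝔭.map_aO, ← map_ev3]
    have : ev3 l 𝔭.aO (x v) (y w) = 0 := by
      refine Subtype.ext ((map_ev3 𝔭.O.subtype l _ _ _).trans ?_)
      rw [ha]
      exact h0
    rw [this, map_zero]
  exact ⟨{
    x := fun v => x v
    y := fun v => y v
    x_injective := fun v w h => Subtype.ext (pt_inj v w (by
      by_contra h0
      refine 𝔭.map_intCast_ne h0 ?_
      push_cast
      rw [← hx', ← hx', Subtype.ext h, sub_self]))
    y_injective := fun v w h => Subtype.ext (hyp_inj v w (by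
      by_contra h0
      refine 𝔭.map_intCast_ne h0 ?_
      push_cast
      rw [← hy', ← hy', Subtype.ext h, sub_self]))
    Fval_eq_zero := hF
    Hval_eq_zero := hH
    incidence := fun v w => by
      constructor
      · intro h
        by_contra h0
        refine key cA v w ?_ h
        rw [← ev2_map_ev1, ← ev1_map_ev1]
        exact A_ne v v.2 w w.2 h0
      · intro h
        refine (mul_eq_zero.1 (relation_of_roots ((hF _).2 ⟨v, rfl⟩)
          ((hH _).2 ⟨w, rfl⟩))).resolve_right (key cB v w ?_)
        rw [← ev2_map_ev1, ← ev1_map_ev1]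
        exact B_ne v v.2 w w.2 h
    Qval_ne_zero := fun v h => by
      refine 𝔭.map_intCast_ne (pt_root v v.2).2 ?_
      rw [intCast_Qval, ← hx', ← 𝔭.map_aO, ← map_Qval]
      have : Qval 𝔭.aO (x v) = 0 := by
        refine Subtype.ext ((map_Qval 𝔭.O.subtype _ _).trans ?_)
        rw [ha]
        exact h
      rw [this, map_zero] }⟩

theorem dot_add (w u v : V5) : dot w (u + v) = dot w u + dot w v := by
  simp only [dot, Pi.add_apply]
  ring

theorem eq_zero_of_dot : ∀ v : V5, (∀ w : V5, w ≠ 0 → dot w v = 0) → v = 0 := by decide +kernel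

theorem zmod_two_ext : ∀ {r s : ZMod 2}, (r = 0 ↔ s = 0) → r = s := by decide

theorem exists_linearEquiv_of_dot (π π' : Pt → Pt) (hπ' : Function.Surjective π')
    (h : ∀ v w : Pt, dot (π' w) (π v) = 0 ↔ dot w v = 0) :
    ∃ e : V5 ≃ₗ[ZMod 2] V5, ∀ v : Pt, e v = π v := by
  classical
  let f : V5 → V5 := fun v => if hv : v = 0 then 0 else π ⟨v, hv⟩
  have hf : ∀ v : Pt, f v = π v := fun v => dif_neg v.2
  have hf0 : f 0 = 0 := dif_pos rfl
  have hd : ∀ (w : Pt) (v : V5), dot (π' w) (f v) = dot w v := fun w v => by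
    rcases eq_or_ne v 0 with rfl | hv
    · simp [hf0, dot]
    · exact zmod_two_ext (by rw [hf ⟨v, hv⟩]; exact h ⟨v, hv⟩ w)
  have hadd : ∀ u v, f (u + v) = f u + f v := fun u v => by
    rw [← sub_eq_zero, sub_eq_add_neg]
    refine eq_zero_of_dot _ fun w hw => ?_
    obtain ⟨w', h'⟩ := hπ' ⟨w, hw⟩
    obtain rfl : (π' w' : V5) = w := congrArg Subtype.val h'
    rw [ZModModule.neg_eq_self, dot_add, dot_add, hd, hd, hd, dot_add]
    exact CharTwo.add_self_eq_zero _
  let F : V5 →ₗ[ZMod 2] V5 := (AddMonoidHom.mk' f hadd).toZModLinearMap 2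
  have hF : Function.Injective F := (injective_iff_map_eq_zero F).2 fun v hv =>
    eq_zero_of_dot v fun w hw => by
      have hv : f v = 0 := hv
      rw [← hd ⟨w, hw⟩, hv]
      simp [dot]
  exact ⟨LinearEquiv.ofInjectiveEndo F hF, fun v => hf v⟩

section
variable {K L : Type*} [Field K] [Field L] [Algebra K L] {a t : K}

theorem Configuration.exists_representation
    (c : Configuration (algebraMap K L a) (algebraMap K L t)) :
    ∃ ρ : Gal(L/K) →* (V5 ≃ₗ[ZMod 2] V5), ∀ g (v w : Pt), g (c.x v) = c.x w ↔ ρ g v = w := by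
  have h1 : ∀ (g : Gal(L/K)) (v : Pt), ∃ w, c.x w = g (c.x v) := fun g v => by
    rw [← c.Fval_eq_zero]
    have := map_Fval (g : L →+* L) (algebraMap K L a) (algebraMap K L t) (c.x v)
    simpa [(c.Fval_eq_zero _).2 ⟨v, rfl⟩] using this.symm
  have h2 : ∀ (g : Gal(L/K)) (v : Pt), ∃ w, c.y w = g (c.y v) := fun g v => by
    rw [← c.Hval_eq_zero]
    have := map_Hval (g : L →+* L) (algebraMap K L a) (algebraMap K L t) (c.y v)
    simpa [(c.Hval_eq_zero _).2 ⟨v, rfl⟩] using this.symm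
  choose π hπ using h1
  choose π' hπ' using h2
  have h3 : ∀ g, ∃ e : V5 ≃ₗ[ZMod 2] V5, ∀ v : Pt, e v = π g v := fun g => by
    refine exists_linearEquiv_of_dot (π g) (π' g) (Finite.surjective_of_injective fun v w h =>
      c.y_injective (g.injective (by rw [← hπ', ← hπ', h]))) fun v w => ?_
    rw [← c.incidence, ← c.incidence, hπ, hπ']
    have := map_ev3 (g : L →+* L) cA (algebraMap K L a) (c.x v) (c.y w)
    simp only [RingHom.coe_coe, AlgEquiv.commutes] at this
    rw [← this, EmbeddingLike.map_eq_zero_iff]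
  choose e he using h3
  have h4 : ∀ g (v w : Pt), g (c.x v) = c.x w ↔ e g v = w := fun g v w => by
    rw [he, Subtype.coe_inj, ← hπ, c.x_injective.eq_iff]
  refine ⟨MonoidHom.mk' e fun g h => LinearEquiv.ext fun v => ?_, h4⟩
  rcases eq_or_ne v 0 with rfl | hv
  · simp
  · have h5 := (hπ (g * h) ⟨v, hv⟩).symm
    rw [AlgEquiv.mul_apply, ← hπ, ← hπ, c.x_injective.eq_iff] at h5
    change e (g * h) v = e g (e h v)
    rw [he (g * h) ⟨v, hv⟩, he h ⟨v, hv⟩, he, ← h5]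

end

theorem irreducible_map_C_sub {F : Type*} [Field F] {p q : F[X]} (hq : q ≠ 0)
    (h : IsRelPrime q p)
    (hm : (p.map RatFunc.C - C RatFunc.X * q.map RatFunc.C).Monic) :
    Irreducible (p.map RatFunc.C - C RatFunc.X * q.map RatFunc.C) := by
  have hC : (algebraMap F[X] (RatFunc F)).comp C = RatFunc.C := RingHom.ext RatFunc.algebraMap_C
  have he : (p.map C - C X * q.map C).map (algebraMap F[X] (RatFunc F)) =
      p.map RatFunc.C - C RatFunc.X * q.map RatFunc.C := by
    rw [Polynomial.map_sub, Polynomial.map_mul, map_map, map_map, hC, map_C, RatFunc.algebraMap_X]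
  rw [← he] at hm ⊢
  rw [← (monic_of_injective (RatFunc.algebraMap_injective F)
    hm).irreducible_iff_irreducible_map_fraction_map,
    ← MulEquiv.irreducible_iff (Bivariate.swap (R := F))]
  have hs : Bivariate.swap (R := F) (p.map C - C X * q.map C) = C (-q) * X + C p := by
    rw [map_sub, map_mul, Bivariate.swap_map_C, Bivariate.swap_map_C, Bivariate.swap_X, C_neg]
    ring
  rw [hs]
  exact irreducible_C_mul_X_add_C (neg_ne_zero.2 hq) h.neg_left

theorem map_fFamily {F E : Type*} [Field F] [Field E] (φ : F →+* E) (a t : F) :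
    (fFamily a t).map φ = fFamily (φ a) (φ t) := by
  simp [fFamily, f0, g0, g1, a1, a2, a3, a4, a5, a6, a7, a8, a9, a10, a11, a12, a13, a14,
    map_ofNat, Polynomial.map_ofNat]

theorem irreducible_fFamily {F L : Type} [Field F] [Field L] [Algebra (RatFunc F) L] (a : F)
    (hs : (fFamily (algebraMap (RatFunc F) L (RatFunc.C a))
      (algebraMap (RatFunc F) L RatFunc.X)).Splits)
    (hq : ∀ z : L, (fFamily (algebraMap (RatFunc F) L (RatFunc.C a))
      (algebraMap (RatFunc F) L RatFunc.X)).eval z = 0 →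
      ((g0 (algebraMap (RatFunc F) L (RatFunc.C a))) ^ 8 *
        (g1 (algebraMap (RatFunc F) L (RatFunc.C a))) ^ 4 * X).eval z ≠ 0) :
    Irreducible (fFamily (RatFunc.C a) RatFunc.X) := by
  obtain ⟨p, hp⟩ : ∃ p : F[X], p = f0 a ^ 3 * (X - 3) := ⟨_, rfl⟩
  obtain ⟨q, hq'⟩ : ∃ q : F[X], q = g0 a ^ 8 * g1 a ^ 4 * X := ⟨_, rfl⟩
  have hmp (E : Type) [Field E] (φ : F →+* E) : p.map φ = f0 (φ a) ^ 3 * (X - 3) := by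
    simp [hp, f0, a1, a2, a3, a4, a5, a6, a7, a8, a9, a10, map_ofNat, Polynomial.map_ofNat]
  have hmq (E : Type) [Field E] (φ : F →+* E) :
      q.map φ = g0 (φ a) ^ 8 * g1 (φ a) ^ 4 * X := by
    simp [hq', g0, g1, a11, a12, a13, a14, map_ofNat, Polynomial.map_ofNat]
  have hf : fFamily (RatFunc.C a) RatFunc.X =
      p.map RatFunc.C - C RatFunc.X * q.map RatFunc.C := by
    rw [hmp, hmq, fFamily]
    ring
  have hq0 : q ≠ 0 := hq' ▸ mul_ne_zero (mul_ne_zero (pow_ne_zero _ monic_g0.1.ne_zero)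
    (pow_ne_zero _ monic_g1.1.ne_zero)) X_ne_zero
  have hm := (monic_fFamily (a := (RatFunc.C a)) RatFunc.X).1
  rw [hf] at hm ⊢
  refine irreducible_map_C_sub hq0 (fun d hdq hdp => ?_) hm
  by_contra hd
  let φ : F →+* L := (algebraMap (RatFunc F) L).comp RatFunc.C
  have hdL : d.map φ ∣ fFamily (algebraMap (RatFunc F) L (RatFunc.C a))
      (algebraMap (RatFunc F) L RatFunc.X) := by
    rw [← map_fFamily, hf, Polynomial.map_sub, Polynomial.map_mul, map_map, map_map]
    exact dvd_sub (map_dvd φ hdp) ((map_dvd φ hdq).mul_left _)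
  have hdd : d.degree ≠ 0 := fun h => hd (isUnit_iff_degree_eq_zero.2 h)
  obtain ⟨z, hz⟩ := (hs.of_dvd (monic_fFamily _).1.ne_zero hdL).exists_eval_eq_zero
    (by rwa [degree_map])
  refine hq z (eval_eq_zero_of_dvd_of_eval_eq_zero hdL hz) ?_
  have := eval_eq_zero_of_dvd_of_eval_eq_zero (map_dvd φ hdq) hz
  rwa [hmq] at this

theorem Configuration.eval_ne_zero {L : Type*} [Field L] [CharZero L] {a t : L}
    (c : Configuration a t) (hu : a - 2 ≠ 0) (hv : a + 1 ≠ 0) (hw : a + 4 ≠ 0) (z : L)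
    (hz : (fFamily a t).eval z = 0) : ((g0 a) ^ 8 * (g1 a) ^ 4 * X).eval z ≠ 0 := by
  obtain ⟨x, rfl⟩ : ∃ x, (a + 1) * x = z := ⟨z / (a + 1), mul_div_cancel₀ _ hv⟩
  have h1 := Fval_eq hu hv hw t x
  rw [hz, mul_zero] at h1
  obtain ⟨v, rfl⟩ := (c.Fval_eq_zero x).1
    ((mul_eq_zero.1 h1).resolve_right (pow_ne_zero _ hv))
  have h2 := c.Qval_ne_zero v
  rw [Qval] at h2
  have hG := right_ne_zero_of_mul h2
  have h3 := left_ne_zero_of_mul h2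
  have h4 := pow_ne_zero_iff (by norm_num) |>.1 (left_ne_zero_of_mul h3)
  have h5 := pow_ne_zero_iff (by norm_num) |>.1 (right_ne_zero_of_mul h3)
  rw [eval_mul, eval_mul, eval_pow, eval_pow, eval_X, ← ev2_cG]
  refine mul_ne_zero (mul_ne_zero (pow_ne_zero _ (mul_ne_zero h4 hv)) (pow_ne_zero _ fun h6 => ?_))
    (mul_ne_zero hv hG)
  have h7 := ev2_cH hu hv hw (c.x v)
  rw [h6, mul_zero] at h7
  exact (mul_ne_zero h5 (pow_ne_zero _ hv)) h7

theorem Configuration.exists_algEquiv {K L : Type*} [Field K] [Field L] [Algebra K L] [CharZero L]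
    [Normal K L] {a t : K} (c : Configuration (algebraMap K L a) (algebraMap K L t))
    (hu : algebraMap K L a - 2 ≠ 0) (hv : algebraMap K L a + 1 ≠ 0)
    (hw : algebraMap K L a + 4 ≠ 0) (h : Irreducible (fFamily a t)) (v w : Pt) :
    ∃ g : Gal(L/K), g (c.x v) = c.x w := by
  have hmin : ∀ v, minpoly K ((algebraMap K L a + 1) * c.x v) = fFamily a t := fun v => by
    have : CharZero K := (RingHom.charZero_iff (algebraMap K L).injective).2 inferInstance
    refine (minpoly.eq_of_irreducible_of_monic h ?_ (monic_fFamily t).1).symm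
    have h1 := Fval_eq hu hv hw (algebraMap K L t) (c.x v)
    rw [(c.Fval_eq_zero _).2 ⟨v, rfl⟩, zero_mul] at h1
    rw [aeval_def, ← eval_map, map_fFamily]
    exact (mul_eq_zero.1 h1.symm).resolve_left
      (mul_ne_zero (pow_ne_zero _ hu) (pow_ne_zero _ hw))
  obtain ⟨g, hg⟩ := isConjRoot_iff_exists_algEquiv.1 ((hmin w).trans (hmin v).symm)
  refine ⟨g, ?_⟩
  rw [map_mul, map_add, AlgEquiv.commutes, map_one] at hg
  exact mul_left_cancel₀ hv hg

/-- A linear automorphism of `𝔽₂⁵` fixing exactly fifteen nonzero vectors is a transvection. -/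
theorem exists_transvection_of_card (g : V5 ≃ₗ[ZMod 2] V5)
    (h : Nat.card {v : Pt // g v = v} = 15) :
    ∃ (u : V5) (φ : Module.Dual (ZMod 2) V5), u ≠ 0 ∧ φ ≠ 0 ∧ φ u = 0 ∧
      ∀ x, g x = x + φ x • u := by
  classical
  let T : V5 →ₗ[ZMod 2] V5 := g.toLinearMap - LinearMap.id
  have hT : ∀ x, T x = g x - x := fun _ => rfl
  have hcard : Nat.card (LinearMap.ker T) = 16 := by
    let e : {v : Pt // g v = v} ≃ {v : LinearMap.ker T // v ≠ 0} :=
      { toFun := fun v => ⟨⟨v.1, by rw [LinearMap.mem_ker, hT, v.2, sub_self]⟩,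
          fun h0 => v.1.2 (congrArg Subtype.val h0)⟩
        invFun := fun v => ⟨⟨v.1, fun h0 => v.2 (Subtype.ext h0)⟩,
          sub_eq_zero.1 (LinearMap.mem_ker.1 v.1.2)⟩
        left_inv := fun _ => rfl
        right_inv := fun _ => rfl }
    rw [Nat.card_congr e, Nat.card_eq_fintype_card, Fintype.card_subtype_compl,
      Fintype.card_subtype_eq] at h
    rw [Nat.card_eq_fintype_card]
    lia
  have hker : Module.finrank (ZMod 2) (LinearMap.ker T) = 4 := by
    rw [Nat.card_eq_fintype_card, Module.card_eq_pow_finrank (K := ZMod 2), ZMod.card] at hcard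
    exact Nat.pow_right_injective le_rfl (hcard.trans (by norm_num : 16 = 2 ^ 4))
  have hrange : Module.finrank (ZMod 2) (LinearMap.range T) = 1 := by
    have := LinearMap.finrank_range_add_finrank_ker T
    rw [hker, Module.finrank_fin_fun] at this
    lia
  obtain ⟨⟨u, hu⟩, hu0, hspan⟩ := finrank_eq_one_iff'.1 hrange
  have hu0 : u ≠ 0 := fun h0 => hu0 (Subtype.ext h0)
  obtain ⟨i, hi⟩ : ∃ i, u i ≠ 0 := Function.ne_iff.1 hu0
  have hi1 : u i = 1 := by
    generalize u i = r at hi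
    revert r
    decide
  have hφ : ∀ x, T x = (T x i) • u := fun x => by
    obtain ⟨r, hr⟩ := hspan ⟨T x, x, rfl⟩
    have hr : r • u = T x := congrArg Subtype.val hr
    rw [← hr, Pi.smul_apply, hi1, smul_eq_mul, mul_one]
  refine ⟨u, (LinearMap.proj i).comp T, hu0, fun h0 => ?_, ?_, fun x => ?_⟩
  · obtain ⟨x, rfl⟩ := hu
    have h1 : T x i = 0 := LinearMap.congr_fun h0 x
    exact zero_ne_one (h1.symm.trans hi1)
  · change T u i = 0
    by_contra h0
    have h1 : T u i = 1 := by
      generalize T u i = r at h0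
      revert r
      decide
    have h2 := hφ u
    rw [h1, one_smul, hT, sub_eq_iff_eq_add, V5_add_self] at h2
    exact hu0 ((map_eq_zero_iff g g.injective).1 h2)
  · change g x = x + T x i • u
    rw [← hφ, hT, add_sub_cancel]

section
variable {K L : Type} [Field K] [Field L] [Algebra K L] [CharZero L] {a t : L} {p : ℕ} {a₀ t₀ : ℤ}

theorem FrobeniusPlace.exists_reduction (𝔭 : FrobeniusPlace (K := K) a t p a₀ t₀)
    (c : Configuration a t) (hu : a - 2 ≠ 0) (hv : a + 1 ≠ 0) (hw : a + 4 ≠ 0)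
    (hs : (fFamily a t).Splits) (hl : lcF a₀ % p ≠ 0) :
    ∃ ξ : Pt → 𝔭.κ,
      pF (a₀ : 𝔭.κ) (t₀ : 𝔭.κ) = C (lcF (a₀ : 𝔭.κ)) * ∏ v, (X - C (ξ v)) ∧
      lcF (a₀ : 𝔭.κ) ≠ 0 ∧ ∀ v w, 𝔭.σ (c.x v) = c.x w → ξ w = ξ v ^ p := by
  obtain ⟨s, s1, s2, s3, s4⟩ := 𝔭.exists_lift_pF hu hv hw hs hl
  have hlF : lcF a ≠ 0 :=
    mul_ne_zero (mul_ne_zero (pow_ne_zero _ hu) (pow_ne_zero _ hv)) (pow_ne_zero _ hw)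
  obtain ⟨r, hr, hr'⟩ := exists_labels 𝔭.O.subtype s (s1.trans card_pt.symm) c.x c.x_injective
    fun v => Multiset.mem_map.1 ((eval_prod_eq_zero hlF s2).1
      (by rw [eval_pF]; exact (c.Fval_eq_zero _).2 ⟨v, rfl⟩))
  refine ⟨fun v => 𝔭.Φ (r v), by rw [s3, hr, Multiset.map_map, Multiset.map_map]; rfl, s4,
    fun v w h => ?_⟩
  obtain ⟨h1, h2⟩ := 𝔭.frob (r v)
  rw [← h2]
  refine congrArg 𝔭.Φ (Subtype.ext ?_)
  change 𝔭.O.subtype (r w) = 𝔭.σ (𝔭.O.subtype (r v))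
  rw [hr', hr', h]

end

theorem eval_derivative_prod_eq_zero {ι R : Type*} [Fintype ι] [CommRing R] {P : R[X]}
    {c : R} {ξ : ι → R} (h : P = C c * ∏ v, (X - C (ξ v))) {v w : ι} (hvw : v ≠ w)
    (hξ : ξ v = ξ w) : (derivative P).eval (ξ v) = 0 := by
  classical
  rw [h, ← Finset.mul_prod_erase _ _ (Finset.mem_univ v),
    ← Finset.mul_prod_erase _ _ (Finset.mem_erase.2 ⟨hvw.symm, Finset.mem_univ w⟩), ← hξ]
  simp [derivative_mul]

theorem eval_prod_eq_zero' {ι R : Type*} [Fintype ι] [CommRing R] [IsDomain R] {P : R[X]}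
    {c : R} (hc : c ≠ 0) {ξ : ι → R} (h : P = C c * ∏ v, (X - C (ξ v))) (z : R) :
    P.eval z = 0 ↔ ∃ v, ξ v = z := by
  rw [h, eval_mul, eval_C, mul_eq_zero, or_iff_right hc, eval_prod, Finset.prod_eq_zero_iff]
  simp [sub_eq_zero, eq_comm]

section
variable {K L : Type} [Field K] [Field L] [Algebra K L] [CharZero L] {a t : K}

theorem FrobeniusPlace.exists_transvection
    (𝔭 : FrobeniusPlace (K := K) (algebraMap K L a) (algebraMap K L t) 139 104 22)
    (c : Configuration (algebraMap K L a) (algebraMap K L t))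
    (hu : algebraMap K L a - 2 ≠ 0) (hv : algebraMap K L a + 1 ≠ 0)
    (hw : algebraMap K L a + 4 ≠ 0)
    (hs : (fFamily (algebraMap K L a) (algebraMap K L t)).Splits)
    (ρ : Gal(L/K) →* (V5 ≃ₗ[ZMod 2] V5))
    (hρ : ∀ g (v w : Pt), g (c.x v) = c.x w ↔ ρ g v = w) :
    ∃ (u : V5) (φ : Module.Dual (ZMod 2) V5), u ≠ 0 ∧ φ ≠ 0 ∧ φ u = 0 ∧
      ∀ x, ρ 𝔭.σ x = x + φ x • u := by
  classical
  have : Fact (Nat.Prime 139) := ⟨by norm_num⟩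
  obtain ⟨ξ, h1, h2, h3⟩ := 𝔭.exists_reduction c hu hv hw hs (by decide +kernel)
  have hF : ∀ n : ℕ, ((Fval 104 22 (n : ℤ) : ℤ) : 𝔭.κ) = (pF ((104 : ℤ) : 𝔭.κ) (22 : ℤ)).eval
      (n : 𝔭.κ) := fun n => by rw [eval_pF, intCast_Fval]; push_cast; rfl
  have hroot : ∀ n : ℕ, Fval 104 22 (n : ℤ) % 139 = 0 ↔ ∃ v, ξ v = n := fun n => by
    rw [← eval_prod_eq_zero' h2 h1, ← hF]
    exact ⟨fun h => 𝔭.map_intCast_eq h, not_imp_not.1 fun h => 𝔭.map_intCast_ne h⟩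
  have huniq : ∀ n : ℕ, n < 139 → ∀ v w, ξ v = n → ξ w = n → v = w := fun n hn v w hv hw => by
    by_contra hvw
    have h4 := eval_derivative_prod_eq_zero h1 hvw (hv.trans hw.symm)
    have h5 : pF ((104 : ℤ) : 𝔭.κ) (22 : ℤ) = ev1 (lF 104 22) X := by
      rw [ev1_lF, pF, map_intCast, map_intCast]
    rw [h5, derivative_ev1, ← coe_evalRingHom, map_dev1, coe_evalRingHom, eval_X, hv] at h4
    refine 𝔭.map_intCast_ne (simple_139 n hn ((hroot n).2 ⟨v, hv⟩)) ?_
    rw [← eq_intCast (Int.castRingHom 𝔭.κ), map_dev1]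
    simpa using h4
  have hpow : ∀ z : 𝔭.κ, z ^ 139 = z ↔ ∃ n < 139, z = (n : ℕ) := fun z => by
    rw [← Subfield.mem_bot_iff_pow_eq_self 𝔭.κ 139, ← ZMod.fieldRange_castHom_eq_bot 139]
    constructor
    · rintro ⟨x, rfl⟩
      exact ⟨x.val, x.val_lt, by simp⟩
    · rintro ⟨n, -, rfl⟩
      exact ⟨n, map_natCast _ _⟩
  have hfix : ∀ v : Pt, ρ 𝔭.σ v = v ↔ ξ v ^ 139 = ξ v := fun v => by
    constructor
    · exact fun h => (h3 v v ((hρ _ _ _).2 h)).symm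
    · intro h
      obtain ⟨n, hn, hvn⟩ := (hpow _).1 h
      have h0 : ρ 𝔭.σ v ≠ 0 := fun h0 => v.2 ((map_eq_zero_iff _ (ρ 𝔭.σ).injective).1 h0)
      have h5 := h3 v ⟨_, h0⟩ ((hρ _ _ _).2 rfl)
      exact congrArg Subtype.val (huniq n hn _ _ (by rw [h5, h, hvn]) hvn)
  have hinj : ∀ m n : ℕ, m < 139 → n < 139 → (m : 𝔭.κ) = n → m = n := fun m n hm hn h =>
    Nat.ModEq.eq_of_lt_of_lt ((CharP.natCast_eq_natCast 𝔭.κ 139).1 h) hm hn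
  refine exists_transvection_of_card _ ?_
  rw [← card_139, Nat.card_eq_fintype_card, ← Fintype.card_coe]
  symm
  have hex : ∀ n : {n // n ∈ (Finset.range 139).filter fun n : ℕ => Fval 104 22 (n : ℤ) % 139 = 0},
      ∃ v, ξ v = (n : ℕ) := fun n => (hroot n).1 (Finset.mem_filter.1 n.2).2
  choose ν hν using hex
  have hlt : ∀ n : {n // n ∈ (Finset.range 139).filter fun n : ℕ => Fval 104 22 (n : ℤ) % 139 = 0},
      (n : ℕ) < 139 := fun n => Finset.mem_range.1 (Finset.mem_filter.1 n.2).1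
  refine Fintype.card_of_bijective (f := fun n => ⟨ν n, (hfix _).2 ((hpow _).2 ⟨n, hlt n, hν n⟩)⟩)
    ⟨fun m n h => Subtype.ext (hinj m n (hlt m) (hlt n) ?_), fun v => ?_⟩
  · have h5 : ν m = ν n := congrArg Subtype.val h
    rw [← hν, ← hν, h5]
  · obtain ⟨n, hn, hvn⟩ := (hpow _).1 ((hfix _).1 v.2)
    refine ⟨⟨n, Finset.mem_filter.2 ⟨Finset.mem_range.2 hn, (hroot n).2 ⟨_, hvn⟩⟩⟩, ?_⟩
    exact Subtype.ext (huniq n hn _ _ (hν _) hvn)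

end

section
variable {K L : Type} [Field K] [Field L] [Algebra K L] [CharZero L] {a t : K}

theorem orderOf_nine {κ : Type*} [Field κ] [CharP κ 11] : orderOf (9 : κ) = 5 := by
  have h11 : (11 : κ) = 0 := by exact_mod_cast CharP.cast_eq_zero κ 11
  have : Fact (Nat.Prime 5) := ⟨by norm_num⟩
  refine orderOf_eq_prime (by linear_combination 5368 * h11) fun h => ?_
  have h8 : (8 : κ) = 0 := by linear_combination h
  exact one_ne_zero (by linear_combination (3 * h11 - 4 * h8) : (1 : κ) = 0)

theorem FrobeniusPlace.exists_pow_five_eq_one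
    (𝔭 : FrobeniusPlace (K := K) (algebraMap K L a) (algebraMap K L t) 11 3 7)
    (c : Configuration (algebraMap K L a) (algebraMap K L t))
    (hu : algebraMap K L a - 2 ≠ 0) (hv : algebraMap K L a + 1 ≠ 0)
    (hw : algebraMap K L a + 4 ≠ 0)
    (hs : (fFamily (algebraMap K L a) (algebraMap K L t)).Splits)
    (ρ : Gal(L/K) →* (V5 ≃ₗ[ZMod 2] V5))
    (hρ : ∀ g (v w : Pt), g (c.x v) = c.x w ↔ ρ g v = w) :
    ∃ n : ℕ, ρ 𝔭.σ ^ n ≠ 1 ∧ (ρ 𝔭.σ ^ n) ^ 5 = 1 := by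
  classical
  have : Fact (Nat.Prime 11) := ⟨by norm_num⟩
  have h11 : (11 : 𝔭.κ) = 0 := by exact_mod_cast CharP.cast_eq_zero 𝔭.κ 11
  obtain ⟨ξ, h1, h2, h3⟩ := 𝔭.exists_reduction c hu hv hw hs (by decide +kernel)
  obtain ⟨q, hq⟩ : ∃ q : 𝔭.κ[X], q = ev1 [7, 7, 10, 8, 4, 4] X := ⟨_, rfl⟩
  have hdvd : q ∣ pF ((3 : ℤ) : 𝔭.κ) (7 : ℤ) := by
    have h := ev1_eq_zero (A := 𝔭.κ[X]) (x := X) _ factor_11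
    rw [ev1_ladd, ev1_lmul, ev1_lmul, ev1_lF, ← hq] at h
    have h0 : ev1 [-1] (X : 𝔭.κ[X]) = -1 := by simp [ev1_cons, ev1_nil]
    rw [h0, neg_one_mul, add_neg_eq_zero] at h
    rw [pF, map_intCast, map_intCast]
    exact ⟨_, h⟩
  have hqe : ∀ z, q.eval z = ev1 [7, 7, 10, 8, 4, 4] z := fun z => by
    rw [hq, ← coe_evalRingHom, map_ev1, coe_evalRingHom, eval_X]
  have hsplit : (pF ((3 : ℤ) : 𝔭.κ) (7 : ℤ)).Splits := by
    rw [h1]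
    exact (Splits.C _).mul (Splits.prod fun v _ => Splits.X_sub_C _)
  have hp0 : pF ((3 : ℤ) : 𝔭.κ) (7 : ℤ) ≠ 0 := by
    rw [h1]
    exact mul_ne_zero (C_ne_zero.2 h2) (Finset.prod_ne_zero_iff.2 fun v _ => X_sub_C_ne_zero _)
  have hdeg : q.degree ≠ 0 := fun h => by
    have h4 := hqe 0
    have h5 := hqe 2
    rw [eq_C_of_degree_eq_zero h, eval_C] at h4 h5
    rw [h4] at h5
    simp only [ev1_cons, ev1_nil] at h5
    push_cast at h5
    exact one_ne_zero (by linear_combination 5 * h5 + 141 * h11 : (1 : 𝔭.κ) = 0)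
  obtain ⟨θ, hθ⟩ := (hsplit.of_dvd hp0 hdvd).exists_eval_eq_zero hdeg
  obtain ⟨v, rfl⟩ := (eval_prod_eq_zero' h2 h1 θ).1 (eval_eq_zero_of_dvd_of_eval_eq_zero hdvd hθ)
  rw [hqe] at hθ
  simp only [ev1_cons, ev1_nil] at hθ
  push_cast at hθ
  have hθ' : (ξ v - 4) ^ 5 = 8 * (ξ v - 5) ^ 5 := by
    linear_combination hθ +
      (-ξ v ^ 5 + 16 * ξ v ^ 4 - 168 * ξ v ^ 3 + 850 * ξ v ^ 2 - 2157 * ξ v + 2179) * h11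
  have hB : ξ v - 5 ≠ 0 := fun hB => by
    have hA : ξ v - 4 = 1 := by linear_combination hB
    rw [hA, hB] at hθ'
    norm_num at hθ'
  obtain ⟨ζ, hζ⟩ : ∃ ζ, ξ v - 4 = ζ * (ξ v - 5) := ⟨_, (div_mul_cancel₀ _ hB).symm⟩
  have hζ5 : ζ ^ 5 = 8 := by
    rw [hζ, mul_pow] at hθ'
    exact mul_right_cancel₀ (pow_ne_zero _ hB) hθ'
  have hζ0 : ζ ≠ 0 := by
    rintro rfl
    refine 𝔭.map_intCast_ne (z := 8) (by norm_num) ?_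
    push_cast
    rw [← hζ5]
    norm_num
  have hζ11 : ζ ^ 11 = 9 * ζ := by
    linear_combination (ζ ^ 6 + 8 * ζ) * hζ5 + 5 * ζ * h11
  have h9 : (9 : 𝔭.κ) ^ 11 = 9 := by
    have := pow_orderOf_eq_one (9 : 𝔭.κ)
    rw [orderOf_nine] at this
    linear_combination 9 * (9 ^ 5 + 1) * this
  have key : ∀ (k : ℕ) (w : Pt), (ρ 𝔭.σ ^ k) v = w → ξ w - 4 = 9 ^ k * ζ * (ξ w - 5) := by
    intro k
    induction k with
    | zero =>
      intro w h
      obtain rfl : v = w := Subtype.ext h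
      rw [hζ, pow_zero, one_mul]
    | succ k ih =>
      intro w h
      have h0 : (ρ 𝔭.σ ^ k) v ≠ 0 := fun h0 =>
        v.2 ((map_eq_zero_iff _ (ρ 𝔭.σ ^ k).injective).1 h0)
      have h4 := congrArg (· ^ 11) (ih ⟨_, h0⟩ rfl)
      have h5 := h3 ⟨_, h0⟩ w ((hρ _ _ _).2 (by
        rw [← h, pow_succ']
        rfl))
      simp only [mul_pow, sub_pow_char, ← h5] at h4
      have h6 : (4 : 𝔭.κ) ^ 11 = 4 := by linear_combination 381300 * h11
      have h7 : (5 : 𝔭.κ) ^ 11 = 5 := by linear_combination 4438920 * h11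
      rw [h6, h7, hζ11, ← pow_mul, mul_comm k 11, pow_mul, h9] at h4
      rw [h4]
      ring
  have hm : (9 : 𝔭.κ) ^ orderOf (ρ 𝔭.σ) = 1 := by
    have h4 := key (orderOf (ρ 𝔭.σ)) v (by rw [pow_orderOf_eq_one]; rfl)
    rw [hζ] at h4
    have h5 := mul_right_cancel₀ hB h4
    exact mul_right_cancel₀ hζ0 (by rw [← h5, one_mul])
  have h5 : 5 ∣ orderOf (ρ 𝔭.σ) := by
    have h4 := orderOf_dvd_of_pow_eq_one hm
    rwa [orderOf_nine] at h4
  have : Finite (V5 ≃ₗ[ZMod 2] V5) := DFunLike.finite _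
  have h6 := orderOf_pow_orderOf_div (orderOf_pos (ρ 𝔭.σ)).ne' h5
  refine ⟨_, fun h => ?_, h6 ▸ pow_orderOf_eq_one _⟩
  rw [h, orderOf_one] at h6
  norm_num at h6

end

theorem nonempty_linearEquiv_mulEquiv :
    Nonempty ((V5 ≃ₗ[ZMod 2] V5) ≃* Matrix.ProjectiveSpecialLinearGroup (Fin 5) (ZMod 2)) := by
  have hbij : Function.Bijective (Matrix.SpecialLinearGroup.toLin' (n := Fin 5) (R := ZMod 2)) := by
    refine ⟨Matrix.SpecialLinearGroup.toLin'_injective, fun e => ?_⟩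
    have hdet : (LinearMap.toMatrix' (e : V5 →ₗ[ZMod 2] V5)).det = 1 := by
      have h := e.isUnit_det'
      rw [LinearMap.det_toMatrix']
      generalize LinearMap.det (e : V5 →ₗ[ZMod 2] V5) = r at h ⊢
      revert r
      decide
    refine ⟨⟨_, hdet⟩, LinearEquiv.ext fun v => ?_⟩
    refine (Matrix.SpecialLinearGroup.toLin'_apply _ v).trans ?_
    change Matrix.toLin' (LinearMap.toMatrix' (e : V5 →ₗ[ZMod 2] V5)) v = e v
    rw [Matrix.toLin'_toMatrix']
    rfl
  have hcenter : Subgroup.center (Matrix.SpecialLinearGroup (Fin 5) (ZMod 2)) = ⊥ := by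
    refine (Subgroup.eq_bot_iff_forall _).2 fun A hA => ?_
    obtain ⟨r, hr, hA⟩ := Matrix.SpecialLinearGroup.mem_center_iff.1 hA
    have hr1 : r = 1 := by
      clear hA
      revert r
      decide
    exact Subtype.ext (by rw [← hA, hr1, map_one]; rfl)
  exact ⟨(MulEquiv.ofBijective _ hbij).symm.trans
    (QuotientGroup.quotientBot.symm.trans (QuotientGroup.quotientMulEquivOfEq hcenter.symm))⟩

section
variable {K L : Type*} [Field K] [Field L] [Algebra K L] [CharZero L] {a t : K}

theorem Configuration.ker_restrict [Fact ((fFamily a t).map (algebraMap K L)).Splits]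
    (c : Configuration (algebraMap K L a) (algebraMap K L t))
    (hu : algebraMap K L a - 2 ≠ 0) (hv : algebraMap K L a + 1 ≠ 0)
    (hw : algebraMap K L a + 4 ≠ 0) (ρ : Gal(L/K) →* (V5 ≃ₗ[ZMod 2] V5))
    (hρ : ∀ g (v w : Pt), g (c.x v) = c.x w ↔ ρ g v = w) :
    (Gal.restrict (fFamily a t) L).ker = ρ.ker := by
  have : CharZero K := (RingHom.charZero_iff (algebraMap K L).injective).2 inferInstance
  have hroot : ∀ z, z ∈ (fFamily a t).rootSet L ↔ ∃ v, (algebraMap K L a + 1) * c.x v = z := by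
    intro z
    obtain ⟨x, rfl⟩ : ∃ x, (algebraMap K L a + 1) * x = z := ⟨_, mul_div_cancel₀ z hv⟩
    rw [mem_rootSet_of_ne (monic_fFamily t).1.ne_zero, aeval_def, ← eval_map, map_fFamily]
    have h1 := Fval_eq hu hv hw (algebraMap K L t) x
    have h2 := mul_ne_zero (pow_ne_zero 6 hu) (pow_ne_zero 6 hw)
    simp only [mul_right_inj' hv]
    rw [← c.Fval_eq_zero, ← mul_eq_zero_iff_left h2, ← h1, mul_eq_zero_iff_right (pow_ne_zero _ hv)]
  ext g
  rw [MonoidHom.mem_ker, MonoidHom.mem_ker,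
    ← map_eq_one_iff _ (Gal.galActionHom_injective (fFamily a t) L)]
  constructor
  · intro h
    refine LinearEquiv.ext fun v => ?_
    rcases eq_or_ne v 0 with rfl | hv0
    · simp
    · have h1 := Gal.galActionHom_restrict (fFamily a t) L g
        ⟨_, (hroot _).2 ⟨⟨v, hv0⟩, rfl⟩⟩
      rw [h] at h1
      simp only [Equiv.Perm.coe_one, id_eq, map_mul, map_add, AlgEquiv.commutes, map_one] at h1
      exact (hρ g ⟨v, hv0⟩ ⟨v, hv0⟩).1 (mul_left_cancel₀ hv h1).symm
  · intro h
    ext z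
    obtain ⟨v, hv⟩ := (hroot _).1 z.2
    rw [Gal.galActionHom_restrict, ← hv, map_mul, map_add, AlgEquiv.commutes, map_one,
      (hρ g v v).2 (by rw [h]; rfl)]
    exact hv

end

theorem algebraMap_add_intCast_ne_zero {L : Type} [Field L] [Algebra Kαt L] (n : ℤ) :
    algebraMap Kαt L (RatFunc.C (RatFunc.X : RatFunc ℚ)) + n ≠ 0 := by
  let φ : ℚ[X] →+* L := (algebraMap Kαt L).comp (RatFunc.C.comp (algebraMap ℚ[X] (RatFunc ℚ)))
  have hφ : Function.Injective φ := (algebraMap Kαt L).injective.comp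
    (RatFunc.C_injective.comp (RatFunc.algebraMap_injective ℚ))
  have h : φ (X + C (n : ℚ)) = algebraMap Kαt L (RatFunc.C (RatFunc.X : RatFunc ℚ)) + n := by
    rw [map_add, map_intCast, map_intCast]
    simp [φ]
  rw [← h]
  exact (map_ne_zero_iff φ hφ).2 (X_add_C_ne_zero _)

theorem map_dualα {F E : Type*} [Field F] [Field E] (φ : F →+* E) (a : F) :
    φ (dualα a) = dualα (φ a) := by
  simp [dualα, map_ofNat]

theorem map_dualt {F E : Type*} [Field F] [Field E] (φ : F →+* E) (a t : F) :
    φ (dualt a t) = dualt (φ a) (φ t) := by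
  simp [dualt, map_ofNat]

section
variable {K L : Type} [Field K] [Field L] [Algebra K L] [CharZero L] {a t : K}

theorem nonempty_gal_mulEquiv [FiniteDimensional K L] [IsGalois K L]
    (hu : algebraMap K L a - 2 ≠ 0) (hv : algebraMap K L a + 1 ≠ 0)
    (hw : algebraMap K L a + 4 ≠ 0)
    (hplace : ∀ (p : ℕ) [Fact p.Prime] (a₀ t₀ : ℤ),
      Nonempty (FrobeniusPlace (K := K) (algebraMap K L a) (algebraMap K L t) p a₀ t₀))
    (hf : ((fFamily a t).map (algebraMap K L)).Splits)
    (hh : ((fFamily (dualα a) (dualt a t)).map (algebraMap K L)).Splits)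
    (hirr : Configuration (algebraMap K L a) (algebraMap K L t) → Irreducible (fFamily a t)) :
    Nonempty ((fFamily a t).Gal ≃* (V5 ≃ₗ[ZMod 2] V5)) := by
  have hf' := hf
  rw [map_fFamily] at hf' hh
  rw [map_dualα, map_dualt] at hh
  have : Fact (Nat.Prime 881) := ⟨by norm_num⟩
  have : Fact (Nat.Prime 139) := ⟨by norm_num⟩
  have : Fact (Nat.Prime 11) := ⟨by norm_num⟩
  obtain ⟨𝔭⟩ := hplace 881 177 88
  obtain ⟨𝔮⟩ := hplace 139 104 22
  obtain ⟨𝔯⟩ := hplace 11 3 7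
  obtain ⟨c⟩ := 𝔭.nonempty_configuration hu hv hw hf' hh
  obtain ⟨ρ, hρ⟩ := c.exists_representation
  obtain ⟨u, φ, hu0, hφ, hφu, htrans⟩ := 𝔮.exists_transvection c hu hv hw hf' ρ hρ
  obtain ⟨n, hn1, hn5⟩ := 𝔯.exists_pow_five_eq_one c hu hv hw hf' ρ hρ
  have htop : ρ.range = ⊤ := by
    refine eq_top_of_transvection ρ.range (fun v w hv0 hw0 => ?_) u φ hu0 hφ hφu
      ⟨_, ⟨𝔮.σ, rfl⟩, htrans⟩ (ρ 𝔯.σ ^ n) (pow_mem (show ρ 𝔯.σ ∈ ρ.range from ⟨_, rfl⟩) n) hn5 hn1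
    obtain ⟨g, hg⟩ := c.exists_algEquiv hu hv hw (hirr c) ⟨v, hv0⟩ ⟨w, hw0⟩
    exact ⟨_, ⟨g, rfl⟩, (hρ _ _ _).1 hg⟩
  have : Fact ((fFamily a t).map (algebraMap K L)).Splits := ⟨hf⟩
  exact ⟨(QuotientGroup.quotientKerEquivOfSurjective _
    (Gal.restrict_surjective (fFamily a t) L)).symm.trans
    ((QuotientGroup.quotientMulEquivOfEq (c.ker_restrict hu hv hw ρ hρ)).trans
      (QuotientGroup.quotientKerEquivOfSurjective _ (MonoidHom.range_eq_top.1 htop)))⟩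

end

theorem exists_isGalois_splits {K : Type} [Field K] [CharZero K] {f h : K[X]} (hf : f ≠ 0)
    (hh : h ≠ 0) : ∃ (L : Type) (_ : Field L) (_ : Algebra K L), CharZero L ∧
      FiniteDimensional K L ∧ IsGalois K L ∧
      (f.map (algebraMap K L)).Splits ∧ (h.map (algebraMap K L)).Splits := by
  obtain ⟨L, _, _, _⟩ : ∃ (L : Type) (_ : Field L) (_ : Algebra K L),
      IsSplittingField K L (f * h) :=
    ⟨SplittingField (f * h), inferInstance, inferInstance, IsSplittingField.splittingField _⟩
  have hP := IsSplittingField.splits L (f * h)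
  have hP0 : (f * h).map (algebraMap K L) ≠ 0 := Polynomial.map_ne_zero (mul_ne_zero hf hh)
  have : Normal K L := Normal.of_isSplittingField (f * h)
  have : FiniteDimensional K L := IsSplittingField.finiteDimensional L (f * h)
  exact ⟨L, inferInstance, inferInstance,
    (RingHom.charZero_iff (algebraMap K L).injective).1 inferInstance, inferInstance, ⟨⟩,
    hP.of_dvd hP0 (Polynomial.map_dvd _ (dvd_mul_right _ _)),
    hP.of_dvd hP0 (Polynomial.map_dvd _ (dvd_mul_left _ _))⟩

/-- The polynomial `f(x, α, t)` has degree 31 in `x` and its Galois group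
over `ℚ(α, t)` is isomorphic to `PSL₅(𝔽₂)`, the projective special linear group of degree 5
over the field with two elements. -/
theorem galoisGroup_fFamily_eq_PSL52 :
    (fFamily (RatFunc.C RatFunc.X : RatFunc (RatFunc ℚ)) RatFunc.X).natDegree = 31 ∧
    Nonempty ((fFamily (RatFunc.C RatFunc.X : RatFunc (RatFunc ℚ)) RatFunc.X).Gal ≃*
      Matrix.ProjectiveSpecialLinearGroup (Fin 5) (ZMod 2)) := by
  refine ⟨(monic_fFamily _).2, ?_⟩
  obtain ⟨L, _, _, _, _, _, hf, hh⟩ := exists_isGalois_splits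
    (monic_fFamily (a := (RatFunc.C RatFunc.X : Kαt)) RatFunc.X).1.ne_zero
    (monic_fFamily (a := dualα (RatFunc.C RatFunc.X : Kαt))
      (dualt (RatFunc.C RatFunc.X) RatFunc.X)).1.ne_zero
  have hu := algebraMap_add_intCast_ne_zero (L := L) (-2)
  have hv := algebraMap_add_intCast_ne_zero (L := L) 1
  have hw := algebraMap_add_intCast_ne_zero (L := L) 4
  rw [Int.cast_neg, ← sub_eq_add_neg, Int.cast_ofNat] at hu
  rw [Int.cast_one] at hv
  rw [Int.cast_ofNat] at hw
  have hf' := hf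
  rw [map_fFamily] at hf'
  obtain ⟨e⟩ := nonempty_gal_mulEquiv hu hv hw (fun p _ => nonempty_frobeniusPlace L p) hf hh
    (fun c => irreducible_fFamily _ hf' (c.eval_ne_zero hu hv hw))
  obtain ⟨e'⟩ := nonempty_linearEquiv_mulEquiv
  exact ⟨e.trans e'⟩

end PSL52Family
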